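/- There exist a constant C > 0 and a positive integer x₀ such that S(x) ≤ C ln ln x for every integer x ≥ x₀ (i.e., S(x) ≪ ln ln x). -/

import Mathlib

open scoped Classical

/-- The largest element of ℙ*₁ = ℙ* ∪ {1} (prime-powers together with 1) not exceeding `x`. -/
noncomputable def q (x : ℕ) : ℕ :=
  sSup {m : ℕ | (IsPrimePow m ∨ m = 1) ∧ m ≤ x}

/-- The prime-power map. -/
noncomputable def P (x : ℕ) : ℕ :=
  if x = 1 then 1
  else if IsPrimePow x then x / x.minFac
  else x - q x

/-- The orbit of `x` under `P`: `orbit x 1 = x` and `orbit x (n+1) = P (orbit x n)`. -/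
noncomputable def orbit (x n : ℕ) : ℕ := P^[n - 1] x

/-- The transient length `T x = min {n ≥ 1 : x_n = 1}`. -/
noncomputable def T (x : ℕ) : ℕ := sInf {n : ℕ | 1 ≤ n ∧ orbit x n = 1}

/-- The settling time `S x = min {n ≥ 1 : x_n ∈ ℙ*₁}`. -/
noncomputable def S (x : ℕ) : ℕ :=
  sInf {n : ℕ | 1 ≤ n ∧ (IsPrimePow (orbit x n) ∨ orbit x n = 1)}

namespace PrimeGap
open Real Finset
open scoped ArithmeticFunction.vonMangoldt

/-- The positive integers `n` with `v < log n ≤ v + θ`. -/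
noncomputable def win (v θ : ℝ) : Finset ℕ := Ioc ⌊exp v⌋₊ ⌊exp (v + θ)⌋₊

lemma mem_win {v θ : ℝ} {n : ℕ} : n ∈ win v θ ↔ 0 < n ∧ v < log n ∧ log n ≤ v + θ := by
  unfold win
  rw [mem_Ioc]
  constructor
  · rintro ⟨h1, h2⟩
    have hn : 0 < n := by omega
    have hn' : (0 : ℝ) < n := by exact_mod_cast hn
    rw [Nat.floor_lt (exp_pos _).le] at h1
    rw [Nat.le_floor_iff (exp_pos _).le] at h2
    exact ⟨hn, (lt_log_iff_exp_lt hn').2 h1, (log_le_iff_le_exp hn').2 h2⟩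
  · rintro ⟨hn, h1, h2⟩
    have hn' : (0 : ℝ) < n := by exact_mod_cast hn
    rw [Nat.floor_lt (exp_pos _).le, Nat.le_floor_iff (exp_pos _).le]
    exact ⟨(lt_log_iff_exp_lt hn').1 h1, (log_le_iff_le_exp hn').1 h2⟩

lemma log_add_one_le {a : ℕ} (ha : 1 ≤ a) : log ((a : ℝ) + 1) ≤ log a + 1 / a := by
  have ha' : (1 : ℝ) ≤ a := by exact_mod_cast ha
  have h : (a : ℝ) + 1 = a * (1 + 1 / a) := by field_simp
  rw [h, log_mul (by positivity) (by positivity)]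
  have := log_le_sub_one_of_pos (show (0 : ℝ) < 1 + 1 / a by positivity)
  linarith

lemma sum_one_div_le {a b : ℕ} (ha : 1 ≤ a) (hab : a ≤ b) :
    ∑ n ∈ Ioc a b, (1 : ℝ) / n ≤ log b - log a := by
  induction b, hab using Nat.le_induction with
  | base => simp
  | succ b hb ih =>
    rw [← insert_Ioc_right_eq_Ioc_add_one hb, sum_insert (by simp)]
    have hb' : (1 : ℝ) ≤ b := by exact_mod_cast ha.trans hb
    have h := one_sub_inv_le_log_of_pos (show (0 : ℝ) < ((b : ℝ) + 1) / b by positivity)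
    rw [log_div (by positivity) (by positivity)] at h
    have h2 : 1 - (((b : ℝ) + 1) / b)⁻¹ = 1 / (b + 1) := by field_simp; ring
    push_cast
    linarith

lemma le_sum_one_div {a b : ℕ} (hab : a ≤ b) :
    log (b + 1) - log (a + 1) ≤ ∑ n ∈ Ioc a b, (1 : ℝ) / n := by
  induction b, hab using Nat.le_induction with
  | base => simp
  | succ b hb ih =>
    rw [← insert_Ioc_right_eq_Ioc_add_one hb, sum_insert (by simp)]
    have h := log_add_one_le (show 1 ≤ b + 1 by omega)
    push_cast at *
    linarith

lemma sum_win_one_div {v θ : ℝ} (h0 : 0 ≤ θ) (h1 : θ ≤ 1) :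
    |∑ n ∈ win v θ, (1 : ℝ) / n - θ| ≤ 4 * exp (-v) := by
  set a := ⌊exp v⌋₊ with ha
  set b := ⌊exp (v + θ)⌋₊ with hb
  have hab : a ≤ b := Nat.floor_le_floor (exp_le_exp.2 (by linarith))
  have hwin : win v θ = Ioc a b := rfl
  rw [hwin]
  have hb1 : (b : ℝ) ≤ exp (v + θ) := Nat.floor_le (exp_pos _).le
  have ha1 : (a : ℝ) ≤ exp v := Nat.floor_le (exp_pos _).le
  have ha2 : exp v < a + 1 := Nat.lt_floor_add_one _
  have hb2 : exp (v + θ) < b + 1 := Nat.lt_floor_add_one _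
  rcases Nat.eq_zero_or_pos a with h | h
  · have hv : v < 0 := by
      rw [h] at ha2
      rw [← exp_lt_one_iff]; simpa using ha2
    have hb3 : b ≤ 2 := by
      have : (b : ℝ) < 3 := by
        calc (b : ℝ) ≤ exp (v + θ) := hb1
          _ ≤ exp 1 := exp_le_exp.2 (by linarith)
          _ < 3 := by linarith [exp_one_lt_d9]
      have : b < 3 := by exact_mod_cast this
      omega
    have hs0 : 0 ≤ ∑ n ∈ Ioc a b, (1 : ℝ) / n := sum_nonneg fun _ _ => by positivity
    have hs1 : ∑ n ∈ Ioc a b, (1 : ℝ) / n ≤ 3 / 2 := by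
      rw [h]
      interval_cases b <;> norm_num [Finset.sum_Ioc_succ_top]
    have : 1 ≤ exp (-v) := one_le_exp (by linarith)
    rw [abs_le]; constructor <;> linarith
  · have ha3 : (1 : ℝ) ≤ a := by exact_mod_cast h
    have hu := sum_one_div_le h hab
    have hl := le_sum_one_div hab
    have e1 : log b ≤ v + θ := by
      rw [log_le_iff_le_exp (by exact_mod_cast lt_of_lt_of_le h hab)]; exact hb1
    have e2 : v ≤ log (a + 1) := by
      rw [le_log_iff_exp_le (by positivity)]; exact ha2.le
    have e3 : v + θ ≤ log (b + 1) := by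
      rw [le_log_iff_exp_le (by positivity)]; exact hb2.le
    have e4 : log a ≤ v := by
      rw [log_le_iff_le_exp (by positivity)]; exact ha1
    have e5 := log_add_one_le h
    have e6 : 1 / (a : ℝ) ≤ 2 * exp (-v) := by
      rw [exp_neg, div_le_iff₀ (by positivity)]
      have : exp v * (exp v)⁻¹ = 1 := mul_inv_cancel₀ (exp_pos v).ne'
      have h3 : 0 < (exp v)⁻¹ := by positivity
      nlinarith
    have := exp_pos (-v)
    rw [abs_le]; constructor <;> linarith

lemma sum_win_mul {k : ℕ} (hk : 0 < k) (v θ : ℝ) (g : ℕ → ℝ) :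
    ∑ n ∈ win v θ with k ∣ n, g n = ∑ m ∈ win (v - log k) θ, g (k * m) := by
  symm
  have hk' : (k : ℝ) ≠ 0 := by positivity
  apply sum_bij (fun m _ => k * m)
  · intro m hm
    rw [mem_win] at hm
    have hm' : (m : ℝ) ≠ 0 := by have := hm.1; positivity
    rw [mem_filter, mem_win]
    push_cast
    rw [log_mul hk' hm']
    refine ⟨⟨Nat.mul_pos hk hm.1, ?_, ?_⟩, dvd_mul_right _ _⟩ <;> linarith [hm.2.1, hm.2.2]
  · intro m _ m' _ h
    exact Nat.eq_of_mul_eq_mul_left hk h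
  · intro n hn
    rw [mem_filter, mem_win] at hn
    obtain ⟨⟨h1, h2, h3⟩, m, rfl⟩ := hn
    have hm : 0 < m := Nat.pos_of_mul_pos_left h1
    have hm' : (m : ℝ) ≠ 0 := by positivity
    push_cast at h2 h3
    rw [log_mul hk' hm'] at h2 h3
    exact ⟨m, mem_win.2 ⟨hm, by linarith, by linarith⟩, rfl⟩
  · intros; rfl

lemma sum_win_dvd {k : ℕ} (hk : 0 < k) {v θ : ℝ} (h0 : 0 ≤ θ) (h1 : θ ≤ 1) :
    |∑ n ∈ win v θ with k ∣ n, (1 : ℝ) / n - θ / k| ≤ 4 * exp (-v) := by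
  rw [sum_win_mul hk v θ (fun n => (1 : ℝ) / n)]
  have hk' : (0 : ℝ) < k := by positivity
  have h := sum_win_one_div (v := v - log k) h0 h1
  have e : ∑ m ∈ win (v - log k) θ, (1 : ℝ) / ((k * m : ℕ) : ℝ) - θ / k
      = (1 / k) * (∑ n ∈ win (v - log k) θ, (1 : ℝ) / n - θ) := by
    rw [mul_sub, mul_sum]
    congr 1
    · apply sum_congr rfl; intro m _; push_cast; rw [one_div_mul_one_div]
    · ring
  rw [e, abs_mul, abs_of_pos (by positivity)]
  have e2 : exp (-(v - log k)) = exp (-v) * k := by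
    rw [neg_sub, sub_eq_add_neg, exp_add, exp_log hk', mul_comm]
  rw [e2] at h
  calc 1 / (k : ℝ) * _ ≤ 1 / k * (4 * (exp (-v) * k)) := by gcongr
    _ = 4 * exp (-v) := by field_simp

/-- The weighted prime-power counting function `∑_{log n ≤ v} Λ(n) / n`. -/
noncomputable def mert (v : ℝ) : ℝ := ∑ n ∈ Ioc 0 ⌊exp v⌋₊, Λ n / n

lemma sum_vonMangoldt_div {M : ℕ} (hM : 1 ≤ M) :
    -1 ≤ ∑ n ∈ Ioc 0 M, Λ n / n - log M ∧ ∑ n ∈ Ioc 0 M, Λ n / n - log M ≤ 6 := by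
  have hM' : (1 : ℝ) ≤ M := by exact_mod_cast hM
  have h1 : log (M.factorial) = ∑ n ∈ Ioc 0 M, Λ n * ((M / n : ℕ) : ℝ) := by
    have h := ArithmeticFunction.sum_Ioc_mul_zeta_eq_sum (ArithmeticFunction.vonMangoldt) M
    rw [ArithmeticFunction.vonMangoldt_mul_zeta] at h
    rw [← h]
    clear h hM hM'
    induction M with
    | zero => simp
    | succ M ih =>
      rw [Nat.factorial_succ, ← insert_Ioc_right_eq_Ioc_add_one (Nat.zero_le M), sum_insert (by simp), ← ih]
      push_cast
      rw [log_mul (by positivity) (by positivity), ArithmeticFunction.log_apply]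
      push_cast; rfl
  have h2 : M * log M - M ≤ log (M.factorial) := by
    have := Stirling.le_log_factorial_stirling (n := M) (by omega)
    have h3 : 0 ≤ log M := log_nonneg hM'
    have h4 : 0 ≤ log (2 * π) := log_nonneg (by linarith [pi_gt_three])
    linarith
  have h3 : log (M.factorial) ≤ M * log M := by
    rw [← log_pow]
    exact log_le_log (by positivity) (by exact_mod_cast Nat.factorial_le_pow M)
  have hpsi : ∑ n ∈ Ioc 0 M, Λ n ≤ (log 4 + 4) * M := by
    have := Chebyshev.psi_le_const_mul_self (x := (M : ℝ)) (by positivity)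
    simpa [Chebyshev.psi] using this
  have hlog4 : log 4 ≤ 2 := by
    rw [show (4 : ℝ) = 2 ^ 2 by norm_num, log_pow]
    push_cast; linarith [log_two_lt_d9]
  have h5 : log (M.factorial) ≤ M * ∑ n ∈ Ioc 0 M, Λ n / n := by
    rw [h1, mul_sum]
    apply sum_le_sum
    intro n hn
    have h := Nat.cast_div_le (α := ℝ) (m := M) (n := n)
    have := ArithmeticFunction.vonMangoldt_nonneg (n := n)
    calc Λ n * ((M / n : ℕ) : ℝ) ≤ Λ n * (M / n) := by gcongr
      _ = _ := by ring
  have h6 : M * ∑ n ∈ Ioc 0 M, Λ n / n ≤ log (M.factorial) + ∑ n ∈ Ioc 0 M, Λ n := by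
    rw [h1, mul_sum, ← sum_add_distrib]
    apply sum_le_sum
    intro n hn
    have hn0 : 0 < n := (mem_Ioc.1 hn).1
    have h : (M : ℝ) / n ≤ ((M / n : ℕ) : ℝ) + 1 := by
      rw [← Nat.floor_div_eq_div (K := ℝ)]
      exact (Nat.lt_floor_add_one _).le
    have := ArithmeticFunction.vonMangoldt_nonneg (n := n)
    calc M * (Λ n / n) = Λ n * (M / n) := by ring
      _ ≤ Λ n * (((M / n : ℕ) : ℝ) + 1) := by gcongr
      _ = _ := by ring
  constructor <;> nlinarith

lemma abs_mert_sub_le {v : ℝ} (hv : 0 ≤ v) : |mert v - v| ≤ 6 := by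
  unfold mert
  set M := ⌊exp v⌋₊ with hM
  have hM1 : 1 ≤ M := Nat.le_floor (by simpa using one_le_exp hv)
  have hM' : (1 : ℝ) ≤ M := by exact_mod_cast hM1
  have h := sum_vonMangoldt_div hM1
  have e1 : log M ≤ v := by
    rw [log_le_iff_le_exp (by positivity)]; exact Nat.floor_le (exp_pos _).le
  have e2 : v ≤ log (M + 1) := by
    rw [le_log_iff_exp_le (by positivity)]; exact (Nat.lt_floor_add_one _).le
  have e3 := log_add_one_le hM1
  have e4 : 1 / (M : ℝ) ≤ 1 := by rw [div_le_one (by positivity)]; exact hM'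
  rw [abs_le]; constructor <;> linarith [h.1, h.2]

lemma mert_mono : Monotone mert := by
  intro a b hab
  unfold mert
  apply sum_le_sum_of_subset_of_nonneg
  · exact Ioc_subset_Ioc_right (Nat.floor_le_floor (exp_le_exp.2 hab))
  · intros
    have := ArithmeticFunction.vonMangoldt_nonneg (n := ‹ℕ›)
    positivity

lemma sum_win_vonMangoldt (v : ℝ) {θ : ℝ} (h : 0 ≤ θ) :
    ∑ n ∈ win v θ, Λ n / n = mert (v + θ) - mert v := by
  unfold mert win
  have hab : ⌊exp v⌋₊ ≤ ⌊exp (v + θ)⌋₊ := Nat.floor_le_floor (exp_le_exp.2 (by linarith))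
  rw [eq_sub_iff_add_eq', ← sum_union]
  · congr 1
    ext n; simp only [mem_union, mem_Ioc]; omega
  · rw [disjoint_left]; intro n; simp only [mem_Ioc]; omega

end PrimeGap

namespace PrimeGap
open Finset
open scoped ArithmeticFunction.Moebius

lemma sum_divisors_filter_dvd_moebius {l m : ℕ} (hm : Squarefree m) :
    ∑ d ∈ m.divisors with l ∣ d, (μ d : ℝ) = if m = l then (μ l : ℝ) else 0 := by
  by_cases hl : l ∣ m
  · obtain ⟨k, rfl⟩ := hl
    have h0 : l * k ≠ 0 := hm.ne_zero
    have hl0 : l ≠ 0 := left_ne_zero_of_mul h0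
    have hk0 : k ≠ 0 := right_ne_zero_of_mul h0
    have hcop : Nat.Coprime l k := Nat.coprime_of_squarefree_mul hm
    have e : ∑ d ∈ (l * k).divisors with l ∣ d, (μ d : ℝ) = ∑ e ∈ k.divisors, (μ (l * e) : ℝ) := by
      symm
      apply sum_bij (fun e _ => l * e)
      · intro e he
        rw [Nat.mem_divisors] at he
        rw [mem_filter, Nat.mem_divisors]
        exact ⟨⟨mul_dvd_mul_left l he.1, h0⟩, dvd_mul_right _ _⟩
      · intro a _ b _ h
        exact Nat.eq_of_mul_eq_mul_left (Nat.pos_of_ne_zero hl0) h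
      · intro d hd
        rw [mem_filter, Nat.mem_divisors] at hd
        obtain ⟨⟨h1, _⟩, e, rfl⟩ := hd
        exact ⟨e, Nat.mem_divisors.2 ⟨Nat.dvd_of_mul_dvd_mul_left (Nat.pos_of_ne_zero hl0) h1, hk0⟩, rfl⟩
      · intros; rfl
    have e2 : ∑ e ∈ k.divisors, (μ (l * e) : ℝ) = μ l * ∑ e ∈ k.divisors, (μ e : ℝ) := by
      rw [mul_sum]
      apply sum_congr rfl
      intro e he
      rw [ArithmeticFunction.isMultiplicative_moebius.map_mul_of_coprime
        (hcop.coprime_dvd_right (Nat.dvd_of_mem_divisors he))]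
      push_cast; rfl
    have e3 : ∑ e ∈ k.divisors, (μ e : ℝ) = if k = 1 then 1 else 0 := by
      have h := congrArg (fun f : ArithmeticFunction ℤ => f k) ArithmeticFunction.moebius_mul_coe_zeta
      simp only [ArithmeticFunction.coe_mul_zeta_apply, ArithmeticFunction.one_apply] at h
      rw [← Int.cast_sum, h]
      split_ifs <;> simp
    rw [e, e2, e3]
    by_cases hk : k = 1
    · subst hk; simp
    · have : l * k ≠ l := by
        intro h
        exact hk (Nat.eq_of_mul_eq_mul_left (Nat.pos_of_ne_zero hl0) (by omega))
      rw [if_neg hk, if_neg this, mul_zero]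
  · have : m ≠ l := by rintro rfl; exact hl dvd_rfl
    rw [if_neg this]
    apply sum_eq_zero
    intro d hd
    rw [mem_filter, Nat.mem_divisors] at hd
    exact absurd (hd.2.trans hd.1.1) hl

section
variable (s : BoundingSieve) (R : ℕ)

/-- Selberg's sum `∑ h(l)` over the sifting divisors `l ≤ R`. -/
noncomputable def selSum : ℝ := ∑ l ∈ s.prodPrimes.divisors with l ≤ R, s.selbergTerms l

/-- The optimal weights of Selberg's sieve of level `R`. -/
noncomputable def selWt (d : ℕ) : ℝ :=
  if d ∣ s.prodPrimes then
    (μ d : ℝ) / (s.nu d * selSum s R) * ∑ l ∈ s.prodPrimes.divisors with l ≤ R ∧ d ∣ l, s.selbergTerms l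
  else 0

variable {s R}

lemma selSum_pos (hR : 1 ≤ R) : 0 < selSum s R := by
  apply sum_pos
  · intro l hl
    exact s.selbergTerms_pos (Nat.dvd_of_mem_divisors (mem_filter.1 hl).1)
  · exact ⟨1, mem_filter.2 ⟨Nat.mem_divisors.2 ⟨one_dvd _, s.prodPrimes_ne_zero⟩, hR⟩⟩

lemma selWt_one (hR : 1 ≤ R) : selWt s R 1 = 1 := by
  unfold selWt
  have h := (selSum_pos (s := s) hR).ne'
  simp only [isUnit_one, IsUnit.dvd, ↓reduceIte, s.nu_mult.map_one, and_true,
    ArithmeticFunction.moebius_apply_one, one_mul]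
  rw [← selSum]
  push_cast
  field_simp

lemma selWt_of_lt {d : ℕ} (hd : R < d) : selWt s R d = 0 := by
  unfold selWt
  split_ifs
  · rw [sum_eq_zero, mul_zero]
    intro l hl
    rw [mem_filter, Nat.mem_divisors] at hl
    have := Nat.le_of_dvd (Nat.pos_of_ne_zero (by rintro rfl; simp_all)) hl.2.2
    omega
  · rfl

lemma selWt_of_not_dvd {d : ℕ} (hd : ¬ d ∣ s.prodPrimes) : selWt s R d = 0 := by
  unfold selWt
  rw [if_neg hd]

lemma abs_selWt_le {d : ℕ} (hR : 1 ≤ R) (hd : d ∣ s.prodPrimes) :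
    |selWt s R d| ≤ s.selbergTerms d / s.nu d := by
  have hH := selSum_pos (s := s) hR
  have hν := s.nu_pos_of_dvd_prodPrimes hd
  have hh := s.selbergTerms_pos hd
  have hd0 : 0 < d := Nat.pos_of_dvd_of_pos hd (Nat.pos_of_ne_zero s.prodPrimes_ne_zero)
  have key : ∑ l ∈ s.prodPrimes.divisors with l ≤ R ∧ d ∣ l, s.selbergTerms l
      ≤ s.selbergTerms d * selSum s R := by
    unfold selSum
    rw [mul_sum]
    have hcop : ∀ l ∈ {l ∈ s.prodPrimes.divisors | l ≤ R ∧ d ∣ l}, Nat.Coprime d (l / d) := by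
      intro l hl
      rw [mem_filter, Nat.mem_divisors] at hl
      obtain ⟨⟨h1, _⟩, _, k, rfl⟩ := hl
      rw [Nat.mul_div_cancel_left _ hd0]
      exact Nat.coprime_of_squarefree_mul (s.squarefree_of_dvd_prodPrimes h1)
    calc ∑ l ∈ s.prodPrimes.divisors with l ≤ R ∧ d ∣ l, s.selbergTerms l
        = ∑ l ∈ s.prodPrimes.divisors with l ≤ R ∧ d ∣ l, s.selbergTerms d * s.selbergTerms (l / d) := by
          apply sum_congr rfl
          intro l hl
          rw [← s.selbergTerms_isMultiplicative.map_mul_of_coprime (hcop l hl),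
            Nat.mul_div_cancel' (mem_filter.1 hl).2.2]
      _ = ∑ k ∈ {l ∈ s.prodPrimes.divisors | l ≤ R ∧ d ∣ l}.image (fun l => l / d),
            s.selbergTerms d * s.selbergTerms k := by
          rw [sum_image]
          intro a ha b hb h
          have ha' := Nat.mul_div_cancel' (mem_filter.1 ha).2.2
          have hb' := Nat.mul_div_cancel' (mem_filter.1 hb).2.2
          simp only at h
          rw [← ha', ← hb', h]
      _ ≤ _ := by
          apply sum_le_sum_of_subset_of_nonneg
          · intro k hk
            rw [mem_image] at hk
            obtain ⟨l, hl, rfl⟩ := hk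
            rw [mem_filter, Nat.mem_divisors] at hl
            rw [mem_filter, Nat.mem_divisors]
            exact ⟨⟨(Nat.div_dvd_of_dvd hl.2.2).trans hl.1.1, hl.1.2⟩,
              (Nat.div_le_self _ _).trans hl.2.1⟩
          · intro k hk _
            have := s.selbergTerms_pos (Nat.dvd_of_mem_divisors (mem_filter.1 hk).1)
            positivity
  have hnn : 0 ≤ ∑ l ∈ s.prodPrimes.divisors with l ≤ R ∧ d ∣ l, s.selbergTerms l :=
    sum_nonneg fun l hl => (s.selbergTerms_pos (Nat.dvd_of_mem_divisors (mem_filter.1 hl).1)).le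
  unfold selWt
  rw [if_pos hd, abs_mul, abs_div, abs_of_nonneg hnn, abs_of_pos (by positivity : 0 < s.nu d * selSum s R)]
  have hμ : |(μ d : ℝ)| ≤ 1 := by
    have := ArithmeticFunction.abs_moebius_le_one (n := d)
    exact_mod_cast this
  calc _ ≤ 1 / (s.nu d * selSum s R) * (s.selbergTerms d * selSum s R) := by gcongr
    _ = _ := by field_simp

lemma mainSum_selWt (hR : 1 ≤ R) :
    s.mainSum (BoundingSieve.lambdaSquared (selWt s R)) = 1 / selSum s R := by
  have hH := selSum_pos (s := s) hR
  rw [s.mainSum_lambdaSquared_eq_sum_mul_sum_sq]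
  have key : ∀ l ∈ s.prodPrimes.divisors,
      (∑ d ∈ s.prodPrimes.divisors, if l ∣ d then s.nu d * selWt s R d else 0)
        = if l ≤ R then μ l * s.selbergTerms l / selSum s R else 0 := by
    intro l hl
    calc (∑ d ∈ s.prodPrimes.divisors, if l ∣ d then s.nu d * selWt s R d else 0)
        = ∑ d ∈ s.prodPrimes.divisors, ∑ m ∈ s.prodPrimes.divisors,
            if l ∣ d ∧ m ≤ R ∧ d ∣ m then μ d * s.selbergTerms m / selSum s R else 0 := by
          apply sum_congr rfl
          intro d hd
          have hdP := Nat.dvd_of_mem_divisors hd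
          have hν := s.nu_pos_of_dvd_prodPrimes hdP
          unfold selWt
          rw [if_pos hdP]
          split_ifs with h
          · rw [sum_filter, mul_sum, mul_sum]
            apply sum_congr rfl
            intro m _
            simp only [h, true_and]
            split_ifs
            · field_simp
            · simp
          · simp [h]
      _ = ∑ m ∈ s.prodPrimes.divisors, if m ≤ R then
            s.selbergTerms m / selSum s R * (∑ d ∈ m.divisors with l ∣ d, (μ d : ℝ)) else 0 := by
          rw [sum_comm]
          apply sum_congr rfl
          intro m hm
          rw [Nat.mem_divisors] at hm
          split_ifs with h
          · rw [mul_sum]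
            simp only [h, true_and]
            rw [← sum_filter]
            have : {d ∈ s.prodPrimes.divisors | l ∣ d ∧ d ∣ m} = {d ∈ m.divisors | l ∣ d} := by
              ext d
              simp only [mem_filter, Nat.mem_divisors]
              have h0 : m ≠ 0 := ne_zero_of_dvd_ne_zero hm.2 hm.1
              constructor
              · rintro ⟨_, h1, h2⟩; exact ⟨⟨h2, h0⟩, h1⟩
              · rintro ⟨⟨h2, _⟩, h1⟩; exact ⟨⟨h2.trans hm.1, hm.2⟩, h1, h2⟩
            rw [this]
            apply sum_congr rfl
            intro d _
            ring
          · simp [h]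
      _ = _ := by
          have : ∀ m ∈ s.prodPrimes.divisors, (if m ≤ R then
            s.selbergTerms m / selSum s R * (∑ d ∈ m.divisors with l ∣ d, (μ d : ℝ)) else 0)
              = if m = l then (if l ≤ R then μ l * s.selbergTerms l / selSum s R else 0) else 0 := by
            intro m hm
            rw [sum_divisors_filter_dvd_moebius
              (s.squarefree_of_dvd_prodPrimes (Nat.dvd_of_mem_divisors hm))]
            by_cases hml : m = l
            · subst hml; simp only [if_true]; split_ifs <;> ring
            · simp [hml]
          rw [sum_congr rfl this, sum_ite_eq_of_mem' _ _ _ hl]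
  have : ∀ l ∈ s.prodPrimes.divisors, (s.selbergTerms l)⁻¹ *
        (∑ d ∈ s.prodPrimes.divisors, if l ∣ d then s.nu d * selWt s R d else 0) ^ 2
      = if l ≤ R then s.selbergTerms l / selSum s R ^ 2 else 0 := by
    intro l hl
    rw [key l hl]
    have hp := s.selbergTerms_pos (Nat.dvd_of_mem_divisors hl)
    split_ifs
    · have hμ : (μ l : ℝ) ^ 2 = 1 := by
        have := ArithmeticFunction.moebius_sq_eq_one_of_squarefree
          (s.squarefree_of_dvd_prodPrimes (Nat.dvd_of_mem_divisors hl))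
        exact_mod_cast this
      rw [div_pow, mul_pow, hμ]
      field_simp
    · simp
  rw [sum_congr rfl this, ← sum_filter, ← sum_div]
  rw [← selSum]
  field_simp

lemma sum_sum_selWt (hR : 1 ≤ R) :
    ∑ a ∈ s.prodPrimes.divisors, ∑ b ∈ s.prodPrimes.divisors,
      selWt s R a * selWt s R b * s.nu (a.lcm b) = 1 / selSum s R := by
  rw [← mainSum_selWt hR, s.mainSum_lambdaSquared_eq_sum_sum_mul]
  apply sum_congr rfl
  intro a ha
  apply sum_congr rfl
  intro b hb
  rw [s.nu_mult.map_lcm]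
  · ring
  · exact (s.nu_pos_of_dvd_prodPrimes ((Nat.gcd_dvd_left a b).trans (Nat.dvd_of_mem_divisors ha))).ne'

end
end PrimeGap

namespace PrimeGap
open Real Finset
open scoped ArithmeticFunction.Moebius ArithmeticFunction.vonMangoldt

/-- The completely multiplicative function `n ↦ n ^ a`. -/
noncomputable def rpowHom (a : ℝ) : ℕ →* ℝ where
  toFun n := (n : ℝ) ^ a
  map_one' := by simp
  map_mul' m n := by push_cast; exact mul_rpow (Nat.cast_nonneg _) (Nat.cast_nonneg _)

/-- The local density `1 - (1 - 1/p)(1 - p^{-1-σ})`. -/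
noncomputable def nuP (σ : ℝ) (p : ℕ) : ℝ := 1 - (1 - 1 / p) * (1 - (p : ℝ) ^ (-(1 + σ)))

lemma prime_rpow_bounds {σ : ℝ} (hσ : 0 < σ) {p : ℕ} (hp : p.Prime) :
    0 < (p : ℝ) ^ (-(1 + σ)) ∧ (p : ℝ) ^ (-(1 + σ)) ≤ 1 / p := by
  have h2 : (2 : ℝ) ≤ p := by exact_mod_cast hp.two_le
  refine ⟨by positivity, ?_⟩
  rw [one_div, ← rpow_neg_one]
  exact rpow_le_rpow_of_exponent_le (by linarith) (by linarith)

lemma inv_prime_le {p : ℕ} (hp : p.Prime) : (0 : ℝ) < 1 / p ∧ 1 / (p : ℝ) ≤ 1 / 2 := by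
  have h2 : (2 : ℝ) ≤ p := by exact_mod_cast hp.two_le
  exact ⟨by positivity, one_div_le_one_div_of_le (by norm_num) h2⟩

lemma nuP_bounds {σ : ℝ} (hσ : 0 < σ) {p : ℕ} (hp : p.Prime) :
    0 < nuP σ p ∧ (1 - 1 / (p : ℝ)) ^ 2 ≤ 1 - nuP σ p ∧ nuP σ p ≤ 2 / p - 1 / p ^ 2 := by
  obtain ⟨h1, h2⟩ := prime_rpow_bounds hσ hp
  obtain ⟨h3, h4⟩ := inv_prime_le hp
  have h6 : (2 : ℝ) / p - 1 / p ^ 2 = 2 * (1 / p) - (1 / p) ^ 2 := by ring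
  rw [h6]
  unfold nuP
  refine ⟨by nlinarith, by nlinarith, by nlinarith⟩

/-- The sieving data used to build the weights. -/
noncomputable def sieve (y : ℕ) (σ : ℝ) (hσ : 0 < σ) : BoundingSieve where
  support := ∅
  prodPrimes := primorial y
  prodPrimes_squarefree := squarefree_primorial y
  weights := fun _ => 0
  weights_nonneg := fun _ => le_rfl
  totalMass := 0
  nu := ArithmeticFunction.prodPrimeFactors (nuP σ)
  nu_mult := ArithmeticFunction.IsMultiplicative.prodPrimeFactors _
  nu_pos_of_prime := fun p hp _ => by
    rw [ArithmeticFunction.prodPrimeFactors_apply hp.ne_zero, hp.primeFactors, prod_singleton]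
    exact (nuP_bounds hσ hp).1
  nu_lt_one_of_prime := fun p hp _ => by
    rw [ArithmeticFunction.prodPrimeFactors_apply hp.ne_zero, hp.primeFactors, prod_singleton]
    obtain ⟨h3, h4⟩ := inv_prime_le hp
    nlinarith [(nuP_bounds hσ hp).2.1]

section
variable {y : ℕ} {σ : ℝ} (hσ : 0 < σ)

lemma sieve_nu_prime {p : ℕ} (hp : p.Prime) : (sieve y σ hσ).nu p = nuP σ p := by
  change ArithmeticFunction.prodPrimeFactors (nuP σ) p = _
  rw [ArithmeticFunction.prodPrimeFactors_apply hp.ne_zero, hp.primeFactors, prod_singleton]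

lemma sieve_selbergTerms_prime {p : ℕ} (hp : p.Prime) :
    (sieve y σ hσ).selbergTerms p = nuP σ p / (1 - nuP σ p) := by
  rw [BoundingSieve.selbergTerms_apply, hp.primeFactors, prod_singleton, sieve_nu_prime hσ hp,
    div_eq_mul_inv]

lemma one_sub_nuP_pos {σ : ℝ} (hσ : 0 < σ) {p : ℕ} (hp : p.Prime) : 1 / 4 ≤ 1 - nuP σ p := by
  obtain ⟨h3, h4⟩ := inv_prime_le hp
  nlinarith [(nuP_bounds hσ hp).2.1]

lemma one_add_selbergTerms_prime {p : ℕ} (hp : p.Prime) :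
    1 + (sieve y σ hσ).selbergTerms p = (1 - 1 / (p : ℝ))⁻¹ * (1 - (p : ℝ) ^ (-(1 + σ)))⁻¹ := by
  rw [sieve_selbergTerms_prime hσ hp, ← mul_inv]
  have h := one_sub_nuP_pos hσ hp
  have e : (1 - 1 / (p : ℝ)) * (1 - (p : ℝ) ^ (-(1 + σ))) = 1 - nuP σ p := by unfold nuP; ring
  rw [e]
  field_simp
  ring

lemma selbergTerms_prime_le {p : ℕ} (hp : p.Prime) :
    (sieve y σ hσ).selbergTerms p ≤ 6 / p := by
  rw [sieve_selbergTerms_prime hσ hp]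
  have h := one_sub_nuP_pos hσ hp
  obtain ⟨h1, h2, h3⟩ := nuP_bounds hσ hp
  have hp2 : (2 : ℝ) ≤ p := by exact_mod_cast hp.two_le
  have e : (2 : ℝ) / p - 1 / p ^ 2 ≤ 6 / p * (1 - 1 / (p : ℝ)) ^ 2 := by
    have : 6 / p * (1 - 1 / (p : ℝ)) ^ 2 - (2 / p - 1 / p ^ 2) = (4 * p - 3) * (p - 2) / p ^ 3 := by
      field_simp; ring
    have h4 : 0 ≤ (4 * (p : ℝ) - 3) * (p - 2) / p ^ 3 := by
      apply div_nonneg _ (by positivity)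
      apply mul_nonneg <;> linarith
    linarith
  rw [div_le_iff₀ (by linarith)]
  calc nuP σ p ≤ 6 / p * (1 - 1 / (p : ℝ)) ^ 2 := h3.trans e
    _ ≤ _ := by gcongr

lemma selbergTerms_div_nu_le {d : ℕ} (hd : d ∣ primorial y) :
    (sieve y σ hσ).selbergTerms d / (sieve y σ hσ).nu d ≤ 4 ^ d.primeFactors.card := by
  have hν := (sieve y σ hσ).nu_pos_of_dvd_prodPrimes hd
  rw [BoundingSieve.selbergTerms_apply, mul_div_assoc, mul_div_cancel₀ _ hν.ne']
  rw [← prod_const]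
  apply prod_le_prod
  · intro p hp
    have hp' := Nat.prime_of_mem_primeFactors hp
    rw [sieve_nu_prime hσ hp']
    have := one_sub_nuP_pos hσ hp'
    rw [inv_nonneg]; linarith
  · intro p hp
    have hp' := Nat.prime_of_mem_primeFactors hp
    rw [sieve_nu_prime hσ hp']
    have := one_sub_nuP_pos hσ hp'
    rw [inv_le_comm₀ (by linarith) (by norm_num)]
    linarith

lemma sum_selbergTerms_eq_prod :
    ∑ l ∈ (primorial y).divisors, (sieve y σ hσ).selbergTerms l
      = ∏ p ∈ Nat.primesLE y, (1 + (sieve y σ hσ).selbergTerms p) := by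
  rw [← primeFactors_primorial]
  exact ((sieve y σ hσ).selbergTerms_isMultiplicative.prodPrimeFactors_one_add_of_squarefree
    (squarefree_primorial y)).symm

lemma sum_rpow_le_prod (y : ℕ) {s : ℝ} (hs : 0 < s) :
    ∑ n ∈ Icc 1 y, (n : ℝ) ^ (-s) ≤ ∏ p ∈ Nat.primesLE y, (1 - (p : ℝ) ^ (-s))⁻¹ := by
  have h := (EulerProduct.summable_and_hasSum_smoothNumbers_prod_primesBelow_geometric
    (f := rpowHom (-s)) (fun {p} hp => by
      change ‖(p : ℝ) ^ (-s)‖ < 1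
      rw [norm_of_nonneg (by positivity)]
      exact rpow_lt_one_of_one_lt_of_neg (by exact_mod_cast hp.one_lt) (by linarith)) (y + 1)).2
  have h2 := sum_le_hasSum ((Icc 1 y).subtype (· ∈ Nat.smoothNumbers (y + 1)))
    (fun (i : Nat.smoothNumbers (y + 1)) _ => by
      change 0 ≤ ((i : ℕ) : ℝ) ^ (-s)
      positivity) h
  rw [sum_subtype_of_mem (fun n : ℕ => (rpowHom (-s)) n)] at h2
  · exact h2
  · intro n hn
    rw [mem_Icc] at hn
    exact Nat.mem_smoothNumbers_of_lt (by omega) (by omega)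

lemma log_sq_le_prod (hy : 2 ≤ y) (hσ1 : σ ≤ 1 / log y) :
    log y ^ 2 / 3 ≤ ∏ p ∈ Nat.primesLE y, (1 + (sieve y σ hσ).selbergTerms p) := by
  have hy2 : (2 : ℝ) ≤ y := by exact_mod_cast hy
  have hlog : 0 < log y := log_pos (by linarith)
  have e : ∏ p ∈ Nat.primesLE y, (1 + (sieve y σ hσ).selbergTerms p)
      = (∏ p ∈ Nat.primesLE y, (1 - (p : ℝ) ^ (-(1 : ℝ)))⁻¹) *
        ∏ p ∈ Nat.primesLE y, (1 - (p : ℝ) ^ (-(1 + σ)))⁻¹ := by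
    rw [← prod_mul_distrib]
    apply prod_congr rfl
    intro p hp
    rw [one_add_selbergTerms_prime hσ (by simpa using (Nat.mem_primesLE.1 hp).2), rpow_neg_one, one_div]
  have h1 : log y ≤ ∑ n ∈ Icc 1 y, (n : ℝ) ^ (-(1 : ℝ)) := by
    have h := log_le_harmonic_floor y (by positivity)
    rw [Nat.floor_natCast, harmonic_eq_sum_Icc] at h
    push_cast at h
    simpa [rpow_neg_one] using h
  have h2 : log y / 3 ≤ ∑ n ∈ Icc 1 y, (n : ℝ) ^ (-(1 + σ)) := by
    have : (∑ n ∈ Icc 1 y, (n : ℝ) ^ (-(1 : ℝ))) / 3 ≤ ∑ n ∈ Icc 1 y, (n : ℝ) ^ (-(1 + σ)) := by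
      rw [sum_div]
      apply sum_le_sum
      intro n hn
      rw [mem_Icc] at hn
      have hn1 : (0 : ℝ) < n := by exact_mod_cast hn.1
      have hny : (n : ℝ) ≤ y := by exact_mod_cast hn.2
      rw [neg_add, rpow_add hn1, div_eq_mul_inv]
      gcongr
      rw [rpow_neg hn1.le]
      apply inv_anti₀ (by positivity)
      calc (n : ℝ) ^ σ ≤ (y : ℝ) ^ (1 / log y) := by
            apply (rpow_le_rpow hn1.le hny hσ.le).trans
            exact rpow_le_rpow_of_exponent_le (by linarith) hσ1
        _ = exp 1 := by rw [rpow_def_of_pos (by linarith), mul_one_div_cancel hlog.ne']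
        _ ≤ 3 := by linarith [exp_one_lt_d9]
    linarith
  have h3 := sum_rpow_le_prod y (s := 1) one_pos
  have h4 := sum_rpow_le_prod y (s := 1 + σ) (by linarith)
  rw [e]
  calc log y ^ 2 / 3 = log y * (log y / 3) := by ring
    _ ≤ _ := by
      apply mul_le_mul (h1.trans h3) (h2.trans h4) (by positivity) (by linarith [h1.trans h3])

/-- The function `n ↦ h(n) n^a` attached to the sieve. -/
noncomputable def twistTerms (y : ℕ) (σ : ℝ) (hσ : 0 < σ) (a : ℝ) : ArithmeticFunction ℝ :=
  ⟨fun n => (sieve y σ hσ).selbergTerms n * (n : ℝ) ^ a, by simp⟩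

lemma twistTerms_isMultiplicative (a : ℝ) : (twistTerms y σ hσ a).IsMultiplicative := by
  refine ArithmeticFunction.IsMultiplicative.iff_ne_zero.2 ⟨?_, ?_⟩
  · simp [twistTerms, (sieve y σ hσ).selbergTerms_isMultiplicative.map_one]
  · intro m n _ _ h
    change (sieve y σ hσ).selbergTerms (m * n) * ((m * n : ℕ) : ℝ) ^ a =
      ((sieve y σ hσ).selbergTerms m * (m : ℝ) ^ a) * ((sieve y σ hσ).selbergTerms n * (n : ℝ) ^ a)
    rw [(sieve y σ hσ).selbergTerms_isMultiplicative.map_mul_of_coprime h]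
    push_cast
    rw [mul_rpow (Nat.cast_nonneg _) (Nat.cast_nonneg _)]
    ring

lemma sum_primes_log_div_le (hy : 2 ≤ y) :
    ∑ p ∈ Nat.primesLE y, log p / p ≤ log y + 6 := by
  have h := (sum_vonMangoldt_div (M := y) (by omega)).2
  have h2 : ∑ p ∈ Nat.primesLE y, log p / p ≤ ∑ n ∈ Ioc 0 y, Λ n / n := by
    calc ∑ p ∈ Nat.primesLE y, log p / p = ∑ p ∈ Nat.primesLE y, Λ p / p := by
          apply sum_congr rfl
          intro p hp
          rw [ArithmeticFunction.vonMangoldt_apply_prime (Nat.mem_primesLE.1 hp).2]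
      _ ≤ _ := by
          apply sum_le_sum_of_subset_of_nonneg
          · intro p hp
            have := Nat.mem_primesLE.1 hp
            exact mem_Ioc.2 ⟨this.2.pos, this.1⟩
          · intro n _ _
            have := ArithmeticFunction.vonMangoldt_nonneg (n := n)
            positivity
  linarith

lemma half_prod_le_selSum (hy : 2 ≤ y) :
    (∏ p ∈ Nat.primesLE y, (1 + (sieve y σ hσ).selbergTerms p)) / 2
      ≤ selSum (sieve y σ hσ) (y ^ 121) := by
  set s := sieve y σ hσ with hs
  have hy2 : (2 : ℝ) ≤ y := by exact_mod_cast hy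
  have hlog2 : 0.69 < log y := by
    have := log_le_log (by norm_num) hy2
    linarith [log_two_gt_d9]
  have hlog : 0 < log y := by linarith
  set η := 1 / log y with hη
  have hη0 : 0 < η := by positivity
  set R : ℕ := y ^ 121 with hR
  have hpos : ∀ l ∈ (primorial y).divisors, 0 < s.selbergTerms l := fun l hl =>
    s.selbergTerms_pos (Nat.dvd_of_mem_divisors hl)
  have hRpow : ((R : ℕ) : ℝ) ^ η = exp 121 := by
    rw [hR]; push_cast
    rw [← rpow_natCast, ← rpow_mul (by linarith), rpow_def_of_pos (by linarith), hη]
    congr 1; push_cast; field_simp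
  have htail : ∑ l ∈ (primorial y).divisors with ¬ l ≤ R, s.selbergTerms l
      ≤ exp (-121) * ∑ l ∈ (primorial y).divisors, twistTerms y σ hσ η l := by
    rw [mul_sum]
    calc ∑ l ∈ (primorial y).divisors with ¬ l ≤ R, s.selbergTerms l
        ≤ ∑ l ∈ (primorial y).divisors with ¬ l ≤ R, exp (-121) * twistTerms y σ hσ η l := by
          apply sum_le_sum
          intro l hl
          rw [mem_filter] at hl
          have h1 := hpos l hl.1
          have h2 : (R : ℝ) ≤ l := by exact_mod_cast (not_le.1 hl.2).le
          change _ ≤ _ * (s.selbergTerms l * (l : ℝ) ^ η)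
          have h3 : exp 121 ≤ (l : ℝ) ^ η := by
            rw [← hRpow]; exact rpow_le_rpow (by positivity) h2 hη0.le
          have h4 : exp (-121) * exp 121 = 1 := by rw [← exp_add]; simp
          calc s.selbergTerms l = s.selbergTerms l * (exp (-121) * exp 121) := by rw [h4, mul_one]
            _ ≤ s.selbergTerms l * (exp (-121) * (l : ℝ) ^ η) := by gcongr
            _ = _ := by ring
      _ ≤ _ := by
          apply sum_le_sum_of_subset_of_nonneg (filter_subset _ _)
          intro l hl _
          have h1 := hpos l hl
          change 0 ≤ _ * (s.selbergTerms l * (l : ℝ) ^ η)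
          positivity
  have hprod : ∑ l ∈ (primorial y).divisors, twistTerms y σ hσ η l
      ≤ exp 120 * ∏ p ∈ Nat.primesLE y, (1 + s.selbergTerms p) := by
    have e := (twistTerms_isMultiplicative (y := y) hσ η).prodPrimeFactors_one_add_of_squarefree
      (squarefree_primorial y)
    rw [← e, primeFactors_primorial]
    have hterm : ∀ p ∈ Nat.primesLE y, 1 + twistTerms y σ hσ η p
        ≤ exp (12 * η * (log p / p)) * (1 + s.selbergTerms p) := by
      intro p hp
      obtain ⟨hpy, hpp⟩ := Nat.mem_primesLE.1 hp
      have hp2 : (2 : ℝ) ≤ p := by exact_mod_cast hpp.two_le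
      have hpy' : (p : ℝ) ≤ y := by exact_mod_cast hpy
      have hlp : 0 < log p := log_pos (by linarith)
      have h6 := selbergTerms_prime_le (y := y) hσ hpp
      have h0 : 0 < s.selbergTerms p := hpos p (Nat.mem_divisors.2
        ⟨hpp.dvd_primorial_iff.2 hpy, primorial_ne_zero _⟩)
      change 1 + s.selbergTerms p * (p : ℝ) ^ η ≤ _
      have hx : (p : ℝ) ^ η ≤ 1 + 2 * (η * log p) := by
        rw [rpow_def_of_pos (by linarith)]
        have ht1 : log p * η ≤ 1 := by
          rw [hη, mul_one_div, div_le_one hlog]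
          exact log_le_log (by linarith) hpy'
        have ht0 : 0 ≤ log p * η := by positivity
        have := abs_exp_sub_one_le (x := log p * η) (by rw [abs_of_nonneg ht0]; exact ht1)
        rw [abs_of_nonneg ht0] at this
        have := le_abs_self (exp (log p * η) - 1)
        linarith
      have hE := add_one_le_exp (12 * η * (log p / p))
      have h7 : s.selbergTerms p * (2 * (η * log p)) ≤ 12 * η * (log p / p) := by
        calc s.selbergTerms p * (2 * (η * log p)) ≤ 6 / p * (2 * (η * log p)) := by gcongr
          _ = _ := by ring
      have h8 : 0 ≤ 12 * η * (log p / p) := by positivity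
      calc 1 + s.selbergTerms p * (p : ℝ) ^ η
          ≤ 1 + s.selbergTerms p * (1 + 2 * (η * log p)) := by gcongr
        _ ≤ (12 * η * (log p / p) + 1) * (1 + s.selbergTerms p) := by nlinarith
        _ ≤ _ := by gcongr
    calc ∏ p ∈ Nat.primesLE y, (1 + twistTerms y σ hσ η p)
        ≤ ∏ p ∈ Nat.primesLE y, (exp (12 * η * (log p / p)) * (1 + s.selbergTerms p)) := by
          apply prod_le_prod _ hterm
          intro p hp
          obtain ⟨hpy, hpp⟩ := Nat.mem_primesLE.1 hp
          have h0 : 0 < s.selbergTerms p := hpos p (Nat.mem_divisors.2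
            ⟨hpp.dvd_primorial_iff.2 hpy, primorial_ne_zero _⟩)
          change 0 ≤ 1 + s.selbergTerms p * (p : ℝ) ^ η
          positivity
      _ = exp (12 * η * ∑ p ∈ Nat.primesLE y, log p / p) * ∏ p ∈ Nat.primesLE y, (1 + s.selbergTerms p) := by
          rw [prod_mul_distrib, mul_sum, exp_sum]
      _ ≤ _ := by
          apply mul_le_mul_of_nonneg_right
          · apply exp_le_exp.2
            have := sum_primes_log_div_le hy
            calc 12 * η * ∑ p ∈ Nat.primesLE y, log p / p ≤ 12 * η * (log y + 6) := by gcongr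
              _ ≤ 12 * η * (10 * log y) := by gcongr; linarith
              _ = 120 := by rw [hη]; field_simp; norm_num
          · apply prod_nonneg
            intro p hp
            obtain ⟨hpy, hpp⟩ := Nat.mem_primesLE.1 hp
            have h0 : 0 < s.selbergTerms p := hpos p (Nat.mem_divisors.2
              ⟨hpp.dvd_primorial_iff.2 hpy, primorial_ne_zero _⟩)
            linarith
  have htot := sum_selbergTerms_eq_prod (y := y) hσ
  have hsplit := sum_filter_add_sum_filter_not (primorial y).divisors (fun l => l ≤ R)
    (fun l => s.selbergTerms l)
  have hp0 : 0 ≤ ∏ p ∈ Nat.primesLE y, (1 + s.selbergTerms p) := by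
    rw [← htot]; exact sum_nonneg fun l hl => (hpos l hl).le
  have hexp : exp (-121) * exp 120 ≤ 1 / 2 := by
    rw [← exp_add]
    have : exp (-121 + 120) = (exp 1)⁻¹ := by rw [← exp_neg]; norm_num
    rw [this, one_div]
    exact inv_anti₀ (by norm_num) (by linarith [exp_one_gt_d9])
  have hfin : ∑ l ∈ (primorial y).divisors with ¬ l ≤ R, s.selbergTerms l
      ≤ 1 / 2 * ∏ p ∈ Nat.primesLE y, (1 + s.selbergTerms p) := by
    calc _ ≤ exp (-121) * (exp 120 * ∏ p ∈ Nat.primesLE y, (1 + s.selbergTerms p)) := by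
            apply htail.trans; gcongr
      _ = exp (-121) * exp 120 * ∏ p ∈ Nat.primesLE y, (1 + s.selbergTerms p) := by ring
      _ ≤ _ := by gcongr
  have : selSum s R = ∑ l ∈ (primorial y).divisors with l ≤ R, s.selbergTerms l := rfl
  rw [this]
  linarith

lemma log_sq_le_selSum (hy : 2 ≤ y) (hσ1 : σ ≤ 1 / log y) :
    log y ^ 2 / 6 ≤ selSum (sieve y σ hσ) (y ^ 121) := by
  have h1 := half_prod_le_selSum hσ hy
  have h2 := log_sq_le_prod hσ hy hσ1
  linarith
end
end PrimeGap

namespace PrimeGap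
open Real Finset
open scoped ArithmeticFunction.Moebius ArithmeticFunction.vonMangoldt

/-- Sieve weights of level `R` supported on divisors of the primorial of `y`. -/
structure IsSieveWeight (y R : ℕ) (lam : ℕ → ℝ) : Prop where
  one : lam 1 = 1
  dvd : ∀ k, lam k ≠ 0 → k ∣ primorial y
  le : ∀ k, lam k ≠ 0 → k ≤ R
  abs_lam_le : ∀ k, |lam k| ≤ 4 ^ k.primeFactors.card

/-- The nonnegative weight `(∑_{k ∣ n} λ_k)²`. -/
noncomputable def wt (lam : ℕ → ℝ) (n : ℕ) : ℝ := (∑ k ∈ n.divisors, lam k) ^ 2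

/-- The mean value of `d ↦ wt (d m)`. -/
noncomputable def gW (lam : ℕ → ℝ) (R m : ℕ) : ℝ :=
  ∑ a ∈ Icc 1 R, ∑ b ∈ Icc 1 R, lam a * lam b * ((Nat.gcd (a.lcm b) m : ℝ) / (a.lcm b : ℕ))

lemma wt_nonneg (lam : ℕ → ℝ) (n : ℕ) : 0 ≤ wt lam n := sq_nonneg _

lemma sum_eq_of_support {f : ℕ → ℝ} {A B : Finset ℕ} (h : ∀ a, f a ≠ 0 → (a ∈ A ↔ a ∈ B)) :
    ∑ a ∈ A, f a = ∑ a ∈ B, f a := by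
  rw [← sum_filter_ne_zero A, ← sum_filter_ne_zero B]
  congr 1
  ext a
  simp only [mem_filter]
  exact ⟨fun ⟨h1, h2⟩ => ⟨(h a h2).1 h1, h2⟩, fun ⟨h1, h2⟩ => ⟨(h a h2).2 h1, h2⟩⟩

namespace IsSieveWeight
variable {y R : ℕ} {lam : ℕ → ℝ}

lemma pos (hl : IsSieveWeight y R lam) {k : ℕ} (hk : lam k ≠ 0) : 0 < k :=
  Nat.pos_of_dvd_of_pos (hl.dvd k hk) (primorial_pos y)

lemma mem_Icc (hl : IsSieveWeight y R lam) {k : ℕ} (hk : lam k ≠ 0) : k ∈ Icc 1 R :=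
  Finset.mem_Icc.2 ⟨hl.pos hk, hl.le k hk⟩

lemma abs_le_sq (hl : IsSieveWeight y R lam) {k : ℕ} (hk : k ≤ R) : |lam k| ≤ (R : ℝ) ^ 2 := by
  by_cases h : lam k = 0
  · rw [h, abs_zero]; positivity
  have hsq : Squarefree k := (squarefree_primorial y).squarefree_of_dvd (hl.dvd k h)
  have h2 : 2 ^ k.primeFactors.card ≤ k := by
    calc 2 ^ k.primeFactors.card = ∏ p ∈ k.primeFactors, 2 := by rw [prod_const]
      _ ≤ ∏ p ∈ k.primeFactors, p :=
        prod_le_prod' fun p hp => (Nat.prime_of_mem_primeFactors hp).two_le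
      _ = k := Nat.prod_primeFactors_of_squarefree hsq
  have h3 : (2 : ℝ) ^ k.primeFactors.card ≤ R := by exact_mod_cast h2.trans hk
  calc |lam k| ≤ 4 ^ k.primeFactors.card := hl.abs_lam_le k
    _ = ((2 : ℝ) ^ k.primeFactors.card) ^ 2 := by rw [← pow_mul, mul_comm, pow_mul]; norm_num
    _ ≤ (R : ℝ) ^ 2 := by gcongr

lemma wt_eq (hl : IsSieveWeight y R lam) {n : ℕ} (hn : 0 < n) :
    wt lam n = ∑ a ∈ Icc 1 R, ∑ b ∈ Icc 1 R, if a.lcm b ∣ n then lam a * lam b else 0 := by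
  have h : ∑ k ∈ n.divisors, lam k = ∑ k ∈ Icc 1 R, if k ∣ n then lam k else 0 := by
    rw [← sum_filter]
    apply sum_eq_of_support
    intro k hk
    rw [mem_filter, Nat.mem_divisors]
    exact ⟨fun h => ⟨hl.mem_Icc hk, h.1⟩, fun h => ⟨h.2, hn.ne'⟩⟩
  unfold wt
  rw [h, sq, sum_mul_sum]
  apply sum_congr rfl; intro a _
  apply sum_congr rfl; intro b _
  simp only [Nat.lcm_dvd_iff]
  split_ifs <;> simp_all

lemma wt_le (hl : IsSieveWeight y R lam) {n : ℕ} (hn : n.primeFactors.card ≤ 2) :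
    wt lam n ≤ 4096 := by
  by_cases hn0 : n = 0
  · subst hn0; simp [wt]
  have hcard : {k ∈ n.divisors | Squarefree k}.card ≤ 4 := by
    calc {k ∈ n.divisors | Squarefree k}.card ≤ (n.primeFactors.powerset).card := by
          apply card_le_card_of_injOn (fun k => k.primeFactors)
          · intro k hk
            have hk : k ∈ {k ∈ n.divisors | Squarefree k} := hk
            rw [mem_filter, Nat.mem_divisors] at hk
            exact mem_coe.2 (mem_powerset.2 (Nat.primeFactors_mono hk.1.1 hn0))
          · intro a ha b hb h
            have ha : a ∈ {k ∈ n.divisors | Squarefree k} := ha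
            have hb : b ∈ {k ∈ n.divisors | Squarefree k} := hb
            rw [mem_filter] at ha hb
            simp only at h
            rw [← Nat.prod_primeFactors_of_squarefree ha.2, h,
              Nat.prod_primeFactors_of_squarefree hb.2]
      _ = 2 ^ n.primeFactors.card := card_powerset _
      _ ≤ 2 ^ 2 := Nat.pow_le_pow_right (by norm_num) hn
  have h : |∑ k ∈ n.divisors, lam k| ≤ 64 := by
    have e : ∑ k ∈ n.divisors, lam k = ∑ k ∈ n.divisors with Squarefree k, lam k := by
      apply sum_eq_of_support
      intro k hk
      rw [mem_filter]
      exact ⟨fun h => ⟨h, (squarefree_primorial y).squarefree_of_dvd (hl.dvd k hk)⟩, fun h => h.1⟩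
    rw [e]
    calc _ ≤ ∑ k ∈ n.divisors with Squarefree k, |lam k| := abs_sum_le_sum_abs _ _
      _ ≤ ∑ k ∈ n.divisors with Squarefree k, (16 : ℝ) := by
          apply sum_le_sum
          intro k hk
          rw [mem_filter, Nat.mem_divisors] at hk
          have : k.primeFactors.card ≤ 2 := (card_le_card (Nat.primeFactors_mono hk.1.1 hn0)).trans hn
          calc |lam k| ≤ 4 ^ k.primeFactors.card := hl.abs_lam_le k
            _ ≤ 4 ^ 2 := by gcongr; norm_num
            _ = 16 := by norm_num
      _ = ({k ∈ n.divisors | Squarefree k}.card : ℝ) * 16 := by rw [sum_const, nsmul_eq_mul]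
      _ ≤ 4 * 16 := by gcongr; exact_mod_cast hcard
      _ = 64 := by norm_num
  unfold wt
  rw [← sq_abs]
  nlinarith [abs_nonneg (∑ k ∈ n.divisors, lam k)]

lemma wt_eq_one (hl : IsSieveWeight y R lam) {n : ℕ} (hn : ∀ p : ℕ, p.Prime → p ∣ n → y < p)
    (hn0 : n ≠ 0) : wt lam n = 1 := by
  unfold wt
  have : ∑ k ∈ n.divisors, lam k = ∑ k ∈ {1}, lam k := by
    apply sum_eq_of_support
    intro k hk
    rw [Nat.mem_divisors, mem_singleton]
    constructor
    · rintro ⟨h, _⟩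
      by_contra hk1
      obtain ⟨p, hp, hpk⟩ := Nat.exists_prime_and_dvd hk1
      have h1 := hn p hp (hpk.trans h)
      have h2 := hp.dvd_primorial_iff.1 (hpk.trans (hl.dvd k hk))
      omega
    · rintro rfl; exact ⟨one_dvd _, hn0⟩
  rw [this, sum_singleton, hl.one, one_pow]

lemma sum_win_wt (hl : IsSieveWeight y R lam) {m : ℕ} (hm : 0 < m) {v θ : ℝ} (h0 : 0 ≤ θ) (h1 : θ ≤ 1) :
    |∑ d ∈ win v θ, wt lam (d * m) / d - θ * gW lam R m| ≤ 4 * R ^ 6 * exp (-v) := by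
  have e1 : ∑ d ∈ win v θ, wt lam (d * m) / d = ∑ a ∈ Icc 1 R, ∑ b ∈ Icc 1 R,
      lam a * lam b * ∑ d ∈ win v θ with (a.lcm b / (a.lcm b).gcd m) ∣ d, (1 : ℝ) / d := by
    have : ∀ d ∈ win v θ, wt lam (d * m) / d = ∑ a ∈ Icc 1 R, ∑ b ∈ Icc 1 R,
        lam a * lam b * if (a.lcm b / (a.lcm b).gcd m) ∣ d then (1 : ℝ) / d else 0 := by
      intro d hd
      have hd0 := (mem_win.1 hd).1
      rw [hl.wt_eq (Nat.mul_pos hd0 hm), sum_div]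
      apply sum_congr rfl; intro a ha
      rw [sum_div]
      apply sum_congr rfl; intro b hb
      rw [Finset.mem_Icc] at ha hb
      have hK : 0 < a.lcm b := Nat.lcm_pos ha.1 hb.1
      have hiff : a.lcm b ∣ d * m ↔ (a.lcm b / (a.lcm b).gcd m) ∣ d := by
        constructor
        · intro h
          apply (Nat.coprime_div_gcd_div_gcd (Nat.gcd_pos_of_pos_left m hK)).dvd_of_dvd_mul_right
          rw [← Nat.mul_div_assoc _ (Nat.gcd_dvd_right _ _)]
          exact Nat.div_dvd_div (Nat.gcd_dvd_left _ _) h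
        · intro h
          calc a.lcm b = (a.lcm b / (a.lcm b).gcd m) * (a.lcm b).gcd m :=
                (Nat.div_mul_cancel (Nat.gcd_dvd_left _ _)).symm
            _ ∣ d * m := mul_dvd_mul h (Nat.gcd_dvd_right _ _)
      simp only [hiff]
      split_ifs
      · ring
      · simp
    rw [sum_congr rfl this, sum_comm]
    apply sum_congr rfl; intro a _
    rw [sum_comm]
    apply sum_congr rfl; intro b _
    rw [← mul_sum, sum_filter]
  rw [e1]
  unfold gW
  rw [mul_sum, ← sum_sub_distrib]
  have hb : ∀ a ∈ Icc 1 R, ∀ b ∈ Icc 1 R,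
      |lam a * lam b * ∑ d ∈ win v θ with (a.lcm b / (a.lcm b).gcd m) ∣ d, (1 : ℝ) / d -
        θ * (lam a * lam b * ((Nat.gcd (a.lcm b) m : ℝ) / (a.lcm b : ℕ)))| ≤ R ^ 4 * (4 * exp (-v)) := by
    intro a ha b hb
    rw [Finset.mem_Icc] at ha hb
    have hK : 0 < a.lcm b := Nat.lcm_pos ha.1 hb.1
    have hg : 0 < (a.lcm b).gcd m := Nat.gcd_pos_of_pos_left m hK
    have hK' : 0 < a.lcm b / (a.lcm b).gcd m := Nat.div_pos (Nat.le_of_dvd hK (Nat.gcd_dvd_left _ _)) hg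
    have h := sum_win_dvd hK' (v := v) h0 h1
    have e : θ * (lam a * lam b * ((Nat.gcd (a.lcm b) m : ℝ) / (a.lcm b : ℕ)))
        = lam a * lam b * (θ / ((a.lcm b / (a.lcm b).gcd m : ℕ) : ℝ)) := by
      rw [Nat.cast_div (Nat.gcd_dvd_left _ _) (by positivity)]
      field_simp
    rw [e, ← mul_sub, abs_mul, abs_mul]
    have ha2 := hl.abs_le_sq ha.2
    have hb2 := hl.abs_le_sq hb.2
    calc _ ≤ ((R : ℝ) ^ 2 * R ^ 2) * (4 * exp (-v)) := by gcongr
      _ = _ := by ring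
  calc _ ≤ ∑ a ∈ Icc 1 R, ∑ b ∈ Icc 1 R, (R : ℝ) ^ 4 * (4 * exp (-v)) := by
        apply (abs_sum_le_sum_abs _ _).trans
        apply sum_le_sum
        intro a ha
        rw [mul_sum, ← sum_sub_distrib]
        apply (abs_sum_le_sum_abs _ _).trans
        exact sum_le_sum (hb a ha)
    _ = 4 * R ^ 6 * exp (-v) := by
        simp only [sum_const, Nat.card_Icc, nsmul_eq_mul, Nat.add_sub_cancel]
        ring

lemma gW_nonneg (hl : IsSieveWeight y R lam) {m : ℕ} (hm : 0 < m) : 0 ≤ gW lam R m := by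
  have h : ∀ v : ℝ, -(4 * R ^ 6 * exp (-v)) ≤ gW lam R m := by
    intro v
    have h := (abs_le.1 (hl.sum_win_wt hm (v := v) zero_le_one le_rfl)).2
    have h2 : 0 ≤ ∑ d ∈ win v 1, wt lam (d * m) / d :=
      sum_nonneg fun d _ => div_nonneg (wt_nonneg _ _) (Nat.cast_nonneg _)
    linarith
  have ht : Filter.Tendsto (fun v : ℝ => -(4 * (R : ℝ) ^ 6 * exp (-v))) Filter.atTop (nhds 0) := by
    have h := (tendsto_exp_neg_atTop_nhds_zero.const_mul (4 * (R : ℝ) ^ 6)).neg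
    simpa using h
  exact le_of_tendsto' ht h
end IsSieveWeight

/-- `∑ m^{-1-σ}`. -/
noncomputable def zetaSum (σ : ℝ) : ℝ := ∑' m : ℕ, (m : ℝ) ^ (-(1 + σ))

lemma summable_zeta {σ : ℝ} (hσ : 0 < σ) : Summable fun m : ℕ => (m : ℝ) ^ (-(1 + σ)) :=
  summable_nat_rpow.2 (by linarith)

lemma zetaSum_le {σ : ℝ} (hσ : 0 < σ) : zetaSum σ ≤ 1 + 1 / σ := by
  have hstep : ∀ n : ℕ, 1 ≤ n → (n + 1 : ℝ) ^ (-(1 + σ)) ≤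
      1 / σ * ((n : ℝ) ^ (-σ) - (n + 1 : ℝ) ^ (-σ)) := by
    intro n hn
    have hn0 : (0 : ℝ) < n := by exact_mod_cast hn
    have hn1 : (0 : ℝ) < n + 1 := by positivity
    have h1 : (n : ℝ) ^ (-σ) = (n + 1 : ℝ) ^ (-σ) * exp (-σ * log (n / (n + 1))) := by
      rw [rpow_def_of_pos hn0, rpow_def_of_pos hn1, ← exp_add, log_div hn0.ne' hn1.ne']
      congr 1; ring
    have h2 : log ((n : ℝ) / (n + 1)) ≤ - (1 / (n + 1)) := by
      have := log_le_sub_one_of_pos (show (0 : ℝ) < n / (n + 1) by positivity)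
      have e : (n : ℝ) / (n + 1) - 1 = -(1 / (n + 1)) := by field_simp; ring
      linarith
    have h3 : 1 + σ * (1 / (n + 1)) ≤ exp (-σ * log (n / (n + 1))) := by
      have := add_one_le_exp (-σ * log ((n : ℝ) / (n + 1)))
      nlinarith
    have h4 : (n + 1 : ℝ) ^ (-(1 + σ)) = (n + 1 : ℝ) ^ (-σ) * (1 / (n + 1)) := by
      rw [neg_add, rpow_add hn1, rpow_neg_one, one_div, mul_comm]
    have h5 : (0 : ℝ) < (n + 1 : ℝ) ^ (-σ) := by positivity
    rw [h4, h1]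
    calc (n + 1 : ℝ) ^ (-σ) * (1 / (n + 1)) = 1 / σ * ((n + 1 : ℝ) ^ (-σ) * (1 + σ * (1 / (n + 1))) - (n + 1 : ℝ) ^ (-σ)) := by
          field_simp; ring
      _ ≤ _ := by gcongr
  have hfin : ∀ N : ℕ, ∑ m ∈ range (N + 2), (m : ℝ) ^ (-(1 + σ)) ≤
      1 + 1 / σ * (1 - ((N + 1 : ℕ) : ℝ) ^ (-σ)) := by
    intro N
    induction N with
    | zero =>
      have : (0 : ℝ) ^ (-(1 + σ)) = 0 := zero_rpow (by linarith)
      rw [sum_range_succ, sum_range_one, Nat.cast_zero, this]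
      simp
    | succ N ih =>
      rw [sum_range_succ]
      have h := hstep (N + 1) (by omega)
      push_cast at *
      rw [show (N : ℝ) + 1 + 1 = N + 2 by ring] at *
      linarith
  apply (summable_zeta hσ).tsum_le_of_sum_range_le
  intro n
  have h0 : ∀ m : ℕ, 0 ≤ (m : ℝ) ^ (-(1 + σ)) := fun m => by positivity
  calc ∑ m ∈ range n, (m : ℝ) ^ (-(1 + σ)) ≤ ∑ m ∈ range (n + 2), (m : ℝ) ^ (-(1 + σ)) :=
        sum_le_sum_of_subset_of_nonneg (range_mono (by omega)) fun i _ _ => h0 i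
    _ ≤ _ := hfin n
    _ ≤ 1 + 1 / σ := by
      have : (0 : ℝ) ≤ ((n + 1 : ℕ) : ℝ) ^ (-σ) := by positivity
      have h2 : 0 < 1 / σ := by positivity
      nlinarith

lemma hasSum_dvd_rpow {σ : ℝ} (hσ : 0 < σ) {e : ℕ} (he : 0 < e) :
    HasSum (fun m : ℕ => if e ∣ m then (m : ℝ) ^ (-(1 + σ)) else 0)
      ((e : ℝ) ^ (-(1 + σ)) * zetaSum σ) := by
  have hinj : Function.Injective (fun j : ℕ => e * j) := fun a b h =>
    Nat.eq_of_mul_eq_mul_left he h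
  rw [← hinj.hasSum_iff]
  · have h := (summable_zeta hσ).hasSum.mul_left ((e : ℝ) ^ (-(1 + σ)))
    have e1 : ((fun m : ℕ => if e ∣ m then (m : ℝ) ^ (-(1 + σ)) else 0) ∘ fun j : ℕ => e * j)
        = fun j : ℕ => (e : ℝ) ^ (-(1 + σ)) * (j : ℝ) ^ (-(1 + σ)) := by
      funext j
      simp only [Function.comp, dvd_mul_right, if_true]
      push_cast
      exact mul_rpow (Nat.cast_nonneg _) (Nat.cast_nonneg _)
    rw [e1]
    exact h
  · intro m hm
    rw [if_neg]
    rintro ⟨k, rfl⟩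
    exact hm ⟨k, rfl⟩

/-- The multiplicative function `φ(n) n^a`. -/
noncomputable def totTwist (a : ℝ) : ArithmeticFunction ℝ :=
  ⟨fun n => (Nat.totient n : ℝ) * (n : ℝ) ^ a, by simp⟩

lemma totTwist_isMultiplicative (a : ℝ) : (totTwist a).IsMultiplicative := by
  refine ArithmeticFunction.IsMultiplicative.iff_ne_zero.2 ⟨?_, ?_⟩
  · simp [totTwist]
  · intro m n _ _ h
    change (Nat.totient (m * n) : ℝ) * ((m * n : ℕ) : ℝ) ^ a =
      ((Nat.totient m : ℝ) * (m : ℝ) ^ a) * ((Nat.totient n : ℝ) * (n : ℝ) ^ a)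
    rw [Nat.totient_mul h]
    push_cast
    rw [mul_rpow (Nat.cast_nonneg _) (Nat.cast_nonneg _)]
    ring

lemma nu_eq_sum {y : ℕ} {σ : ℝ} (hσ : 0 < σ) {K : ℕ} (hK : Squarefree K) :
    (sieve y σ hσ).nu K = (∑ e ∈ K.divisors, (Nat.totient e : ℝ) * (e : ℝ) ^ (-(1 + σ))) / K := by
  have h := (totTwist_isMultiplicative (-(1 + σ))).prodPrimeFactors_one_add_of_squarefree hK
  change _ = ∑ e ∈ K.divisors, (Nat.totient e : ℝ) * (e : ℝ) ^ (-(1 + σ)) at h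
  rw [← h]
  change ArithmeticFunction.prodPrimeFactors (nuP σ) K = _
  rw [ArithmeticFunction.prodPrimeFactors_apply hK.ne_zero]
  have hKp : (K : ℝ) = ∏ p ∈ K.primeFactors, (p : ℝ) := by
    rw [← Nat.cast_prod, Nat.prod_primeFactors_of_squarefree hK]
  rw [hKp, ← prod_div_distrib]
  apply prod_congr rfl
  intro p hp
  have hp' := Nat.prime_of_mem_primeFactors hp
  change _ = (1 + (Nat.totient p : ℝ) * (p : ℝ) ^ (-(1 + σ))) / p
  have hp0 : (p : ℝ) ≠ 0 := by exact_mod_cast hp'.ne_zero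
  rw [Nat.totient_prime hp', Nat.cast_sub hp'.one_le]
  unfold nuP
  push_cast
  field_simp
  ring

lemma hasSum_gcd {y : ℕ} {σ : ℝ} (hσ : 0 < σ) {K : ℕ} (hK : Squarefree K) :
    HasSum (fun m : ℕ => (Nat.gcd K m : ℝ) / K * (m : ℝ) ^ (-(1 + σ)))
      ((sieve y σ hσ).nu K * zetaSum σ) := by
  have h := hasSum_sum (s := K.divisors) (f := fun e (m : ℕ) => (Nat.totient e : ℝ) / K *
    (if e ∣ m then (m : ℝ) ^ (-(1 + σ)) else 0)) (fun e he =>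
      (hasSum_dvd_rpow hσ (Nat.pos_of_mem_divisors he)).mul_left _)
  convert h using 1
  · funext m
    have : (Nat.gcd K m : ℝ) = ∑ e ∈ K.divisors with e ∣ m, (Nat.totient e : ℝ) := by
      have h1 : {e ∈ K.divisors | e ∣ m} = (Nat.gcd K m).divisors := by
        ext e
        simp only [mem_filter, Nat.mem_divisors, Nat.dvd_gcd_iff, ne_eq, Nat.gcd_eq_zero_iff]
        have := hK.ne_zero
        tauto
      rw [h1, ← Nat.cast_sum, Nat.sum_totient]
    rw [this, sum_filter, sum_div, sum_mul]
    apply sum_congr rfl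
    intro e _
    split_ifs <;> simp
  · rw [nu_eq_sum hσ hK, sum_div, sum_mul]
    apply sum_congr rfl
    intro e _
    ring

theorem exists_sieveWeight (y : ℕ) (hy : 2 ≤ y) : ∃ lam : ℕ → ℝ, IsSieveWeight y (y ^ 121) lam ∧
    ∑ m ∈ Icc 1 ((y ^ 121) ^ 12), gW lam (y ^ 121) m / m ≤ 4 * 10 ^ 6 / log ((y : ℝ) ^ 121) := by
  set R := y ^ 121 with hR
  have hy2 : (2 : ℝ) ≤ y := by exact_mod_cast hy
  have hlog2 : 0.69 < log y := by
    have := log_le_log (by norm_num) hy2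
    linarith [log_two_gt_d9]
  have hR1 : 1 ≤ R := Nat.one_le_pow _ _ (by omega)
  set ℓ := log ((y : ℝ) ^ 121) with hℓ
  have hℓ' : ℓ = 121 * log y := by rw [hℓ, log_pow]; norm_num
  have hℓ0 : 1 ≤ ℓ := by linarith
  set σ := 1 / (12 * ℓ) with hσdef
  have hσ : 0 < σ := by positivity
  have hσ1 : σ ≤ 1 / log y := by
    apply one_div_le_one_div_of_le <;> linarith
  set s := sieve y σ hσ with hs
  have hP : s.prodPrimes = primorial y := rfl
  have hl : IsSieveWeight y R (selWt s R) := by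
    refine ⟨selWt_one hR1, ?_, ?_, ?_⟩
    · intro k hk
      by_contra h
      exact hk (selWt_of_not_dvd (by rwa [hP]))
    · intro k hk
      by_contra h
      exact hk (selWt_of_lt (not_le.1 h))
    · intro k
      by_cases hk : k ∣ primorial y
      · exact (abs_selWt_le hR1 (by rwa [hP])).trans (selbergTerms_div_nu_le hσ hk)
      · rw [selWt_of_not_dvd (by rwa [hP]), abs_zero]; positivity
  refine ⟨selWt s R, hl, ?_⟩
  set lam := selWt s R with hlam
  have hsum : HasSum (fun m : ℕ => gW lam R m * (m : ℝ) ^ (-(1 + σ)))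
      (∑ a ∈ Icc 1 R, ∑ b ∈ Icc 1 R, lam a * lam b * (s.nu (a.lcm b) * zetaSum σ)) := by
    unfold gW
    simp_rw [sum_mul]
    apply hasSum_sum; intro a _
    apply hasSum_sum; intro b _
    by_cases hab : lam a * lam b = 0
    · simp only [hab, zero_mul]; exact hasSum_zero
    · have hK : Squarefree (a.lcm b) := (squarefree_primorial y).squarefree_of_dvd
        (Nat.lcm_dvd (hl.dvd a (left_ne_zero_of_mul hab)) (hl.dvd b (right_ne_zero_of_mul hab)))
      have := (hasSum_gcd (y := y) hσ hK).mul_left (lam a * lam b)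
      simpa only [mul_assoc] using this
  have hform : ∑ a ∈ Icc 1 R, ∑ b ∈ Icc 1 R, lam a * lam b * (s.nu (a.lcm b) * zetaSum σ)
      = zetaSum σ / selSum s R := by
    have h := sum_sum_selWt (s := s) hR1
    have hin : ∀ a, ∑ b ∈ s.prodPrimes.divisors, selWt s R a * selWt s R b * s.nu (a.lcm b)
        = ∑ b ∈ Icc 1 R, lam a * lam b * s.nu (a.lcm b) := by
      intro a
      apply sum_eq_of_support
      intro b hb
      have hb' : lam b ≠ 0 := right_ne_zero_of_mul (left_ne_zero_of_mul hb)
      exact ⟨fun _ => hl.mem_Icc hb', fun _ => Nat.mem_divisors.2 ⟨hl.dvd b hb', s.prodPrimes_ne_zero⟩⟩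
    have hout : ∑ a ∈ s.prodPrimes.divisors, ∑ b ∈ s.prodPrimes.divisors,
        selWt s R a * selWt s R b * s.nu (a.lcm b)
        = ∑ a ∈ Icc 1 R, ∑ b ∈ Icc 1 R, lam a * lam b * s.nu (a.lcm b) := by
      simp_rw [hin]
      apply sum_eq_of_support
      intro a ha
      have ha' : lam a ≠ 0 := by
        intro h0
        apply ha
        apply sum_eq_zero
        intro b _
        rw [h0, zero_mul, zero_mul]
      exact ⟨fun _ => hl.mem_Icc ha', fun _ => Nat.mem_divisors.2 ⟨hl.dvd a ha', s.prodPrimes_ne_zero⟩⟩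
    rw [hout] at h
    calc _ = (∑ a ∈ Icc 1 R, ∑ b ∈ Icc 1 R, lam a * lam b * s.nu (a.lcm b)) * zetaSum σ := by
          rw [sum_mul]
          apply sum_congr rfl; intro a _
          rw [sum_mul]
          apply sum_congr rfl; intro b _
          ring
      _ = _ := by rw [h]; ring
  rw [hform] at hsum
  have hnn : ∀ m : ℕ, 0 ≤ gW lam R m * (m : ℝ) ^ (-(1 + σ)) := by
    intro m
    rcases Nat.eq_zero_or_pos m with h | h
    · subst h
      have : ((0 : ℕ) : ℝ) ^ (-(1 + σ)) = 0 := by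
        rw [Nat.cast_zero]; exact zero_rpow (by linarith)
      rw [this, mul_zero]
    · exact mul_nonneg (hl.gW_nonneg h) (by positivity)
  have hbound : ∑ m ∈ Icc 1 (R ^ 12), gW lam R m / m
      ≤ 3 * ∑ m ∈ Icc 1 (R ^ 12), gW lam R m * (m : ℝ) ^ (-(1 + σ)) := by
    rw [mul_sum]
    apply sum_le_sum
    intro m hm
    rw [Finset.mem_Icc] at hm
    have hm0 : (0 : ℝ) < m := by exact_mod_cast hm.1
    have hg := hl.gW_nonneg (m := m) hm.1
    have hmR : (m : ℝ) ≤ ((y : ℝ) ^ 121) ^ 12 := by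
      have : (m : ℝ) ≤ ((R ^ 12 : ℕ) : ℝ) := by exact_mod_cast hm.2
      rw [hR] at this; push_cast at this; exact this
    have hms : (m : ℝ) ^ σ ≤ 3 := by
      have hlm : log m ≤ 12 * ℓ := by
        rw [hℓ, ← Nat.cast_ofNat (n := 12), ← log_pow]
        exact log_le_log hm0 hmR
      calc (m : ℝ) ^ σ = exp (log m * σ) := rpow_def_of_pos hm0 _
        _ ≤ exp 1 := by
          apply exp_le_exp.2
          rw [hσdef, mul_one_div, div_le_one (by positivity)]
          exact hlm
        _ ≤ 3 := by linarith [exp_one_lt_d9]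
    have : (1 : ℝ) / m ≤ 3 * (m : ℝ) ^ (-(1 + σ)) := by
      rw [neg_add, rpow_add hm0, rpow_neg_one, rpow_neg hm0.le, one_div]
      have : 1 ≤ 3 * ((m : ℝ) ^ σ)⁻¹ := by
        rw [← div_eq_mul_inv, le_div_iff₀ (by positivity)]; linarith
      have h2 : (0 : ℝ) < (m : ℝ)⁻¹ := by positivity
      nlinarith
    calc gW lam R m / m = gW lam R m * (1 / m) := by ring
      _ ≤ gW lam R m * (3 * (m : ℝ) ^ (-(1 + σ))) := by gcongr
      _ = _ := by ring
  have hfin := sum_le_hasSum (Icc 1 (R ^ 12)) (fun m _ => hnn m) hsum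
  have hH := log_sq_le_selSum hσ hy hσ1
  rw [← hs, ← hR] at hH
  have hz := zetaSum_le hσ
  have hH2 : ℓ ^ 2 / 87846 ≤ selSum s R := by
    rw [hℓ']; nlinarith
  have hz2 : zetaSum σ ≤ 13 * ℓ := by
    have : 1 / σ = 12 * ℓ := by rw [hσdef, one_div_one_div]
    linarith
  calc _ ≤ 3 * (zetaSum σ / selSum s R) := by linarith
    _ ≤ 3 * (13 * ℓ / (ℓ ^ 2 / 87846)) := by gcongr
    _ = 3425994 / ℓ := by field_simp; norm_num
    _ ≤ 4 * 10 ^ 6 / ℓ := by gcongr; norm_num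

end PrimeGap

namespace PrimeGap
open Real Finset
open scoped ArithmeticFunction.Moebius ArithmeticFunction.vonMangoldt

/-- The normalised density of prime powers in the window `win v θ`. -/
noncomputable def fW (θ v : ℝ) : ℝ := (∑ n ∈ win v θ, Λ n / n) / θ

/-- Prime powers whose prime is at most `y`. -/
def SmallPP (y n : ℕ) : Prop := IsPrimePow n ∧ n.minFac ≤ y

lemma vonMangoldt_div_nonneg (n : ℕ) : 0 ≤ Λ n / n :=
  div_nonneg ArithmeticFunction.vonMangoldt_nonneg (Nat.cast_nonneg _)

lemma fW_nonneg {θ : ℝ} (h : 0 ≤ θ) (v : ℝ) : 0 ≤ fW θ v :=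
  div_nonneg (sum_nonneg fun n _ => vonMangoldt_div_nonneg n) h

lemma one_div_le_exp_neg {v : ℝ} {n : ℕ} (hn : 0 < n) (h : v < log n) : 1 / (n : ℝ) ≤ exp (-v) := by
  have hn' : (0 : ℝ) < n := by exact_mod_cast hn
  rw [exp_neg, one_div]
  apply inv_anti₀ (exp_pos _)
  exact ((lt_log_iff_exp_lt hn').1 h).le

lemma mem_Ioc_exp {V : ℝ} {n : ℕ} : n ∈ Ioc 0 ⌊exp V⌋₊ ↔ 0 < n ∧ log n ≤ V := by
  rw [mem_Ioc]
  constructor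
  · rintro ⟨h1, h2⟩
    have hn' : (0 : ℝ) < n := by exact_mod_cast h1
    exact ⟨h1, (log_le_iff_le_exp hn').2 ((Nat.le_floor_iff (exp_pos _).le).1 h2)⟩
  · rintro ⟨h1, h2⟩
    have hn' : (0 : ℝ) < n := by exact_mod_cast h1
    exact ⟨h1, (Nat.le_floor_iff (exp_pos _).le).2 ((log_le_iff_le_exp hn').1 h2)⟩

lemma SmallPP.exists {y n : ℕ} (h : SmallPP y n) :
    ∃ p k : ℕ, p ∈ Nat.primesLE y ∧ 1 ≤ k ∧ p ^ k = n := by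
  obtain ⟨⟨p, k, hp, hk, rfl⟩, h2⟩ := h
  have hp' := hp.nat_prime
  rw [hp'.pow_minFac hk.ne'] at h2
  exact ⟨p, k, Nat.mem_primesLE.2 ⟨h2, hp'⟩, hk, rfl⟩

lemma SmallPP.exists_le {y n : ℕ} {V : ℝ} (h : SmallPP y n) (hV : log n ≤ V) :
    ∃ p k : ℕ, p ∈ Nat.primesLE y ∧ k ∈ Icc 1 ⌊2 * V⌋₊ ∧ p ^ k = n := by
  obtain ⟨p, k, hp, hk, rfl⟩ := h.exists
  refine ⟨p, k, hp, mem_Icc.2 ⟨hk, ?_⟩, rfl⟩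
  have hp2 : (2 : ℝ) ≤ p := by exact_mod_cast (Nat.mem_primesLE.1 hp).2.two_le
  have h2 : 0.69 ≤ log p := by
    have := log_le_log (by norm_num) hp2
    linarith [log_two_gt_d9]
  push_cast at hV
  rw [log_pow] at hV
  apply Nat.le_floor
  have : (k : ℝ) * 0.69 ≤ k * log p := by gcongr
  linarith [show (0 : ℝ) ≤ k from Nat.cast_nonneg _]

lemma card_smallPP (y : ℕ) {V : ℝ} (hV : 0 ≤ V) :
    ((({n ∈ Ioc 0 ⌊exp V⌋₊ | SmallPP y n}).card : ℕ) : ℝ) ≤ 2 * y * V := by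
  have h : {n ∈ Ioc 0 ⌊exp V⌋₊ | SmallPP y n} ⊆
      (Nat.primesLE y ×ˢ Icc 1 ⌊2 * V⌋₊).image (fun x => x.1 ^ x.2) := by
    intro n hn
    rw [mem_filter, mem_Ioc_exp] at hn
    obtain ⟨p, k, hp, hk, e⟩ := hn.2.exists_le hn.1.2
    exact mem_image.2 ⟨(p, k), mem_product.2 ⟨hp, hk⟩, e⟩
  have hc : (Nat.primesLE y).card ≤ y := by
    calc (Nat.primesLE y).card ≤ (Icc 1 y).card := card_le_card fun p hp =>
          mem_Icc.2 ⟨(Nat.mem_primesLE.1 hp).2.one_le, (Nat.mem_primesLE.1 hp).1⟩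
      _ = y := by simp
  have h2 := (card_le_card h).trans card_image_le
  rw [card_product, Nat.card_Icc, Nat.add_sub_cancel] at h2
  have h3 : ({n ∈ Ioc 0 ⌊exp V⌋₊ | SmallPP y n}).card ≤ y * ⌊2 * V⌋₊ :=
    h2.trans (Nat.mul_le_mul_right _ hc)
  calc _ ≤ ((y * ⌊2 * V⌋₊ : ℕ) : ℝ) := by exact_mod_cast h3
    _ = y * (⌊2 * V⌋₊ : ℝ) := by push_cast; ring
    _ ≤ y * (2 * V) := by gcongr; exact Nat.floor_le (by positivity)
    _ = _ := by ring

lemma sum_win_smallPP (y : ℕ) {v θ : ℝ} (hv : 0 ≤ v) (h1 : θ ≤ 1) :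
    ∑ n ∈ win v θ with SmallPP y n, (1 : ℝ) / n ≤ 2 * y * (v + 1) * exp (-v) := by
  calc ∑ n ∈ win v θ with SmallPP y n, (1 : ℝ) / n
      ≤ ∑ n ∈ win v θ with SmallPP y n, exp (-v) := by
        apply sum_le_sum
        intro n hn
        rw [mem_filter, mem_win] at hn
        exact one_div_le_exp_neg hn.1.1 hn.1.2.1
    _ = ({n ∈ win v θ | SmallPP y n}.card : ℝ) * exp (-v) := by rw [sum_const, nsmul_eq_mul]
    _ ≤ ({n ∈ Ioc 0 ⌊exp (v + 1)⌋₊ | SmallPP y n}.card : ℝ) * exp (-v) := by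
        gcongr
        intro n hn
        rw [mem_win] at hn
        exact mem_Ioc_exp.2 ⟨hn.1, by linarith [hn.2.2]⟩
    _ ≤ _ := by
        gcongr
        exact card_smallPP y (by linarith)

lemma sum_smallPP_vonMangoldt {y : ℕ} (hy : 2 ≤ y) (V : ℝ) :
    ∑ n ∈ Ioc 0 ⌊exp V⌋₊ with SmallPP y n, Λ n / n ≤ 2 * (log y + 6) := by
  have h : {n ∈ Ioc 0 ⌊exp V⌋₊ | SmallPP y n} ⊆
      (Nat.primesLE y ×ˢ Icc 1 ⌊2 * V⌋₊).image (fun x => x.1 ^ x.2) := by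
    intro n hn
    rw [mem_filter, mem_Ioc_exp] at hn
    obtain ⟨p, k, hp, hk, e⟩ := hn.2.exists_le hn.1.2
    exact mem_image.2 ⟨(p, k), mem_product.2 ⟨hp, hk⟩, e⟩
  calc _ ≤ ∑ n ∈ (Nat.primesLE y ×ˢ Icc 1 ⌊2 * V⌋₊).image (fun x => x.1 ^ x.2), Λ n / n :=
        sum_le_sum_of_subset_of_nonneg h fun n _ _ => vonMangoldt_div_nonneg n
    _ ≤ ∑ x ∈ Nat.primesLE y ×ˢ Icc 1 ⌊2 * V⌋₊, Λ (x.1 ^ x.2) / ((x.1 ^ x.2 : ℕ) : ℝ) :=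
        sum_image_le_of_nonneg (f := fun n : ℕ => Λ n / n) fun n _ => vonMangoldt_div_nonneg _
    _ = ∑ p ∈ Nat.primesLE y, ∑ k ∈ Icc 1 ⌊2 * V⌋₊, Λ (p ^ k) / ((p ^ k : ℕ) : ℝ) := sum_product _ _ _
    _ ≤ ∑ p ∈ Nat.primesLE y, 2 * (log p / p) := by
        apply sum_le_sum
        intro p hp
        have hpp := (Nat.mem_primesLE.1 hp).2
        have hp2 : (2 : ℝ) ≤ p := by exact_mod_cast hpp.two_le
        have hlp : 0 < log p := log_pos (by linarith)
        have e : ∀ k ∈ Icc 1 ⌊2 * V⌋₊, Λ (p ^ k) / ((p ^ k : ℕ) : ℝ) = log p * (1 / (p : ℝ)) ^ k := by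
          intro k hk
          rw [ArithmeticFunction.vonMangoldt_apply_pow (by have := (mem_Icc.1 hk).1; omega),
            ArithmeticFunction.vonMangoldt_apply_prime hpp]
          push_cast
          rw [one_div, inv_pow, div_eq_mul_inv]
        rw [sum_congr rfl e, ← mul_sum]
        have hg : ∀ K : ℕ, ∑ k ∈ Icc 1 K, (1 / (p : ℝ)) ^ k ≤ 2 / p - 2 * (1 / (p : ℝ)) ^ (K + 1) := by
          obtain ⟨h3, h4⟩ := inv_prime_le hpp
          intro K
          induction K with
          | zero =>
            simp only [zero_lt_one, Icc_eq_empty_of_lt, sum_empty, zero_add, pow_one]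
            rw [mul_one_div, sub_self]
          | succ K ih =>
            rw [← insert_Icc_right_eq_Icc_add_one (by omega), sum_insert (by simp)]
            have h5 : 0 < (1 / (p : ℝ)) ^ (K + 1) := by positivity
            have h6 : (1 / (p : ℝ)) ^ (K + 1 + 1) = (1 / (p : ℝ)) ^ (K + 1) * (1 / p) := pow_succ _ _
            rw [h6]; nlinarith
        have h7 := hg ⌊2 * V⌋₊
        have h8 : 0 < (1 / (p : ℝ)) ^ (⌊2 * V⌋₊ + 1) := by positivity
        calc log p * ∑ k ∈ Icc 1 ⌊2 * V⌋₊, (1 / (p : ℝ)) ^ k ≤ log p * (2 / p) := by gcongr; linarith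
          _ = _ := by ring
    _ = 2 * ∑ p ∈ Nat.primesLE y, log p / p := by rw [mul_sum]
    _ ≤ _ := by
        have := sum_primes_log_div_le hy
        linarith

section
variable {y R : ℕ} {lam : ℕ → ℝ}

lemma smallPP_or_large {n : ℕ} (hn : IsPrimePow n) :
    SmallPP y n ∨ ∀ p : ℕ, p.Prime → p ∣ n → y < p := by
  by_cases h : n.minFac ≤ y
  · exact Or.inl ⟨hn, h⟩
  · right
    intro p hp hpn
    have := Nat.minFac_le_of_dvd hp.two_le hpn
    omega

lemma sum_win_vonMangoldt_le_wt (hl : IsSieveWeight y R lam) {v θ : ℝ} (hv : 0 ≤ v) (h0 : 0 ≤ θ)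
    (h1 : θ ≤ 1) : ∑ n ∈ win v θ, Λ n / n ≤ (v + 1) * (θ * gW lam R 1 + 4 * R ^ 6 * exp (-v)
      + 2 * y * (v + 1) * exp (-v)) := by
  have h2 := (abs_le.1 (hl.sum_win_wt one_pos (v := v) h0 h1)).2
  have h3 := sum_win_smallPP y hv h1
  have key : ∑ n ∈ win v θ, Λ n / n ≤ (v + 1) * (∑ d ∈ win v θ, wt lam (d * 1) / d +
      ∑ n ∈ win v θ with SmallPP y n, (1 : ℝ) / n) := by
    rw [sum_filter, ← sum_add_distrib, mul_sum]
    apply sum_le_sum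
    intro n hn
    rw [mem_win] at hn
    have hn0 : (0 : ℝ) < n := by exact_mod_cast hn.1
    have hw := wt_nonneg lam n
    rw [mul_one]
    by_cases hp : IsPrimePow n
    · have hL : Λ n ≤ v + 1 := ArithmeticFunction.vonMangoldt_le_log.trans (by linarith [hn.2.2])
      have hge : 1 / (n : ℝ) ≤ wt lam n / n + if SmallPP y n then 1 / (n : ℝ) else 0 := by
        rcases smallPP_or_large (y := y) hp with h | h
        · rw [if_pos h]
          have : 0 ≤ wt lam n / n := by positivity
          linarith
        · rw [hl.wt_eq_one h hn.1.ne']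
          split_ifs <;> simp
      calc Λ n / n = Λ n * (1 / n) := by ring
        _ ≤ (v + 1) * (wt lam n / n + if SmallPP y n then 1 / (n : ℝ) else 0) := by gcongr
    · rw [ArithmeticFunction.vonMangoldt_eq_zero_iff.2 hp, zero_div]
      apply mul_nonneg (by linarith)
      apply add_nonneg (by positivity)
      split_ifs <;> positivity
  calc _ ≤ _ := key
    _ ≤ _ := by gcongr; linarith
end

lemma gW_one_le {y R : ℕ} {lam : ℕ → ℝ} (hl : IsSieveWeight y R lam) (hR : 1 ≤ R) {Q : ℝ}
    (hQ : ∑ m ∈ Icc 1 (R ^ 12), gW lam R m / m ≤ Q) : gW lam R 1 ≤ Q := by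
  have h := single_le_sum (f := fun m : ℕ => gW lam R m / m) (s := Icc 1 (R ^ 12))
    (fun m hm => div_nonneg (hl.gW_nonneg (mem_Icc.1 hm).1) (Nat.cast_nonneg _))
    (mem_Icc.2 ⟨le_rfl, Nat.one_le_pow _ _ hR⟩)
  simp only [Nat.cast_one, div_one] at h
  linarith

/-- A Brun–Titchmarsh inequality in short windows. -/
lemma fW_le {y : ℕ} (hy : 2 ≤ y) {v θ ℓ : ℝ} (hℓ : ℓ = log ((y : ℝ) ^ 121)) (hv : 10 * ℓ ≤ v)
    (hvR : v + 1 ≤ exp ℓ) (h0 : exp (-(2 * ℓ)) ≤ θ) (h1 : θ ≤ 1) :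
    fW θ v ≤ 5 * 10 ^ 6 * (v + 1) / ℓ := by
  obtain ⟨lam, hl, hQ⟩ := exists_sieveWeight y hy
  set R := y ^ 121 with hR
  have hy2 : (2 : ℝ) ≤ y := by exact_mod_cast hy
  have hR1 : 1 ≤ R := Nat.one_le_pow _ _ (by omega)
  have hRe : (R : ℝ) = exp ℓ := by
    rw [hℓ, exp_log (by positivity), hR]; push_cast; rfl
  have hyR : (y : ℝ) ≤ exp ℓ := by
    rw [← hRe]; exact_mod_cast Nat.le_self_pow (by norm_num) y
  have hℓ1 : 1 ≤ ℓ := by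
    have : 0.69 < log y := by
      have := log_le_log (by norm_num) hy2
      linarith [log_two_gt_d9]
    rw [hℓ, log_pow]; push_cast; linarith
  have hθ : 0 < θ := (exp_pos _).trans_le h0
  have hg := gW_one_le hl hR1 hQ
  rw [← hℓ] at hg
  have hm := sum_win_vonMangoldt_le_wt hl (v := v) (by linarith) hθ.le h1
  have hE : exp (-v) ≤ exp (-(10 * ℓ)) := exp_le_exp.2 (by linarith)
  have hℓe : exp (-ℓ) ≤ 1 / ℓ := by
    rw [exp_neg, ← one_div]
    exact one_div_le_one_div_of_le (by linarith) (by linarith [add_one_le_exp ℓ])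
  have hsmall : exp (-(4 * ℓ)) ≤ θ * (1 / ℓ) := by
    calc exp (-(4 * ℓ)) ≤ exp (-(2 * ℓ)) * exp (-ℓ) := by
          rw [← exp_add]; exact exp_le_exp.2 (by linarith)
      _ ≤ _ := by gcongr
  have ha : (R : ℝ) ^ 6 * exp (-v) ≤ exp (-(4 * ℓ)) := by
    rw [hRe]
    calc exp ℓ ^ 6 * exp (-v) ≤ exp ℓ ^ 6 * exp (-(10 * ℓ)) := by gcongr
      _ = exp (-(4 * ℓ)) := by rw [← exp_nat_mul, ← exp_add]; congr 1; push_cast; ring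
  have hb : y * (v + 1) * exp (-v) ≤ exp (-(4 * ℓ)) := by
    calc y * (v + 1) * exp (-v) ≤ exp ℓ * exp ℓ * exp (-(10 * ℓ)) := by gcongr; linarith
      _ ≤ exp (-(4 * ℓ)) := by rw [← exp_add, ← exp_add]; exact exp_le_exp.2 (by linarith)
  unfold fW
  rw [div_le_iff₀ hθ]
  calc ∑ n ∈ win v θ, Λ n / n ≤ _ := hm
    _ ≤ (v + 1) * (θ * (4 * 10 ^ 6 / ℓ) + 4 * (θ * (1 / ℓ)) + 2 * (θ * (1 / ℓ))) := by
        have : 0 ≤ v + 1 := by linarith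
        gcongr ?_ * ?_
        have : θ * gW lam R 1 ≤ θ * (4 * 10 ^ 6 / ℓ) := by gcongr
        linarith
    _ = (4000006 * (v + 1) / ℓ) * θ := by ring
    _ ≤ _ := by
        have : 0 ≤ v + 1 := by linarith
        gcongr
        norm_num
end PrimeGap

namespace PrimeGap
open Real Finset
open scoped ArithmeticFunction.Moebius ArithmeticFunction.vonMangoldt

/-! ### The Selberg identity -/

lemma selberg_mul_zeta : (ArithmeticFunction.pmul Λ ArithmeticFunction.log + Λ * Λ) *
    (ArithmeticFunction.zeta : ArithmeticFunction ℝ) =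
    ArithmeticFunction.pmul ArithmeticFunction.log ArithmeticFunction.log := by
  rw [add_mul, mul_assoc, ArithmeticFunction.vonMangoldt_mul_zeta]
  ext n
  rcases Nat.eq_zero_or_pos n with rfl | hn
  · simp
  rw [ArithmeticFunction.add_apply, ArithmeticFunction.mul_apply, ArithmeticFunction.mul_apply,
    ← sum_add_distrib, ArithmeticFunction.pmul_apply, ArithmeticFunction.log_apply]
  have h : ∑ i ∈ n.divisors, Λ i = log n := ArithmeticFunction.vonMangoldt_sum
  conv_rhs => rw [← h, sum_mul]
  rw [Nat.sum_divisorsAntidiagonal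
    (fun a b => (ArithmeticFunction.pmul Λ ArithmeticFunction.log) a *
      (ArithmeticFunction.zeta : ArithmeticFunction ℝ) b + Λ a * ArithmeticFunction.log b)]
  apply sum_congr rfl
  intro d hd
  obtain ⟨hdn, -⟩ := Nat.mem_divisors.1 hd
  obtain ⟨e, rfl⟩ := hdn
  have hd0 : 0 < d := Nat.pos_of_mul_pos_right hn
  have he0 : 0 < e := Nat.pos_of_mul_pos_left hn
  rw [Nat.mul_div_cancel_left _ hd0, h, ArithmeticFunction.pmul_apply, ArithmeticFunction.log_apply,
    ArithmeticFunction.log_apply, ArithmeticFunction.natCoe_apply,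
    ArithmeticFunction.zeta_apply_ne he0.ne', Nat.cast_mul,
    log_mul (by positivity) (by positivity)]
  push_cast
  ring

lemma sum_moebius_log_sq {n : ℕ} (hn : 0 < n) : ∑ d ∈ n.divisors, (μ d : ℝ) * (log n - log d) ^ 2 =
    log n * Λ n + (Λ * Λ) n := by
  have h := congr_arg (fun f => (f * (μ : ArithmeticFunction ℝ)) n) selberg_mul_zeta
  simp only [mul_assoc, ArithmeticFunction.coe_zeta_mul_coe_moebius, mul_one] at h
  rw [mul_comm (ArithmeticFunction.pmul ArithmeticFunction.log ArithmeticFunction.log),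
    ArithmeticFunction.add_apply, ArithmeticFunction.pmul_apply, ArithmeticFunction.log_apply,
    ArithmeticFunction.mul_apply (f := (μ : ArithmeticFunction ℝ)), Nat.sum_divisorsAntidiagonal (fun a b => (μ : ArithmeticFunction ℝ) a *
      (ArithmeticFunction.pmul ArithmeticFunction.log ArithmeticFunction.log) b)] at h
  rw [mul_comm (log n), h]
  apply sum_congr rfl
  intro d hd
  obtain ⟨hdn, -⟩ := Nat.mem_divisors.1 hd
  obtain ⟨e, rfl⟩ := hdn
  have hd0 : 0 < d := Nat.pos_of_mul_pos_right hn
  have he0 : 0 < e := Nat.pos_of_mul_pos_left hn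
  rw [Nat.mul_div_cancel_left _ hd0, ArithmeticFunction.pmul_apply, ArithmeticFunction.log_apply,
    ArithmeticFunction.intCoe_apply, Nat.cast_mul, log_mul (by positivity) (by positivity)]
  ring

lemma sum_moebius_eq_zero {n : ℕ} (hn : 1 < n) : ∑ d ∈ n.divisors, (μ d : ℝ) = 0 := by
  have h : ∑ d ∈ n.divisors, μ d = 0 := by
    rw [← ArithmeticFunction.coe_mul_zeta_apply, ArithmeticFunction.moebius_mul_coe_zeta,
      ArithmeticFunction.one_apply_ne hn.ne']
  exact_mod_cast h

lemma sum_moebius_sub_log (v : ℝ) {n : ℕ} (hn : 1 < n) :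
    ∑ d ∈ n.divisors, (μ d : ℝ) * (v - log d) = Λ n := by
  have h : ∑ d ∈ n.divisors, (μ d : ℝ) * log d = -Λ n := ArithmeticFunction.sum_moebius_mul_log_eq
  simp only [mul_sub, sum_sub_distrib, h, ← sum_mul, sum_moebius_eq_zero hn]
  ring

lemma sum_moebius_sub_log_sq (v : ℝ) {n : ℕ} (hn : 1 < n) :
    ∑ d ∈ n.divisors, (μ d : ℝ) * (v - log d) ^ 2 = (2 * v - log n) * Λ n + (Λ * Λ) n := by
  have h1 := sum_moebius_log_sq (n := n) (by omega)
  have h2 := sum_moebius_sub_log (log n) hn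
  have h3 := sum_moebius_eq_zero hn
  have : ∀ d ∈ n.divisors, (μ d : ℝ) * (v - log d) ^ 2 = (μ d : ℝ) * (log n - log d) ^ 2 +
      2 * (v - log n) * ((μ d : ℝ) * (log n - log d)) + (v - log n) ^ 2 * (μ d : ℝ) := by
    intro d _; ring
  rw [sum_congr rfl this, sum_add_distrib, sum_add_distrib, ← mul_sum, ← mul_sum, h1, h2, h3]
  ring

lemma abs_moebius_le (d : ℕ) : |(μ d : ℝ)| ≤ 1 := by
  exact_mod_cast ArithmeticFunction.abs_moebius_le_one (n := d)

lemma vonMangoldt_mul_nonneg (n : ℕ) : 0 ≤ (Λ * Λ) n := by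
  rw [ArithmeticFunction.mul_apply]
  exact sum_nonneg fun x _ => mul_nonneg ArithmeticFunction.vonMangoldt_nonneg
    ArithmeticFunction.vonMangoldt_nonneg

/-! ### Sieved windows -/

/-- The main term of sieved Möbius sums over windows, the variable being truncated at `e ^ D`. -/
noncomputable def mainM (lam : ℕ → ℝ) (R : ℕ) (D : ℝ) (i : ℕ) (v : ℝ) : ℝ :=
  ∑ d ∈ Ioc 0 ⌊exp D⌋₊, (μ d : ℝ) * gW lam R d / d * (v - log d) ^ i

lemma mainM_two_sub (lam : ℕ → ℝ) (R : ℕ) (D v w : ℝ) : mainM lam R D 2 v - mainM lam R D 2 w =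
    (v - w) * (mainM lam R D 1 v + mainM lam R D 1 w) := by
  simp only [mainM]
  rw [← sum_sub_distrib, ← sum_add_distrib, mul_sum]
  exact sum_congr rfl fun d _ => by ring

section
variable {y R : ℕ} {lam : ℕ → ℝ}

lemma IsSieveWeight.sum_small_divisors (hl : IsSieveWeight y R lam) {v θ D : ℝ} (i : ℕ) (hD : D ≤ v)
    (hD0 : 0 ≤ D) (h0 : 0 ≤ θ) (h1 : θ ≤ 1) :
    |∑ n ∈ win v θ, wt lam n / n * ∑ d ∈ n.divisors.filter (fun d : ℕ => log d ≤ D), (μ d : ℝ) * (v - log d) ^ i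
      - θ * mainM lam R D i v| ≤ v ^ i * (4 * R ^ 6 * exp (D - v)) := by
  have e1 : ∑ n ∈ win v θ, wt lam n / n * ∑ d ∈ n.divisors.filter (fun d : ℕ => log d ≤ D), (μ d : ℝ) * (v - log d) ^ i
      = ∑ d ∈ Ioc 0 ⌊exp D⌋₊, (μ d : ℝ) * (v - log d) ^ i / d *
        ∑ m ∈ win (v - log d) θ, wt lam (m * d) / m := by
    have : ∀ d ∈ Ioc 0 ⌊exp D⌋₊, (μ d : ℝ) * (v - log d) ^ i / d *
        ∑ m ∈ win (v - log d) θ, wt lam (m * d) / m =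
        ∑ n ∈ win v θ with d ∣ n, wt lam n / n * ((μ d : ℝ) * (v - log d) ^ i) := by
      intro d hd
      have hd0 : 0 < d := (mem_Ioc.1 hd).1
      rw [sum_win_mul hd0, mul_sum]
      apply sum_congr rfl
      intro m hm
      rw [mul_comm d m]
      have : (0 : ℝ) < m := by exact_mod_cast (mem_win.1 hm).1
      have : (0 : ℝ) < d := by exact_mod_cast hd0
      push_cast
      field_simp
    rw [sum_congr rfl this]
    simp only [sum_filter, mul_sum, mul_ite, mul_zero]
    rw [sum_comm]
    apply sum_congr rfl
    intro n hn
    rw [← sum_filter, ← sum_filter]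
    · apply sum_congr _ fun _ _ => rfl
      ext d
      have hn0 : n ≠ 0 := (mem_win.1 hn).1.ne'
      simp only [mem_filter, Nat.mem_divisors, mem_Ioc_exp]
      constructor
      · rintro ⟨⟨h, _⟩, h'⟩; exact ⟨⟨Nat.pos_of_dvd_of_pos h (by omega), h'⟩, h⟩
      · rintro ⟨⟨_, h'⟩, h⟩; exact ⟨⟨h, hn0⟩, h'⟩
  rw [e1, mainM, mul_sum, ← sum_sub_distrib]
  refine (abs_sum_le_sum_abs _ _).trans ?_
  have hterm : ∀ d ∈ Ioc 0 ⌊exp D⌋₊, |(μ d : ℝ) * (v - log d) ^ i / d *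
      ∑ m ∈ win (v - log d) θ, wt lam (m * d) / m - θ * ((μ d : ℝ) * gW lam R d / d * (v - log d) ^ i)|
      ≤ v ^ i * (4 * R ^ 6 * exp (-v)) := by
    intro d hd
    obtain ⟨hd0, hdD⟩ := mem_Ioc_exp.1 hd
    have hdr : (0 : ℝ) < d := by exact_mod_cast hd0
    have hlog : 0 ≤ log d := log_natCast_nonneg d
    have e : (μ d : ℝ) * (v - log d) ^ i / d *
      ∑ m ∈ win (v - log d) θ, wt lam (m * d) / m - θ * ((μ d : ℝ) * gW lam R d / d * (v - log d) ^ i)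
      = (μ d : ℝ) * (v - log d) ^ i * (1 / d) *
      (∑ m ∈ win (v - log d) θ, wt lam (m * d) / m - θ * gW lam R d) := by ring
    rw [e, abs_mul, abs_mul, abs_mul, abs_pow, abs_of_nonneg (by linarith : 0 ≤ v - log d),
      abs_of_pos (by positivity : (0 : ℝ) < 1 / d)]
    have h3 := hl.sum_win_wt hd0 (v := v - log d) h0 h1
    have h4 : exp (-(v - log d)) = d * exp (-v) := by
      rw [neg_sub, sub_eq_add_neg, exp_add, exp_log hdr]
    rw [h4] at h3
    have h5 := abs_moebius_le d
    calc |(μ d : ℝ)| * (v - log d) ^ i * (1 / d) * |∑ m ∈ win (v - log d) θ, wt lam (m * d) / m - θ * gW lam R d|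
        ≤ 1 * v ^ i * (1 / d) * (4 * R ^ 6 * (d * exp (-v))) := by
          have h6 : 0 ≤ v - log d := by linarith
          have h7 : 0 ≤ v := by linarith
          gcongr
          linarith
      _ = _ := by field_simp
  refine (sum_le_sum hterm).trans ?_
  rw [sum_const, Nat.card_Ioc, Nat.sub_zero, nsmul_eq_mul, sub_eq_add_neg, exp_add]
  have hf : (⌊exp D⌋₊ : ℝ) ≤ exp D := Nat.floor_le (exp_pos _).le
  have hv : 0 ≤ v := hD0.trans hD
  calc _ ≤ exp D * (v ^ i * (4 * R ^ 6 * exp (-v))) := by gcongr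
    _ = _ := by ring

lemma IsSieveWeight.sum_large_divisors (hl : IsSieveWeight y R lam) {v θ D B Q : ℝ} {N : ℕ} (i : ℕ)
    (h0 : 0 ≤ θ) (h1 : θ ≤ 1) (hB1 : 1 ≤ B) (hB : v - D ≤ B) (hN : exp (v + 1 - D) ≤ N)
    (hQ : ∑ m ∈ Icc 1 N, gW lam R m / m ≤ Q) :
    |∑ n ∈ win v θ, wt lam n / n * ∑ d ∈ n.divisors.filter (fun d : ℕ => ¬ log d ≤ D), (μ d : ℝ) * (v - log d) ^ i|
      ≤ B ^ i * (θ * Q + 4 * R ^ 6 * N * exp (-v)) := by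
  refine (abs_sum_le_sum_abs _ _).trans ?_
  have hpt : ∀ n ∈ win v θ, |wt lam n / n * ∑ d ∈ n.divisors.filter (fun d : ℕ => ¬ log d ≤ D), (μ d : ℝ) * (v - log d) ^ i|
      ≤ B ^ i * ∑ m ∈ Icc 1 N, if m ∣ n then wt lam n / n else 0 := by
    intro n hn
    obtain ⟨hn0, hn1, hn2⟩ := mem_win.1 hn
    have hw : 0 ≤ wt lam n / n := div_nonneg (wt_nonneg _ _) (Nat.cast_nonneg _)
    rw [abs_mul, abs_of_nonneg hw, ← sum_filter, sum_const, nsmul_eq_mul]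
    have hA : |∑ d ∈ n.divisors.filter (fun d : ℕ => ¬ log d ≤ D), (μ d : ℝ) * (v - log d) ^ i|
        ≤ #(n.divisors.filter (fun d : ℕ => ¬ log d ≤ D)) * B ^ i := by
      refine (abs_sum_le_sum_abs _ _).trans ?_
      rw [← nsmul_eq_mul, ← sum_const]
      apply sum_le_sum
      intro d hd
      rw [mem_filter, Nat.mem_divisors] at hd
      obtain ⟨⟨hdn, -⟩, hdD⟩ := hd
      have hd0 : (0 : ℝ) < d := by exact_mod_cast Nat.pos_of_dvd_of_pos hdn hn0
      have : log d ≤ log n := log_le_log hd0 (by exact_mod_cast Nat.le_of_dvd hn0 hdn)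
      rw [abs_mul, abs_pow]
      have h5 : |v - log d| ≤ B := abs_le.2 ⟨by linarith, by linarith⟩
      calc _ ≤ 1 * B ^ i := by
            gcongr
            exact abs_moebius_le d
        _ = _ := one_mul _
    have hc : #(n.divisors.filter (fun d : ℕ => ¬ log d ≤ D)) ≤ #{m ∈ Icc 1 N | m ∣ n} := by
      apply card_le_card_of_injOn (fun d => n / d)
      · intro d hd
        simp only [coe_filter, Nat.mem_divisors, Set.mem_ofPred_eq, Finset.mem_Icc] at hd ⊢
        obtain ⟨⟨hdn, -⟩, hdD⟩ := hd
        have hd0 := Nat.pos_of_dvd_of_pos hdn hn0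
        refine ⟨⟨Nat.div_pos (Nat.le_of_dvd hn0 hdn) hd0, ?_⟩, Nat.div_dvd_of_dvd hdn⟩
        have hdr : (0 : ℝ) < d := by exact_mod_cast hd0
        have hnr : (0 : ℝ) < n := by exact_mod_cast hn0
        have : ((n / d : ℕ) : ℝ) ≤ N := by
          refine le_trans ?_ hN
          rw [Nat.cast_div hdn hdr.ne', ← exp_log hnr, ← exp_log hdr, ← exp_sub]
          apply exp_le_exp.2
          linarith
        exact_mod_cast this
      · intro a ha b hb hab
        simp only [coe_filter, Nat.mem_divisors, Set.mem_ofPred_eq] at ha hb hab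
        have := Nat.div_div_self ha.1.1 hn0.ne'
        rw [hab, Nat.div_div_self hb.1.1 hn0.ne'] at this
        exact this.symm
    have hc' : (#(n.divisors.filter (fun d : ℕ => ¬ log d ≤ D)) : ℝ) ≤ #{m ∈ Icc 1 N | m ∣ n} := by exact_mod_cast hc
    calc _ ≤ wt lam n / n * (#{m ∈ Icc 1 N | m ∣ n} * B ^ i) := by
          gcongr; exact hA.trans (by gcongr)
      _ = _ := by ring
  refine (sum_le_sum hpt).trans ?_
  rw [← mul_sum, sum_comm]
  have hm : ∀ m ∈ Icc 1 N, ∑ n ∈ win v θ, (if m ∣ n then wt lam n / n else 0) ≤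
      θ * (gW lam R m / m) + 4 * R ^ 6 * exp (-v) := by
    intro m hm
    have hm0 : 0 < m := (Finset.mem_Icc.1 hm).1
    have hmr : (0 : ℝ) < m := by exact_mod_cast hm0
    have h4 : exp (-(v - log m)) = m * exp (-v) := by
      rw [neg_sub, sub_eq_add_neg, exp_add, exp_log hmr]
    have h3 := (abs_le.1 (hl.sum_win_wt hm0 (v := v - log m) h0 h1)).2
    rw [h4] at h3
    have e : ∑ d ∈ win (v - log m) θ, wt lam (m * d) / ((m * d : ℕ) : ℝ) =
        1 / m * ∑ d ∈ win (v - log m) θ, wt lam (d * m) / d := by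
      rw [mul_sum]
      refine sum_congr rfl fun d _ => ?_
      rw [mul_comm m d, Nat.cast_mul, div_mul_div_comm, one_mul, mul_comm (d : ℝ)]
    rw [← sum_filter, sum_win_mul hm0, e]
    calc _ ≤ 1 / m * (θ * gW lam R m + 4 * R ^ 6 * (m * exp (-v))) := by gcongr; linarith
      _ = _ := by field_simp
  have := sum_le_sum hm
  rw [sum_add_distrib, ← mul_sum, sum_const, Nat.card_Icc, nsmul_eq_mul, Nat.add_sub_cancel] at this
  gcongr
  calc _ ≤ _ := this
    _ ≤ θ * Q + N * (4 * R ^ 6 * exp (-v)) := by gcongr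
    _ = _ := by ring

end

end PrimeGap

namespace PrimeGap
open Real Finset
open scoped ArithmeticFunction.Moebius ArithmeticFunction.vonMangoldt

/-- The standing assumptions for Selberg's formula in short windows: `y` is the sifting level,
`ℓ` the logarithm of the sieve support, and `F` bounds the density of prime powers. -/
structure Setup (y : ℕ) (ℓ v F : ℝ) : Prop where
  two_le : 2 ≤ y
  eq_log : ℓ = log ((y : ℝ) ^ 121)
  le_v : 30 * ℓ ≤ v
  pow_le : (v + ℓ + 10) ^ 4 ≤ exp ℓ
  fW_le : ∀ u θ : ℝ, v / 2 ≤ u → u ≤ v + ℓ → exp (-(2 * ℓ)) ≤ θ → θ ≤ 1 → fW θ u ≤ F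

namespace Setup
variable {y : ℕ} {ℓ v F : ℝ}

lemma log_ge (h : Setup y ℓ v F) : 121 * 0.69 ≤ ℓ := by
  have hy2 : (2 : ℝ) ≤ y := by exact_mod_cast h.two_le
  have h1 : 0.69 < log y := by
    have := log_le_log (by norm_num) hy2
    linarith [log_two_gt_d9]
  rw [h.eq_log, log_pow]; push_cast; linarith

lemma eq_exp (h : Setup y ℓ v F) : ((y ^ 121 : ℕ) : ℝ) = exp ℓ := by
  have hy2 : (2 : ℝ) ≤ y := by exact_mod_cast h.two_le
  rw [h.eq_log, exp_log (by positivity)]; push_cast; rfl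

lemma F_nonneg (h : Setup y ℓ v F) : 0 ≤ F := by
  have := h.log_ge
  have := h.le_v
  exact (fW_nonneg zero_le_one v).trans
    (h.fW_le v 1 (by linarith) (by linarith) (exp_le_one_iff.2 (by linarith)) le_rfl)

variable {lam : ℕ → ℝ} {w θ : ℝ}

lemma sieved_moebius (h : Setup y ℓ v F) (hl : IsSieveWeight y (y ^ 121) lam)
    (hQ : ∑ m ∈ Icc 1 ((y ^ 121) ^ 12), gW lam (y ^ 121) m / m ≤ 4 * 10 ^ 6 / ℓ)
    (hw : v ≤ w) (hw' : w ≤ v + ℓ) (h0 : exp (-(2 * ℓ)) ≤ θ) (h1 : θ ≤ 1) (i : ℕ) (hi : i ≤ 2) :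
    |∑ n ∈ win w θ, wt lam n / n * ∑ d ∈ n.divisors, (μ d : ℝ) * (w - log d) ^ i
      - θ * mainM lam (y ^ 121) (v - 9 * ℓ) i w| ≤ θ * (8 + (10 * ℓ) ^ i * (4 * 10 ^ 6 / ℓ)) := by
  have hℓ := h.log_ge
  have hv := h.le_v
  have hpow := h.pow_le
  have hR := h.eq_exp
  have hθ : 0 < θ := (exp_pos _).trans_le h0
  have hE : 1 ≤ exp ℓ := one_le_exp (by linarith)
  have hsmall : ∀ z : ℝ, 1 ≤ z → z ≤ v + ℓ + 10 → z ^ i ≤ exp ℓ := fun z hz hz' =>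
    (pow_le_pow_right₀ hz (by omega : i ≤ 4)).trans
      ((pow_le_pow_left₀ (by linarith) hz' 4).trans hpow)
  have A := hl.sum_small_divisors (v := w) (θ := θ) (D := v - 9 * ℓ) i (by linarith) (by linarith)
    hθ.le h1
  have B := hl.sum_large_divisors (v := w) (θ := θ) (D := v - 9 * ℓ) (B := 10 * ℓ)
    (N := (y ^ 121) ^ 12) i hθ.le h1 (by linarith) (by linarith)
    (by rw [Nat.cast_pow, hR, ← exp_nat_mul]; apply exp_le_exp.2; push_cast; linarith) hQ
  have A' : w ^ i * (4 * ((y ^ 121 : ℕ) : ℝ) ^ 6 * exp (v - 9 * ℓ - w)) ≤ 4 * θ := by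
    have h2 := hsmall w (by linarith) (by linarith)
    calc _ ≤ exp ℓ * (4 * (exp ℓ) ^ 6 * exp (-(9 * ℓ))) := by
          rw [hR]; gcongr; linarith
      _ = 4 * exp (-(2 * ℓ)) := by
          rw [← exp_nat_mul]
          have : exp (-(2 * ℓ)) = exp ℓ * exp ((6 : ℕ) * ℓ) * exp (-(9 * ℓ)) := by
            rw [← exp_add, ← exp_add]; congr 1; push_cast; ring
          rw [this]; ring
      _ ≤ _ := by linarith
  have B' : (10 * ℓ) ^ i * (4 * ((y ^ 121 : ℕ) : ℝ) ^ 6 * (((y ^ 121) ^ 12 : ℕ) : ℝ) * exp (-w))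
      ≤ 4 * θ := by
    have h2 := hsmall (10 * ℓ) (by linarith) (by linarith)
    calc _ ≤ exp ℓ * (4 * (exp ℓ) ^ 6 * (exp ℓ) ^ 12 * exp (-(30 * ℓ))) := by
          rw [Nat.cast_pow (y ^ 121) 12, hR]; gcongr; linarith
      _ = 4 * exp (-(11 * ℓ)) := by
          rw [← exp_nat_mul, ← exp_nat_mul]
          have : exp (-(11 * ℓ)) = exp ℓ * exp ((6 : ℕ) * ℓ) * exp ((12 : ℕ) * ℓ) *
              exp (-(30 * ℓ)) := by
            rw [← exp_add, ← exp_add, ← exp_add]; congr 1; push_cast; ring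
          rw [this]; ring
      _ ≤ 4 * exp (-(2 * ℓ)) := by gcongr; linarith
      _ ≤ _ := by linarith
  have hsplit : ∑ n ∈ win w θ, wt lam n / n * ∑ d ∈ n.divisors, (μ d : ℝ) * (w - log d) ^ i =
      ∑ n ∈ win w θ, wt lam n / n * ∑ d ∈ n.divisors.filter (fun d : ℕ => log d ≤ v - 9 * ℓ),
        (μ d : ℝ) * (w - log d) ^ i +
      ∑ n ∈ win w θ, wt lam n / n * ∑ d ∈ n.divisors.filter (fun d : ℕ => ¬ log d ≤ v - 9 * ℓ),
        (μ d : ℝ) * (w - log d) ^ i := by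
    rw [← sum_add_distrib]
    refine sum_congr rfl fun n _ => ?_
    rw [← mul_add, sum_filter_add_sum_filter_not]
  rw [hsplit]
  have A2 := abs_le.1 (A.trans A')
  rw [mul_add ((10 * ℓ) ^ i)] at B
  have B2 := abs_le.1 B
  rw [abs_le]
  constructor <;> nlinarith [A2.1, A2.2, B2.1, B2.2]

lemma vonMangoldt_wt_le (hl : IsSieveWeight y (y ^ 121) lam) {n : ℕ} :
    wt lam n * Λ n ≤ 4096 * Λ n := by
  by_cases hp : IsPrimePow n
  · refine mul_le_mul_of_nonneg_right (hl.wt_le ?_) ArithmeticFunction.vonMangoldt_nonneg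
    have := isPrimePow_iff_card_primeFactors_eq_one.1 hp
    omega
  · rw [ArithmeticFunction.vonMangoldt_eq_zero_iff.2 hp]; simp

lemma sum_eq_fW (hθ : 0 < θ) (w : ℝ) : ∑ n ∈ win w θ, Λ n / n = θ * fW θ w := by
  rw [fW]; field_simp

lemma one_lt_of_mem (h : Setup y ℓ v F) (hw : v ≤ w) {n : ℕ} (hn : n ∈ win w θ) : 1 < n := by
  obtain ⟨h1, h2, -⟩ := mem_win.1 hn
  by_contra hc
  have : n = 1 := by omega
  subst this
  have := h.log_ge
  have := h.le_v
  simp at h2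
  linarith

lemma mainM_one_le (h : Setup y ℓ v F) (hl : IsSieveWeight y (y ^ 121) lam)
    (hQ : ∑ m ∈ Icc 1 ((y ^ 121) ^ 12), gW lam (y ^ 121) m / m ≤ 4 * 10 ^ 6 / ℓ)
    (hw : v ≤ w) (hw' : w ≤ v + ℓ) : |mainM lam (y ^ 121) (v - 9 * ℓ) 1 w| ≤ 4096 * F + 10 ^ 8 := by
  have hℓ := h.log_ge
  have hv := h.le_v
  have h0 : exp (-(2 * ℓ)) ≤ 1 := exp_le_one_iff.2 (by linarith)
  have A := h.sieved_moebius hl hQ hw hw' h0 le_rfl 1 (by norm_num)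
  have e : ∑ n ∈ win w 1, wt lam n / n * ∑ d ∈ n.divisors, (μ d : ℝ) * (w - log d) ^ 1 =
      ∑ n ∈ win w 1, wt lam n * Λ n / n := by
    refine sum_congr rfl fun n hn => ?_
    simp only [pow_one]
    rw [sum_moebius_sub_log _ (h.one_lt_of_mem hw hn)]
    ring
  have T0 : 0 ≤ ∑ n ∈ win w 1, wt lam n * Λ n / n := sum_nonneg fun n _ =>
    div_nonneg (mul_nonneg (wt_nonneg _ _) ArithmeticFunction.vonMangoldt_nonneg) (Nat.cast_nonneg _)
  have T1 : ∑ n ∈ win w 1, wt lam n * Λ n / n ≤ 4096 * F := by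
    calc _ ≤ ∑ n ∈ win w 1, 4096 * (Λ n / n) := by
          refine sum_le_sum fun n _ => ?_
          rw [← mul_div_assoc]
          exact div_le_div_of_nonneg_right (vonMangoldt_wt_le hl) (Nat.cast_nonneg _)
      _ = 4096 * fW 1 w := by rw [← mul_sum, sum_eq_fW one_pos, one_mul]
      _ ≤ _ := by gcongr; exact h.fW_le w 1 (by linarith) hw' h0 le_rfl
  rw [e, one_mul, one_mul, pow_one] at A
  have e2 : 10 * ℓ * (4 * 10 ^ 6 / ℓ) = 4 * 10 ^ 7 := by
    have : ℓ ≠ 0 := by linarith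
    field_simp
  rw [e2] at A
  have A2 := abs_le.1 A
  have := h.F_nonneg
  rw [abs_le]
  constructor <;> linarith

lemma mainM_two_close (h : Setup y ℓ v F) (hl : IsSieveWeight y (y ^ 121) lam)
    (hQ : ∑ m ∈ Icc 1 ((y ^ 121) ^ 12), gW lam (y ^ 121) m / m ≤ 4 * 10 ^ 6 / ℓ)
    (hw : v ≤ w) (hw' : w ≤ v + ℓ) :
    |mainM lam (y ^ 121) (v - 9 * ℓ) 2 w - mainM lam (y ^ 121) (v - 9 * ℓ) 2 v| ≤
      ℓ * (8192 * F + 2 * 10 ^ 8) := by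
  have hℓ := h.log_ge
  rw [mainM_two_sub, abs_mul, abs_of_nonneg (by linarith)]
  have h1 := h.mainM_one_le hl hQ hw hw'
  have h2 := h.mainM_one_le hl hQ le_rfl (by linarith)
  apply mul_le_mul (by linarith) _ (abs_nonneg _) (by linarith)
  exact (abs_add_le _ _).trans (by linarith)

end Setup
end PrimeGap

namespace PrimeGap
open Real Finset
open scoped ArithmeticFunction.Moebius ArithmeticFunction.vonMangoldt

lemma sum_win_antidiagonal {w θ V : ℝ} (hV : w + θ ≤ V) (G : ℕ → ℕ → ℝ) :
    ∑ n ∈ win w θ, ∑ x ∈ n.divisorsAntidiagonal, G x.1 x.2 =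
      ∑ a ∈ Ioc 0 ⌊exp V⌋₊, ∑ b ∈ win (w - log a) θ, G a b := by
  have h1 : ∀ a ∈ Ioc 0 ⌊exp V⌋₊, ∑ b ∈ win (w - log a) θ, G a b =
      ∑ n ∈ win w θ with a ∣ n, G a (n / a) := by
    intro a ha
    have ha0 : 0 < a := (mem_Ioc.1 ha).1
    rw [sum_win_mul ha0 w θ (fun n => G a (n / a))]
    exact sum_congr rfl fun b _ => by rw [Nat.mul_div_cancel_left _ ha0]
  rw [sum_congr rfl h1]
  simp only [sum_filter]
  rw [sum_comm]
  refine sum_congr rfl fun n hn => ?_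
  obtain ⟨hn0, -, hn2⟩ := mem_win.1 hn
  rw [Nat.sum_divisorsAntidiagonal G, ← sum_filter]
  refine sum_congr ?_ fun _ _ => rfl
  ext d
  simp only [mem_filter, Nat.mem_divisors, mem_Ioc_exp]
  constructor
  · rintro ⟨h, _⟩
    have hd0 := Nat.pos_of_dvd_of_pos h hn0
    have : log d ≤ log n :=
      log_le_log (by exact_mod_cast hd0) (by exact_mod_cast Nat.le_of_dvd hn0 h)
    exact ⟨⟨hd0, by linarith⟩, h⟩
  · rintro ⟨_, h⟩; exact ⟨h, hn0.ne'⟩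

lemma sum_antidiagonal_add_swap (n : ℕ) (G H : ℕ → ℕ → ℝ) (hH : ∀ a b, H a b = G b a) :
    ∑ x ∈ n.divisorsAntidiagonal, (G x.1 x.2 + H x.1 x.2) =
      2 * ∑ x ∈ n.divisorsAntidiagonal, G x.1 x.2 := by
  rw [sum_add_distrib, two_mul]
  congr 1
  refine sum_equiv (Equiv.prodComm ℕ ℕ) (fun x => ?_) fun x _ => by simp [hH]
  exact Nat.swap_mem_divisorsAntidiagonal.symm

lemma sum_win_vonMangoldt_mul_vonMangoldt {w θ V : ℝ} (hV : w + θ ≤ V) :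
    ∑ n ∈ win w θ, (Λ * Λ) n / n =
      ∑ a ∈ Ioc 0 ⌊exp V⌋₊, Λ a / a * ∑ b ∈ win (w - log a) θ, Λ b / b := by
  have : ∀ n ∈ win w θ, (Λ * Λ) n / n =
      ∑ x ∈ n.divisorsAntidiagonal, Λ x.1 / x.1 * (Λ x.2 / x.2) := by
    intro n _
    rw [ArithmeticFunction.mul_apply, sum_div]
    refine sum_congr rfl fun x hx => ?_
    rw [← (Nat.mem_divisorsAntidiagonal.1 hx).1, div_mul_div_comm, Nat.cast_mul]
  rw [sum_congr rfl this, sum_win_antidiagonal hV (fun a b => Λ a / a * (Λ b / b))]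
  exact sum_congr rfl fun a _ => (mul_sum _ _ _).symm

section
variable {y R : ℕ} {lam : ℕ → ℝ}

lemma card_primeFactors_mul_le {a b : ℕ} (ha : IsPrimePow a) (hb : IsPrimePow b) :
    (a * b).primeFactors.card ≤ 2 := by
  rw [Nat.primeFactors_mul ha.ne_zero hb.ne_zero]
  refine (card_union_le _ _).trans ?_
  rw [isPrimePow_iff_card_primeFactors_eq_one.1 ha, isPrimePow_iff_card_primeFactors_eq_one.1 hb]

lemma abs_wt_sub_one_le (hl : IsSieveWeight y R lam) {n : ℕ} (hn : n.primeFactors.card ≤ 2) :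
    |wt lam n - 1| ≤ 4096 := by
  have h1 := hl.wt_le hn
  have h2 := wt_nonneg lam n
  rw [abs_le]; constructor <;> linarith

/-- The contribution to `Λ a * Λ b / (a * b)` of the `a` that are powers of small primes. -/
noncomputable def smallPair (y a b : ℕ) : ℝ := if SmallPP y a then Λ a / a * (Λ b / b) else 0

lemma abs_wt_sub_one_mul_vonMangoldt (hl : IsSieveWeight y R lam) (n : ℕ) :
    |wt lam n - 1| * Λ n ≤ 4096 * if SmallPP y n then log n else 0 := by
  by_cases hp : IsPrimePow n
  · rcases smallPP_or_large (y := y) hp with h | h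
    · rw [if_pos h]
      have h1 := abs_wt_sub_one_le hl (n := n)
        (by rw [isPrimePow_iff_card_primeFactors_eq_one.1 hp]; norm_num)
      exact mul_le_mul h1 ArithmeticFunction.vonMangoldt_le_log
        ArithmeticFunction.vonMangoldt_nonneg (by norm_num)
    · rw [hl.wt_eq_one h hp.ne_zero, sub_self, abs_zero, zero_mul]
      split_ifs
      · exact mul_nonneg (by norm_num) (log_natCast_nonneg n)
      · simp
  · rw [ArithmeticFunction.vonMangoldt_eq_zero_iff.2 hp, mul_zero]
    split_ifs
    · exact mul_nonneg (by norm_num) (log_natCast_nonneg n)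
    · simp

lemma abs_wt_sub_one_mul_convolution (hl : IsSieveWeight y R lam) (n : ℕ) :
    |wt lam n - 1| * ((Λ * Λ) n / n) ≤
      4096 * (2 * ∑ x ∈ n.divisorsAntidiagonal, smallPair y x.1 x.2) := by
  rw [← sum_antidiagonal_add_swap n (smallPair y) (fun a b => smallPair y b a) fun _ _ => rfl,
    ArithmeticFunction.mul_apply, sum_div, mul_sum, mul_sum]
  refine sum_le_sum fun x hx => ?_
  obtain ⟨hx1, hx0⟩ := Nat.mem_divisorsAntidiagonal.1 hx
  have hnn : ∀ a b, 0 ≤ smallPair y a b := fun a b => by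
    unfold smallPair
    split_ifs
    · exact mul_nonneg (vonMangoldt_div_nonneg _) (vonMangoldt_div_nonneg _)
    · exact le_rfl
  have hR : 0 ≤ 4096 * (smallPair y x.1 x.2 + smallPair y x.2 x.1) :=
    mul_nonneg (by norm_num) (add_nonneg (hnn _ _) (hnn _ _))
  have e : Λ x.1 * Λ x.2 / n = Λ x.1 / x.1 * (Λ x.2 / x.2) := by
    rw [← hx1, div_mul_div_comm, Nat.cast_mul]
  by_cases h1 : IsPrimePow x.1
  swap
  · rw [ArithmeticFunction.vonMangoldt_eq_zero_iff.2 h1]; simpa using hR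
  by_cases h2 : IsPrimePow x.2
  swap
  · rw [ArithmeticFunction.vonMangoldt_eq_zero_iff.2 h2]; simpa using hR
  have hw : |wt lam n - 1| ≤ 4096 := by
    rw [← hx1]; exact abs_wt_sub_one_le hl (card_primeFactors_mul_le h1 h2)
  have hpos : 0 ≤ Λ x.1 / x.1 * (Λ x.2 / x.2) :=
    mul_nonneg (vonMangoldt_div_nonneg _) (vonMangoldt_div_nonneg _)
  rw [e]
  rcases smallPP_or_large (y := y) h1 with h | h
  · have : smallPair y x.1 x.2 = Λ x.1 / x.1 * (Λ x.2 / x.2) := if_pos h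
    rw [← this] at hpos ⊢
    apply mul_le_mul hw _ hpos (by norm_num)
    linarith [hnn x.2 x.1]
  rcases smallPP_or_large (y := y) h2 with h' | h'
  · have : smallPair y x.2 x.1 = Λ x.1 / x.1 * (Λ x.2 / x.2) := by
      unfold smallPair; rw [if_pos h', mul_comm]
    rw [← this] at hpos ⊢
    apply mul_le_mul hw _ hpos (by norm_num)
    linarith [hnn x.1 x.2]
  · rw [← hx1, hl.wt_eq_one (fun p hp hpd => ?_) (mul_ne_zero h1.ne_zero h2.ne_zero), sub_self,
      abs_zero, zero_mul]
    · exact hR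
    · rcases hp.dvd_mul.1 hpd with hd | hd
      · exact h p hp hd
      · exact h' p hp hd

end

namespace Setup
variable {y : ℕ} {ℓ v F : ℝ} {lam : ℕ → ℝ} {w θ : ℝ}

lemma y_le (h : Setup y ℓ v F) : (y : ℝ) ≤ exp ℓ := by
  rw [← h.eq_exp]; exact_mod_cast Nat.le_self_pow (by norm_num) y

lemma log_y_add_le (h : Setup y ℓ v F) : log y + 6 ≤ ℓ := by
  have h1 := h.log_ge
  have h2 := h.eq_log
  rw [log_pow] at h2
  push_cast at h2
  linarith

lemma sum_smallPair_le (h : Setup y ℓ v F) (hw : v ≤ w) (hw' : w ≤ v + ℓ)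
    (h0 : exp (-(2 * ℓ)) ≤ θ) (h1 : θ ≤ 1) :
    ∑ a ∈ Ioc 0 ⌊exp (w + 1)⌋₊, ∑ b ∈ win (w - log a) θ, smallPair y a b ≤
      θ * (2 * F * ℓ + 2) := by
  have hℓ := h.log_ge
  have hv := h.le_v
  have hF := h.F_nonneg
  have hθ : 0 < θ := (exp_pos _).trans_le h0
  have e1 : ∑ a ∈ Ioc 0 ⌊exp (w + 1)⌋₊, ∑ b ∈ win (w - log a) θ, smallPair y a b =
      ∑ a ∈ Ioc 0 ⌊exp (w + 1)⌋₊ with SmallPP y a, Λ a / a * ∑ b ∈ win (w - log a) θ, Λ b / b := by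
    rw [sum_filter]
    refine sum_congr rfl fun a _ => ?_
    unfold smallPair
    split_ifs
    · rw [mul_sum]
    · simp
  have e2 : ∀ a ∈ {a ∈ Ioc 0 ⌊exp (w + 1)⌋₊ | SmallPP y a},
      Λ a / a * ∑ b ∈ win (w - log a) θ, Λ b / b ≤
      θ * F * (Λ a / a) + (w + 1) * exp (-(w / 2)) * (w / 2 + 7) := by
    intro a ha
    obtain ⟨ha1, ha2⟩ := mem_filter.1 ha
    obtain ⟨ha0, haw⟩ := mem_Ioc_exp.1 ha1
    have hla := log_natCast_nonneg a
    have hL := vonMangoldt_div_nonneg a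
    have hX : 0 ≤ (w + 1) * exp (-(w / 2)) * (w / 2 + 7) := by
      have : 0 ≤ w := by linarith
      positivity
    by_cases hc : log a ≤ w / 2
    · have : ∑ b ∈ win (w - log a) θ, Λ b / b ≤ θ * F := by
        rw [sum_eq_fW hθ]
        gcongr
        exact h.fW_le _ _ (by linarith) (by linarith) h0 h1
      calc _ ≤ Λ a / a * (θ * F) := by gcongr
        _ ≤ _ := by linarith
    · push Not at hc
      have h3 : Λ a / a ≤ (w + 1) * exp (-(w / 2)) := by
        rw [div_eq_mul_one_div]
        apply mul_le_mul _ (one_div_le_exp_neg ha0 hc) (by positivity) (by linarith)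
        exact ArithmeticFunction.vonMangoldt_le_log.trans haw
      have h4 : ∑ b ∈ win (w - log a) θ, Λ b / b ≤ w / 2 + 7 := by
        rw [sum_win_vonMangoldt _ hθ.le]
        have h5 : mert (w - log a + θ) ≤ mert (w / 2 + 1) := mert_mono (by linarith)
        have h6 := (abs_le.1 (abs_mert_sub_le (v := w / 2 + 1) (by linarith))).2
        have h7 : 0 ≤ mert (w - log a) := sum_nonneg fun n _ => vonMangoldt_div_nonneg n
        linarith
      calc _ ≤ (w + 1) * exp (-(w / 2)) * (w / 2 + 7) := by
            apply mul_le_mul h3 h4 (sum_nonneg fun n _ => vonMangoldt_div_nonneg n)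
            have : 0 ≤ w := by linarith
            positivity
        _ ≤ _ := by have : 0 ≤ θ * F * (Λ a / a) := by positivity
                    linarith
  rw [e1]
  refine (sum_le_sum e2).trans ?_
  rw [sum_add_distrib, ← mul_sum, sum_const, nsmul_eq_mul]
  have h5 := sum_smallPP_vonMangoldt h.two_le (w + 1)
  have h6 := card_smallPP y (V := w + 1) (by linarith)
  have h7 := h.log_y_add_le
  have h8 : 2 * y * (w + 1) * ((w + 1) * exp (-(w / 2)) * (w / 2 + 7)) ≤ 2 * θ := by
    have hw0 : 0 ≤ w := by linarith
    have hvl : 0 ≤ v + ℓ + 10 := by linarith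
    have h9 : (w + 1) * (w + 1) * (w / 2 + 7) ≤ exp ℓ := by
      calc (w + 1) * (w + 1) * (w / 2 + 7) ≤ (v + ℓ + 10) * (v + ℓ + 10) * (v + ℓ + 10) := by
            gcongr <;> linarith
        _ = (v + ℓ + 10) ^ 3 := by ring
        _ ≤ (v + ℓ + 10) ^ 4 := pow_le_pow_right₀ (by linarith) (by norm_num)
        _ ≤ _ := h.pow_le
    have h10 := h.y_le
    calc _ = 2 * y * ((w + 1) * (w + 1) * (w / 2 + 7)) * exp (-(w / 2)) := by ring
      _ ≤ 2 * exp ℓ * exp ℓ * exp (-(15 * ℓ)) := by gcongr; linarith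
      _ = 2 * exp (-(13 * ℓ)) := by rw [mul_assoc, mul_assoc, ← exp_add, ← exp_add]; ring_nf
      _ ≤ 2 * exp (-(2 * ℓ)) := by gcongr; linarith
      _ ≤ _ := by linarith
  have h11 : 0 ≤ (w + 1) * exp (-(w / 2)) * (w / 2 + 7) := by
    have hw0 : 0 ≤ w := by linarith
    positivity
  calc _ ≤ θ * F * (2 * ℓ) + 2 * y * (w + 1) * ((w + 1) * exp (-(w / 2)) * (w / 2 + 7)) := by
        gcongr; linarith
    _ ≤ _ := by linarith

/-- The sieved second-order sum is close to the genuine one. -/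
lemma unsieve (h : Setup y ℓ v F) (hl : IsSieveWeight y (y ^ 121) lam) (hw : v ≤ w)
    (hw' : w ≤ v + ℓ) (h0 : exp (-(2 * ℓ)) ≤ θ) (h1 : θ ≤ 1) :
    |∑ n ∈ win w θ, wt lam n / n * ∑ d ∈ n.divisors, (μ d : ℝ) * (w - log d) ^ 2 -
      ∑ n ∈ win w θ, ((2 * w - log n) * Λ n + (Λ * Λ) n) / n| ≤ θ * (4096 * (4 * F * ℓ + 6)) := by
  have hℓ := h.log_ge
  have hv := h.le_v
  rw [← sum_sub_distrib]
  refine (abs_sum_le_sum_abs _ _).trans ?_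
  have hpt : ∀ n ∈ win w θ, |wt lam n / n * ∑ d ∈ n.divisors, (μ d : ℝ) * (w - log d) ^ 2 -
      ((2 * w - log n) * Λ n + (Λ * Λ) n) / n| ≤
      4096 * (w * (w + 1)) * (if SmallPP y n then 1 / (n : ℝ) else 0) +
      4096 * (2 * ∑ x ∈ n.divisorsAntidiagonal, smallPair y x.1 x.2) := by
    intro n hn
    rw [sum_moebius_sub_log_sq _ (h.one_lt_of_mem hw hn)]
    obtain ⟨hn0, hn1, hn2⟩ := mem_win.1 hn
    have hnr : (0 : ℝ) < n := by exact_mod_cast hn0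
    have e : wt lam n / n * ((2 * w - log n) * Λ n + (Λ * Λ) n) -
      ((2 * w - log n) * Λ n + (Λ * Λ) n) / n =
      (wt lam n - 1) * ((2 * w - log n) * (Λ n / n) + (Λ * Λ) n / n) := by field_simp
    have hnn := vonMangoldt_mul_nonneg n
    have h2 : 0 ≤ 2 * w - log n := by linarith
    rw [e, abs_mul, abs_of_nonneg (a := (2 * w - log n) * (Λ n / n) + (Λ * Λ) n / n)
      (add_nonneg (mul_nonneg h2 (vonMangoldt_div_nonneg _)) (by positivity)), mul_add]
    apply add_le_add _ (abs_wt_sub_one_mul_convolution hl n)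
    have A := abs_wt_sub_one_mul_vonMangoldt hl n
    calc _ = (2 * w - log n) / n * (|wt lam n - 1| * Λ n) := by ring
      _ ≤ w / n * (4096 * if SmallPP y n then log n else 0) := by
          have hnneg : 0 ≤ |wt lam n - 1| * Λ n :=
            mul_nonneg (abs_nonneg _) ArithmeticFunction.vonMangoldt_nonneg
          have : 0 ≤ w := by linarith
          gcongr
          linarith
      _ ≤ _ := by
          split_ifs
          · have h3 : 0 ≤ w := by linarith
            calc w / n * (4096 * log n) ≤ w / n * (4096 * (w + 1)) := by gcongr; linarith
              _ = _ := by ring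
          · simp
  refine (sum_le_sum hpt).trans ?_
  rw [sum_add_distrib, ← mul_sum, ← mul_sum, ← mul_sum, ← sum_filter,
    sum_win_antidiagonal (V := w + 1) (by linarith) (smallPair y)]
  have A := h.sum_smallPair_le hw hw' h0 h1
  have B := sum_win_smallPP y (v := w) (θ := θ) (by linarith) h1
  have h10 := h.y_le
  have hw0 : 0 ≤ w := by linarith
  have C : w * (w + 1) * (2 * y * (w + 1) * exp (-w)) ≤ 2 * θ := by
    have hvl : 0 ≤ v + ℓ + 10 := by linarith
    have h9 : w * (w + 1) * (w + 1) ≤ exp ℓ := by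
      calc w * (w + 1) * (w + 1) ≤ (v + ℓ + 10) * (v + ℓ + 10) * (v + ℓ + 10) := by
            gcongr <;> linarith
        _ = (v + ℓ + 10) ^ 3 := by ring
        _ ≤ (v + ℓ + 10) ^ 4 := pow_le_pow_right₀ (by linarith) (by norm_num)
        _ ≤ _ := h.pow_le
    calc _ = 2 * y * (w * (w + 1) * (w + 1)) * exp (-w) := by ring
      _ ≤ 2 * exp ℓ * exp ℓ * exp (-(15 * ℓ)) := by gcongr; linarith
      _ = 2 * exp (-(13 * ℓ)) := by rw [mul_assoc, mul_assoc, ← exp_add, ← exp_add]; ring_nf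
      _ ≤ 2 * exp (-(2 * ℓ)) := by gcongr; linarith
      _ ≤ _ := by linarith
  have D : w * (w + 1) * ∑ n ∈ win w θ with SmallPP y n, 1 / (n : ℝ) ≤ 2 * θ :=
    (mul_le_mul_of_nonneg_left B (by positivity)).trans C
  calc _ = 4096 * (w * (w + 1) * ∑ n ∈ win w θ with SmallPP y n, 1 / (n : ℝ)) +
      4096 * (2 * ∑ a ∈ Ioc 0 ⌊exp (w + 1)⌋₊, ∑ b ∈ win (w - log a) θ, smallPair y a b) := by ring
    _ ≤ 4096 * (2 * θ) + 4096 * (2 * (θ * (2 * F * ℓ + 2))) := by gcongr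
    _ = _ := by ring

end Setup
end PrimeGap

namespace PrimeGap
open Real Finset
open scoped ArithmeticFunction.Moebius ArithmeticFunction.vonMangoldt

lemma mert_nonneg (v : ℝ) : 0 ≤ mert v := sum_nonneg fun n _ => vonMangoldt_div_nonneg n

lemma sum_win_eq_sub (v : ℝ) {θ : ℝ} (hθ : 0 ≤ θ) (f : ℕ → ℝ) : ∑ n ∈ win v θ, f n =
    ∑ n ∈ Ioc 0 ⌊exp (v + θ)⌋₊, f n - ∑ n ∈ Ioc 0 ⌊exp v⌋₊, f n := by
  have h : ⌊exp v⌋₊ ≤ ⌊exp (v + θ)⌋₊ := Nat.floor_mono (exp_le_exp.2 (by linarith))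
  rw [eq_sub_iff_add_eq, add_comm, win,
    ← sum_union (disjoint_left.2 fun x hx hx' => by simp only [mem_Ioc] at hx hx'; omega)]
  refine sum_congr ?_ fun _ _ => rfl
  ext x; simp only [mem_union, mem_Ioc]; omega

lemma sum_range_sum_win (v : ℝ) (J : ℕ) (f : ℕ → ℝ) :
    ∑ j ∈ range J, ∑ n ∈ win (v + j) 1, f n = ∑ n ∈ win v J, f n := by
  simp_rw [sum_win_eq_sub _ zero_le_one]
  rw [sum_win_eq_sub _ (Nat.cast_nonneg J)]
  have := sum_range_sub (fun j : ℕ => ∑ n ∈ Ioc 0 ⌊exp (v + j)⌋₊, f n) J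
  simp only [Nat.cast_add, Nat.cast_one, Nat.cast_zero, add_zero, ← add_assoc] at this
  exact this

lemma sum_win_mert_close {v J : ℝ} (hv : 0 ≤ v) (hJ : 0 ≤ J) :
    |∑ n ∈ win v J, Λ n / n - J| ≤ 12 := by
  rw [sum_win_vonMangoldt v hJ]
  have h1 := abs_le.1 (abs_mert_sub_le (v := v + J) (by linarith))
  have h2 := abs_le.1 (abs_mert_sub_le hv)
  rw [abs_le]; constructor <;> linarith

lemma sum_win_convolution_close {v J : ℝ} (hv : 0 ≤ v) (hJ : 0 ≤ J) :
    |∑ n ∈ win v J, (Λ * Λ) n / n - J * v| ≤ 2 * J ^ 2 + 30 * J + 12 * v + 72 := by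
  rw [sum_win_vonMangoldt_mul_vonMangoldt (V := v + J) le_rfl]
  have h1 := abs_le.1 (abs_mert_sub_le (v := v + J) (by linarith))
  have h2 := abs_le.1 (abs_mert_sub_le hv)
  have key : |∑ a ∈ Ioc 0 ⌊exp (v + J)⌋₊, Λ a / a * ∑ b ∈ win (v - log a) J, Λ b / b
      - J * mert (v + J)| ≤ 12 * mert (v + J) + J * (mert (v + J) - mert v) := by
    rw [← sum_win_vonMangoldt v hJ, mert, mul_sum, ← sum_sub_distrib]
    refine (abs_sum_le_sum_abs _ _).trans ?_
    have hpt : ∀ a ∈ Ioc 0 ⌊exp (v + J)⌋₊,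
        |Λ a / a * ∑ b ∈ win (v - log a) J, Λ b / b - J * (Λ a / a)| ≤
        12 * (Λ a / a) + J * (if v < log a then Λ a / a else 0) := by
      intro a ha
      obtain ⟨ha0, ha1⟩ := mem_Ioc_exp.1 ha
      have hL := vonMangoldt_div_nonneg a
      rw [mul_comm J, ← mul_sub, abs_mul, abs_of_nonneg hL]
      split_ifs with hc
      · have : |∑ b ∈ win (v - log a) J, Λ b / b - J| ≤ 12 + J := by
          rw [sum_win_vonMangoldt _ hJ]
          have h3 := abs_le.1 (abs_mert_sub_le (v := v - log a + J) (by linarith))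
          have h4 := mert_nonneg (v - log a)
          have h5 : mert (v - log a) ≤ mert 0 := mert_mono (by linarith)
          have h6 := abs_le.1 (abs_mert_sub_le (v := 0) le_rfl)
          rw [abs_le]; constructor <;> linarith
        calc _ ≤ Λ a / a * (12 + J) := by gcongr
          _ = _ := by ring
      · have := sum_win_mert_close (v := v - log a) (by linarith) hJ
        calc _ ≤ Λ a / a * 12 := by gcongr
          _ = _ := by ring
    refine (sum_le_sum hpt).trans (le_of_eq ?_)
    rw [sum_add_distrib, ← mul_sum, ← mul_sum, ← sum_filter]
    congr 2
    refine sum_congr ?_ fun _ _ => rfl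
    ext a
    simp only [mem_filter, mem_Ioc_exp, mem_win]
    tauto
  have k := abs_le.1 key
  have h3 : J * mert (v + J) ≤ J * (v + J + 6) := by gcongr; linarith
  have h4 : J * (v + J - 6) ≤ J * mert (v + J) := by gcongr; linarith
  have h5 : J * (v - 6) ≤ J * mert v := by gcongr; linarith
  have h6 : 0 ≤ J * J := mul_nonneg hJ hJ
  rw [abs_le]
  constructor <;> linarith

namespace Setup
variable {y : ℕ} {ℓ v F : ℝ} {lam : ℕ → ℝ} {w θ : ℝ}

lemma window_close_mainM (h : Setup y ℓ v F) (hl : IsSieveWeight y (y ^ 121) lam)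
    (hQ : ∑ m ∈ Icc 1 ((y ^ 121) ^ 12), gW lam (y ^ 121) m / m ≤ 4 * 10 ^ 6 / ℓ)
    (hw : v ≤ w) (hw' : w ≤ v + ℓ) (h0 : exp (-(2 * ℓ)) ≤ θ) (h1 : θ ≤ 1) :
    |∑ n ∈ win w θ, ((2 * w - log n) * Λ n + (Λ * Λ) n) / n -
      θ * mainM lam (y ^ 121) (v - 9 * ℓ) 2 v| ≤ θ * (10 ^ 9 * ℓ * (F + 1)) := by
  have hℓ := h.log_ge
  have hF := h.F_nonneg
  have hθ : 0 < θ := (exp_pos _).trans_le h0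
  have A := h.sieved_moebius hl hQ hw hw' h0 h1 2 le_rfl
  have B := h.mainM_two_close hl hQ hw hw'
  have C := h.unsieve hl hw hw' h0 h1
  have e : (10 * ℓ) ^ 2 * (4 * 10 ^ 6 / ℓ) = 4 * 10 ^ 8 * ℓ := by
    have : ℓ ≠ 0 := by linarith
    field_simp
  rw [e] at A
  have B' : |θ * mainM lam (y ^ 121) (v - 9 * ℓ) 2 w - θ * mainM lam (y ^ 121) (v - 9 * ℓ) 2 v| ≤
      θ * (ℓ * (8192 * F + 2 * 10 ^ 8)) := by
    rw [← mul_sub, abs_mul, abs_of_pos hθ]; gcongr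
  have D : θ * (8 + 4 * 10 ^ 8 * ℓ) + θ * (ℓ * (8192 * F + 2 * 10 ^ 8)) +
      θ * (4096 * (4 * F * ℓ + 6)) ≤ θ * (10 ^ 9 * ℓ * (F + 1)) := by
    rw [← mul_add, ← mul_add]
    gcongr
    nlinarith [mul_nonneg (by linarith : 0 ≤ ℓ) hF]
  have A' := abs_le.1 A
  have B'' := abs_le.1 B'
  have C' := abs_le.1 C
  rw [abs_le]
  constructor <;> linarith

lemma mainM_two_asymp (h : Setup y ℓ v F) (hl : IsSieveWeight y (y ^ 121) lam)
    (hQ : ∑ m ∈ Icc 1 ((y ^ 121) ^ 12), gW lam (y ^ 121) m / m ≤ 4 * 10 ^ 6 / ℓ) :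
    |mainM lam (y ^ 121) (v - 9 * ℓ) 2 v - 2 * v| ≤ 2 * 10 ^ 9 * ℓ * (F + 1) + 48 * v / ℓ := by
  have hℓ := h.log_ge
  have hv := h.le_v
  have hF := h.F_nonneg
  set M := mainM lam (y ^ 121) (v - 9 * ℓ) 2 v with hM
  set J := ⌊ℓ⌋₊ with hJ
  have hJ1 : (J : ℝ) ≤ ℓ := Nat.floor_le (by linarith)
  have hJ2 : ℓ - 1 < J := Nat.sub_one_lt_floor ℓ
  have A : ∀ j ∈ range J, |∑ n ∈ win (v + j) 1, ((2 * (v + j) - log n) * Λ n + (Λ * Λ) n) / n - M| ≤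
      10 ^ 9 * ℓ * (F + 1) := by
    intro j hj
    have hjJ : (j : ℝ) ≤ J := by exact_mod_cast (mem_range.1 hj).le
    have := h.window_close_mainM hl hQ (w := v + j) (θ := 1)
      (by have : (0 : ℝ) ≤ j := Nat.cast_nonneg j
          linarith) (by linarith)
      (exp_le_one_iff.2 (by linarith)) le_rfl
    simpa using this
  have B : ∀ j ∈ range J, |∑ n ∈ win (v + j) 1, ((2 * (v + j) - log n) * Λ n + (Λ * Λ) n) / n -
      ∑ n ∈ win (v + j) 1, (v * (Λ n / n) + (Λ * Λ) n / n)| ≤ J * ∑ n ∈ win (v + j) 1, Λ n / n := by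
    intro j hj
    have hjJ : (j : ℝ) + 1 ≤ J := by exact_mod_cast (mem_range.1 hj)
    have hj0 : (0 : ℝ) ≤ j := Nat.cast_nonneg j
    rw [← sum_sub_distrib, mul_sum]
    refine (abs_sum_le_sum_abs _ _).trans (sum_le_sum fun n hn => ?_)
    obtain ⟨hn0, hn1, hn2⟩ := mem_win.1 hn
    have e : ((2 * (v + j) - log n) * Λ n + (Λ * Λ) n) / n - (v * (Λ n / n) + (Λ * Λ) n / n) =
      (v + 2 * j - log n) * (Λ n / n) := by ring
    rw [e, abs_mul, abs_of_nonneg (vonMangoldt_div_nonneg n)]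
    gcongr
    rw [abs_le]; constructor <;> linarith
  have A' := (abs_sum_le_sum_abs _ _).trans (sum_le_sum A)
  have B' := (abs_sum_le_sum_abs _ _).trans (sum_le_sum B)
  rw [sum_sub_distrib, sum_const, sum_const, card_range, nsmul_eq_mul, nsmul_eq_mul] at A'
  rw [sum_sub_distrib, sum_range_sum_win v J, ← mul_sum, sum_range_sum_win v J, sum_add_distrib,
    ← mul_sum] at B'
  have C := abs_le.1 (sum_win_mert_close (v := v) (J := J) (by linarith) (Nat.cast_nonneg J))
  have D := abs_le.1 (sum_win_convolution_close (v := v) (J := J) (by linarith) (Nat.cast_nonneg J))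
  have A2 := abs_le.1 A'
  have B2 := abs_le.1 B'
  have hJ0 : (0 : ℝ) < J := by linarith
  have hvC1 : v * (∑ n ∈ win v J, Λ n / n) ≤ v * (J + 12) := by gcongr <;> linarith
  have hvC2 : v * (J - 12) ≤ v * (∑ n ∈ win v J, Λ n / n) := by gcongr <;> linarith
  have hJC : J * (∑ n ∈ win v J, Λ n / n) ≤ J * (J + 12) := by gcongr; linarith
  have E : |J * M - J * (2 * v)| ≤ J * (10 ^ 9 * ℓ * (F + 1)) + (24 * v + 3 * J ^ 2 + 42 * J + 72) := by
    rw [abs_le]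
    constructor <;> linarith
  rw [← mul_sub, abs_mul, abs_of_pos hJ0] at E
  clear hvC1 hvC2 hJC A2 B2 C D A B A' B'
  have G : 24 * v + 3 * (J : ℝ) ^ 2 + 42 * J + 72 ≤ J * (48 * v / ℓ + 3 * ℓ + 44) := by
    have h1 : 24 * v ≤ J * (48 * v / ℓ) := by
      have : J * (48 * v / ℓ) = (48 * J / ℓ) * v := by ring
      rw [this]
      gcongr
      · linarith
      · rw [le_div_iff₀ (by linarith)]; linarith
    nlinarith
  have H : J * |M - 2 * v| ≤ J * (10 ^ 9 * ℓ * (F + 1) + (48 * v / ℓ + 3 * ℓ + 44)) := by linarith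
  have H2 := le_of_mul_le_mul_left H hJ0
  nlinarith [mul_nonneg (by linarith : 0 ≤ ℓ) hF]

/-- Selberg's formula in a short window. -/
lemma selberg (h : Setup y ℓ v F) (h0 : exp (-(2 * ℓ)) ≤ θ) (h1 : θ ≤ 1) :
    |v * ∑ n ∈ win v θ, Λ n / n + ∑ n ∈ win v θ, (Λ * Λ) n / n - 2 * v * θ| ≤
      θ * (4 * 10 ^ 9 * ℓ * (F + 1) + 48 * v / ℓ) := by
  obtain ⟨lam, hl, hQ⟩ := exists_sieveWeight y h.two_le
  rw [← h.eq_log] at hQ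
  have hℓ := h.log_ge
  have hv := h.le_v
  have hF := h.F_nonneg
  have hθ : 0 < θ := (exp_pos _).trans_le h0
  have A := abs_le.1 (h.window_close_mainM hl hQ le_rfl (by linarith) h0 h1)
  have B := abs_le.1 (h.mainM_two_asymp hl hQ)
  have C : |∑ n ∈ win v θ, ((2 * v - log n) * Λ n + (Λ * Λ) n) / n -
      (v * ∑ n ∈ win v θ, Λ n / n + ∑ n ∈ win v θ, (Λ * Λ) n / n)| ≤ θ * F := by
    rw [mul_sum, ← sum_add_distrib, ← sum_sub_distrib]
    have hf := h.fW_le v θ (by linarith) (by linarith) h0 h1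
    calc _ ≤ ∑ n ∈ win v θ, 1 * (Λ n / n) := by
          refine (abs_sum_le_sum_abs _ _).trans (sum_le_sum fun n hn => ?_)
          obtain ⟨hn0, hn1, hn2⟩ := mem_win.1 hn
          have e : ((2 * v - log n) * Λ n + (Λ * Λ) n) / n - (v * (Λ n / n) + (Λ * Λ) n / n) =
            (v - log n) * (Λ n / n) := by ring
          rw [e, abs_mul, abs_of_nonneg (vonMangoldt_div_nonneg n)]
          gcongr
          rw [abs_le]; constructor <;> linarith
      _ = θ * fW θ v := by rw [← mul_sum, sum_eq_fW hθ, one_mul]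
      _ ≤ _ := by gcongr
  have C' := abs_le.1 C
  have hℓF := mul_nonneg (by linarith : 0 ≤ ℓ) hF
  have D : θ * F ≤ θ * (10 ^ 9 * ℓ * (F + 1)) := by
    gcongr; nlinarith
  have E1 : θ * mainM lam (y ^ 121) (v - 9 * ℓ) 2 v ≤
      θ * (2 * v + (2 * 10 ^ 9 * ℓ * (F + 1) + 48 * v / ℓ)) := by gcongr; linarith
  have E2 : θ * (2 * v - (2 * 10 ^ 9 * ℓ * (F + 1) + 48 * v / ℓ)) ≤
      θ * mainM lam (y ^ 121) (v - 9 * ℓ) 2 v := by gcongr; linarith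
  rw [abs_le]
  constructor <;> linarith

end Setup
end PrimeGap

namespace PrimeGap
open Real Finset Filter
open scoped ArithmeticFunction.Moebius ArithmeticFunction.vonMangoldt

lemma exists_log_pow_near {a : ℝ} (ha : 0 < a) : ∃ L₀ : ℝ, ∀ L ≥ L₀, ∃ y : ℕ, 2 ≤ y ∧
    a * L / 2 ≤ log ((y : ℝ) ^ 121) ∧ log ((y : ℝ) ^ 121) ≤ a * L := by
  refine ⟨121 * 2 / a, fun L hL => ?_⟩
  have hz : 2 ≤ a * L / 121 := by
    rw [ge_iff_le, div_le_iff₀ ha] at hL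
    linarith
  set z := a * L / 121 with hzd
  have hE : exp (z / 2) * exp (z / 2) = exp z := by rw [← exp_add]; ring_nf
  have h1 : z / 2 + 1 ≤ exp (z / 2) := add_one_le_exp _
  have hfl : exp z < ⌊exp z⌋₊ + 1 := Nat.lt_floor_add_one _
  have hle : exp (z / 2) ≤ ⌊exp z⌋₊ := by nlinarith
  have h2 : (2 : ℝ) ≤ ⌊exp z⌋₊ := by linarith
  refine ⟨⌊exp z⌋₊, by exact_mod_cast h2, ?_, ?_⟩
  · have := (le_log_iff_exp_le (by linarith)).2 hle
    rw [log_pow]; push_cast; linarith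
  · have : log (⌊exp z⌋₊ : ℝ) ≤ z :=
      (log_le_iff_le_exp (by linarith)).2 (Nat.floor_le (exp_pos _).le)
    rw [log_pow]; push_cast; linarith

lemma exists_pow_le_exp {a : ℝ} (ha : 0 < a) : ∃ L₀ : ℝ, ∀ L ≥ L₀, (4 * L) ^ 4 ≤ exp (a * L) := by
  have h := (isLittleO_pow_exp_pos_mul_atTop 4 ha).bound (by norm_num : (0 : ℝ) < 1 / 256)
  obtain ⟨L₀, hL⟩ := eventually_atTop.1 h
  refine ⟨max L₀ 0, fun L hL' => ?_⟩
  have := hL L ((le_max_left _ _).trans hL')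
  rw [norm_of_nonneg (pow_nonneg ((le_max_right _ _).trans hL') 4), norm_of_nonneg (exp_pos _).le]
    at this
  calc (4 * L) ^ 4 = 256 * L ^ 4 := by ring
    _ ≤ _ := by linarith

/-- Selberg's formula in windows as short as `e ^ (-δ L)`. -/
theorem exists_selberg {c ε₁ : ℝ} (hc : 0 < c) (hc1 : c < 1) (hε₁ : 0 < ε₁) :
    ∃ δ : ℝ, 0 < δ ∧ ∃ L₀ : ℝ, ∀ L ≥ L₀, ∀ v θ : ℝ, c * L ≤ v → v ≤ 2 * L →
      exp (-(δ * L)) ≤ θ → θ ≤ 1 →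
      |v * ∑ n ∈ win v θ, Λ n / n + ∑ n ∈ win v θ, (Λ * Λ) n / n - 2 * v * θ| ≤ θ * (ε₁ * L) := by
  set B : ℝ := 8 * 10 ^ 9 * (8 * 10 ^ 8 / c + 1) with hB
  have hBpos : 0 < B := by positivity
  set ε : ℝ := min (c / 60) (ε₁ / B) with hε
  have hεpos : 0 < ε := lt_min (by positivity) (by positivity)
  have hεc : ε ≤ c / 60 := min_le_left _ _
  have hεB : ε * B ≤ ε₁ := by
    rw [← le_div_iff₀ hBpos]; exact min_le_right _ _
  obtain ⟨L₁, h₁⟩ := exists_log_pow_near hεpos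
  obtain ⟨L₂, h₂⟩ := exists_log_pow_near (a := c / 20) (by positivity)
  obtain ⟨L₃, h₃⟩ := exists_pow_le_exp (a := ε / 2) (by positivity)
  refine ⟨ε, hεpos, max (max L₁ L₂) (max (max L₃ 10) (384 / (ε * ε₁))), ?_⟩
  intro L hL v θ hv hv2 hθ hθ1
  simp only [ge_iff_le, max_le_iff] at hL
  obtain ⟨⟨hL1, hL2⟩, ⟨hL3, hL10⟩, hL4⟩ := hL
  obtain ⟨y, hy2, hy3, hy4⟩ := h₁ L hL1
  obtain ⟨y', hy2', hy3', hy4'⟩ := h₂ L hL2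
  have hp := h₃ L hL3
  set ℓ := log ((y : ℝ) ^ 121) with hℓ
  set ℓ' := log ((y' : ℝ) ^ 121) with hℓ'
  have hcL : 0 < c * L := by positivity
  have hεcL : ε * L ≤ c * L / 60 := by
    have := mul_le_mul_of_nonneg_right hεc (by linarith : 0 ≤ L)
    linarith
  have hℓpos : 0 < ℓ := by
    have : 0 < ε * L := by positivity
    linarith
  have hcL1 : c * L ≤ L := by nlinarith
  have hs : Setup y ℓ v (8 * 10 ^ 8 / c) := by
    refine ⟨hy2, hℓ, by linarith, ?_, ?_⟩
    · calc (v + ℓ + 10) ^ 4 ≤ (4 * L) ^ 4 := by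
            apply pow_le_pow_left₀ (by linarith); linarith
        _ ≤ exp (ε / 2 * L) := hp
        _ ≤ _ := exp_le_exp.2 (by linarith)
    · intro u ϑ hu hu' hϑ hϑ1
      have hL' : 4 * L ≤ exp (ε / 2 * L) := by
        refine le_trans ?_ hp
        calc 4 * L = (4 * L) ^ 1 := (pow_one _).symm
          _ ≤ _ := pow_le_pow_right₀ (by linarith) (by norm_num)
      have h5 : exp (ε / 2 * L) ≤ exp ℓ' := exp_le_exp.2 (by linarith)
      refine (fW_le hy2' hℓ' (by linarith) (by linarith)
        (le_trans (exp_le_exp.2 (by linarith)) hϑ) hϑ1).trans ?_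
      rw [div_le_div_iff₀ (by linarith) hc]
      have h6 : u + 1 ≤ 4 * L := by linarith
      calc 5 * 10 ^ 6 * (u + 1) * c ≤ 5 * 10 ^ 6 * (4 * L) * c := by gcongr
        _ ≤ 8 * 10 ^ 8 * ℓ' := by linarith
  refine (hs.selberg (le_trans (exp_le_exp.2 (by linarith)) hθ) hθ1).trans ?_
  have hθ0 : 0 < θ := (exp_pos _).trans_le hθ
  gcongr
  have h7 : 4 * 10 ^ 9 * ℓ * (8 * 10 ^ 8 / c + 1) ≤ ε₁ * L / 2 := by
    calc 4 * 10 ^ 9 * ℓ * (8 * 10 ^ 8 / c + 1) = ℓ * B / 2 := by rw [hB]; ring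
      _ ≤ ε * L * B / 2 := by gcongr
      _ = ε * B * L / 2 := by ring
      _ ≤ _ := by gcongr
  have h8 : 48 * v / ℓ ≤ ε₁ * L / 2 := by
    rw [div_le_iff₀ hℓpos]
    rw [div_le_iff₀ (by positivity)] at hL4
    calc 48 * v ≤ 96 * L := by linarith
      _ ≤ L * (L * (ε * ε₁)) / 4 := by
          have := mul_le_mul_of_nonneg_left hL4 (by linarith : 0 ≤ L)
          linarith
      _ = ε₁ * L / 2 * (ε * L / 2) := by ring
      _ ≤ _ := by gcongr
  linarith

end PrimeGap

namespace PrimeGap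
open Real Finset MeasureTheory intervalIntegral
open scoped ArithmeticFunction.Moebius ArithmeticFunction.vonMangoldt

/-- Measurable functions that are bounded on bounded sets. -/
def LocBdd (g : ℝ → ℝ) : Prop := Measurable g ∧ ∀ A : ℝ, ∃ C : ℝ, ∀ x, |x| ≤ A → |g x| ≤ C

namespace LocBdd
variable {f g : ℝ → ℝ}

lemma const (a : ℝ) : LocBdd fun _ => a := ⟨measurable_const, fun _ => ⟨|a|, fun _ _ => le_rfl⟩⟩

lemma add (hf : LocBdd f) (hg : LocBdd g) : LocBdd fun x => f x + g x := by
  refine ⟨hf.1.add hg.1, fun A => ?_⟩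
  obtain ⟨C, hC⟩ := hf.2 A
  obtain ⟨D, hD⟩ := hg.2 A
  exact ⟨C + D, fun x hx => (abs_add_le _ _).trans (add_le_add (hC x hx) (hD x hx))⟩

lemma mul (hf : LocBdd f) (hg : LocBdd g) : LocBdd fun x => f x * g x := by
  refine ⟨hf.1.mul hg.1, fun A => ?_⟩
  obtain ⟨C, hC⟩ := hf.2 A
  obtain ⟨D, hD⟩ := hg.2 A
  refine ⟨C * D, fun x hx => ?_⟩
  rw [abs_mul]
  exact mul_le_mul (hC x hx) (hD x hx) (abs_nonneg _) ((abs_nonneg _).trans (hC x hx))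

lemma sub (hf : LocBdd f) (hg : LocBdd g) : LocBdd fun x => f x - g x := by
  have := hf.add ((const (-1)).mul hg)
  simpa [sub_eq_add_neg] using this

lemma sq (hf : LocBdd f) : LocBdd fun x => f x ^ 2 := by
  simpa [pow_two] using hf.mul hf

lemma sum {ι : Type*} (s : Finset ι) {F : ι → ℝ → ℝ} (h : ∀ i, LocBdd (F i)) :
    LocBdd fun x => ∑ i ∈ s, F i x := by
  induction s using Finset.induction_on with
  | empty => simpa using const 0
  | insert a s ha ih => simpa [sum_insert ha] using (h a).add ih

lemma comp_affine (hf : LocBdd f) (k b : ℝ) : LocBdd fun x => f (k * x + b) := by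
  refine ⟨hf.1.comp (by fun_prop), fun A => ?_⟩
  obtain ⟨C, hC⟩ := hf.2 (|k| * A + |b|)
  refine ⟨C, fun x hx => hC _ ((abs_add_le _ _).trans ?_)⟩
  rw [abs_mul]
  gcongr

lemma of_monotone (hf : Monotone f) : LocBdd f := by
  refine ⟨hf.measurable, fun A => ⟨max |f (-A)| |f A|, fun x hx => ?_⟩⟩
  rw [abs_le] at hx
  exact abs_le_max_abs_abs (hf hx.1) (hf hx.2)

lemma comp_add (hf : LocBdd f) (b : ℝ) : LocBdd fun x => f (x + b) := by
  simpa using hf.comp_affine 1 b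

lemma comp_sub (hf : LocBdd f) (b : ℝ) : LocBdd fun x => f (x - b) := by
  simpa [sub_eq_add_neg] using hf.comp_affine 1 (-b)

lemma comp_sub_mul (hf : LocBdd f) (k b : ℝ) : LocBdd fun x => f (b - k * x) := by
  simpa [sub_eq_add_neg, add_comm] using hf.comp_affine (-k) b

lemma comp_sub_left (hf : LocBdd f) (b : ℝ) : LocBdd fun x => f (b - x) := by
  simpa using hf.comp_sub_mul 1 b

lemma intervalIntegrable (hf : LocBdd f) (a b : ℝ) : IntervalIntegrable f volume a b := by
  obtain ⟨C, hC⟩ := hf.2 (max |a| |b|)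
  rw [intervalIntegrable_iff]
  refine Measure.integrableOn_of_bounded (M := C) (by simp) hf.1.aestronglyMeasurable ?_
  refine (ae_restrict_iff' measurableSet_uIoc).2 (Filter.Eventually.of_forall fun x hx => ?_)
  have hx' := Set.uIoc_subset_uIcc hx
  rw [Set.mem_uIcc] at hx'
  apply hC
  rcases hx' with h | h
  · exact abs_le_max_abs_abs h.1 h.2
  · rw [max_comm]; exact abs_le_max_abs_abs h.1 h.2

lemma integral_mono (hf : LocBdd f) (hg : LocBdd g) {a b : ℝ} (hab : a ≤ b)
    (h : ∀ x ∈ Set.Icc a b, f x ≤ g x) : ∫ x in a..b, f x ≤ ∫ x in a..b, g x :=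
  integral_mono_on hab (hf.intervalIntegrable a b) (hg.intervalIntegrable a b) h

lemma integral_add_eq (hf : LocBdd f) (hg : LocBdd g) (a b : ℝ) :
    ∫ x in a..b, (f x + g x) = (∫ x in a..b, f x) + ∫ x in a..b, g x :=
  intervalIntegral.integral_add (hf.intervalIntegrable a b) (hg.intervalIntegrable a b)

lemma integral_sub_eq (hf : LocBdd f) (hg : LocBdd g) (a b : ℝ) :
    ∫ x in a..b, (f x - g x) = (∫ x in a..b, f x) - ∫ x in a..b, g x :=
  intervalIntegral.integral_sub (hf.intervalIntegrable a b) (hg.intervalIntegrable a b)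

/-- Enlarging the interval of integration of a nonnegative function. -/
lemma integral_mono_interval (hf : LocBdd f) {a b c d : ℝ} (hca : c ≤ a) (hab : a ≤ b) (hbd : b ≤ d)
    (h : ∀ x ∈ Set.Icc c d, 0 ≤ f x) : ∫ x in a..b, f x ≤ ∫ x in c..d, f x := by
  have h1 := integral_add_adjacent_intervals (hf.intervalIntegrable c a) (hf.intervalIntegrable a b)
  have h2 := integral_add_adjacent_intervals (hf.intervalIntegrable c b) (hf.intervalIntegrable b d)
  have h3 : 0 ≤ ∫ x in c..a, f x := integral_nonneg hca fun x hx =>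
    h x ⟨hx.1, hx.2.trans (hab.trans hbd)⟩
  have h4 : 0 ≤ ∫ x in b..d, f x := integral_nonneg hbd fun x hx =>
    h x ⟨hca.trans (hab.trans hx.1), hx.2⟩
  linarith

lemma integral_sum_eq {ι : Type*} (s : Finset ι) (w : ι → ℝ) {F : ι → ℝ → ℝ}
    (h : ∀ i, LocBdd (F i)) (a b : ℝ) :
    ∫ x in a..b, ∑ i ∈ s, w i * F i x = ∑ i ∈ s, w i * ∫ x in a..b, F i x := by
  rw [intervalIntegral.integral_finsetSum fun i _ => ((const (w i)).mul (h i)).intervalIntegrable a b]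
  exact sum_congr rfl fun i _ => intervalIntegral.integral_const_mul _ _

end LocBdd

section monotone
variable {K : ℝ → ℝ}

lemma integral_shift_sub (hK : Monotone K) (α β τ : ℝ) : ∫ u in α..β, (K (u + τ) - K u) =
    (∫ u in β..β + τ, K u) - ∫ u in α..α + τ, K u := by
  have h := LocBdd.of_monotone hK
  rw [(h.comp_add τ).integral_sub_eq h, intervalIntegral.integral_comp_add_right]
  rw [integral_interval_sub_interval_comm' (h.intervalIntegrable _ _) (h.intervalIntegrable _ _)
    (h.intervalIntegrable _ _)]

lemma integral_shift_sub_le (hK : Monotone K) (α β : ℝ) {τ : ℝ} (hτ : 0 ≤ τ) :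
    ∫ u in α..β, (K (u + τ) - K u) ≤ τ * (K (β + τ) - K α) := by
  have h := LocBdd.of_monotone hK
  rw [integral_shift_sub hK]
  have h1 := h.integral_mono (LocBdd.const (K (β + τ))) (show β ≤ β + τ by linarith)
    fun x hx => hK hx.2
  have h2 := (LocBdd.const (K α)).integral_mono h (show α ≤ α + τ by linarith)
    fun x hx => hK hx.1
  simp only [intervalIntegral.integral_const, smul_eq_mul, add_sub_cancel_left] at h1 h2
  linarith

lemma le_integral_shift_sub (hK : Monotone K) (α β : ℝ) {τ : ℝ} (hτ : 0 ≤ τ) :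
    τ * (K β - K (α + τ)) ≤ ∫ u in α..β, (K (u + τ) - K u) := by
  have h := LocBdd.of_monotone hK
  rw [integral_shift_sub hK]
  have h1 := (LocBdd.const (K β)).integral_mono h (show β ≤ β + τ by linarith)
    fun x hx => hK hx.1
  have h2 := h.integral_mono (LocBdd.const (K (α + τ))) (show α ≤ α + τ by linarith)
    fun x hx => hK hx.2
  simp only [intervalIntegral.integral_const, smul_eq_mul, add_sub_cancel_left] at h1 h2
  linarith

end monotone

lemma monotone_sum_Ioc_exp {k : ℕ → ℝ} (hk : ∀ n, 0 ≤ k n) :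
    Monotone fun u : ℝ => ∑ n ∈ Ioc 0 ⌊exp u⌋₊, k n := fun _ _ h =>
  sum_le_sum_of_subset_of_nonneg (Ioc_subset_Ioc_right (Nat.floor_le_floor (exp_le_exp.2 h)))
    fun n _ _ => hk n

lemma locBdd_sum_win {h : ℕ → ℝ} (hh : ∀ n, 0 ≤ h n) {τ : ℝ} (hτ : 0 ≤ τ) :
    LocBdd fun u => ∑ n ∈ win u τ, h n := by
  have := LocBdd.of_monotone (monotone_sum_Ioc_exp hh)
  simpa only [sum_win_eq_sub _ hτ] using (this.comp_add τ).sub this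

lemma integral_sum_win_mul_le {h : ℕ → ℝ} (hh : ∀ n, 0 ≤ h n) {G : ℝ → ℝ} (hG : LocBdd G)
    {α β τ ω : ℝ} (hτ : 0 ≤ τ) (hω : 0 ≤ ω) (hαβ : α ≤ β)
    (hG0 : ∀ u ∈ Set.Icc α (β + τ), 0 ≤ G u)
    (hGl : ∀ u ∈ Set.Icc α β, ∀ x ∈ Set.Icc u (u + τ), G u ≤ G x + ω) :
    ∫ u in α..β, (∑ n ∈ win u τ, h n) * G u ≤
      τ * ∑ n ∈ win α (β + τ - α), h n * (G (log n) + ω) := by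
  set k : ℕ → ℝ := fun n => if n ∈ win α (β + τ - α) then h n * (G (log n) + ω) else 0 with hk
  have hk0 : ∀ n, 0 ≤ k n := by
    intro n
    simp only [hk]
    split_ifs with hn
    · rw [mem_win] at hn
      have := hG0 (log n) ⟨hn.2.1.le, by linarith [hn.2.2]⟩
      have := hh n
      positivity
    · exact le_rfl
  have hmono := monotone_sum_Ioc_exp hk0
  calc _ ≤ ∫ u in α..β, ∑ n ∈ win u τ, k n := by
        refine ((locBdd_sum_win hh hτ).mul hG).integral_mono (locBdd_sum_win hk0 hτ) hαβ ?_
        intro u hu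
        rw [sum_mul]
        refine sum_le_sum fun n hn => ?_
        rw [mem_win] at hn
        have hmem : n ∈ win α (β + τ - α) := mem_win.2 ⟨hn.1, by linarith [hu.1, hn.2.1],
          by linarith [hu.2, hn.2.2]⟩
        simp only [hk, if_pos hmem]
        exact mul_le_mul_of_nonneg_left (hGl u hu _ ⟨hn.2.1.le, hn.2.2⟩) (hh n)
    _ ≤ τ * ∑ n ∈ win α (β + τ - α), k n := by
        have := integral_shift_sub_le hmono α β hτ
        rw [sum_win_eq_sub α (by linarith)]
        simp only [sum_win_eq_sub _ hτ]
        rwa [show α + (β + τ - α) = β + τ by ring]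
    _ = _ := by
        congr 1
        exact sum_congr rfl fun n hn => by simp only [hk, if_pos hn]

/-- The normalised error term for prime powers in windows of length `θ`. -/
noncomputable def rW (θ v : ℝ) : ℝ := fW θ v - 1

lemma fW_eq {θ : ℝ} (hθ : 0 ≤ θ) (v : ℝ) : fW θ v = (mert (v + θ) - mert v) / θ := by
  rw [fW, sum_win_vonMangoldt v hθ]

lemma locBdd_rW {θ : ℝ} (hθ : 0 ≤ θ) : LocBdd (rW θ) := by
  have h := LocBdd.of_monotone mert_mono
  have h2 := (((h.comp_add θ).sub h).mul (LocBdd.const θ⁻¹)).sub (LocBdd.const 1)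
  have e : rW θ = fun v => (mert (v + θ) - mert v) * θ⁻¹ - 1 := by
    funext v; rw [rW, fW_eq hθ, div_eq_mul_inv]
  rwa [e]

lemma abs_integral_rW_le {θ α β : ℝ} (h0 : 0 < θ) (h1 : θ ≤ 1) (hα : 0 ≤ α) (hβ : α ≤ β) :
    |∫ u in α..β, rW θ u| ≤ 13 := by
  have h := LocBdd.of_monotone mert_mono
  have e : ∫ u in α..β, rW θ u = θ⁻¹ * (∫ u in α..β, (mert (u + θ) - mert u)) - (β - α) := by
    have : ∀ u, rW θ u = θ⁻¹ * (mert (u + θ) - mert u) - 1 := fun u => by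
      rw [rW, fW_eq h0.le, div_eq_inv_mul]
    simp only [this]
    rw [((LocBdd.const θ⁻¹).mul ((h.comp_add θ).sub h)).integral_sub_eq (LocBdd.const 1),
      intervalIntegral.integral_const_mul]
    simp
  have u1 := integral_shift_sub_le mert_mono α β h0.le
  have u2 := le_integral_shift_sub mert_mono α β h0.le
  have a1 := abs_le.1 (abs_mert_sub_le hα)
  have a2 := abs_le.1 (abs_mert_sub_le (hα.trans hβ))
  have a3 := abs_le.1 (abs_mert_sub_le (show 0 ≤ α + θ by linarith))
  have a4 := abs_le.1 (abs_mert_sub_le (show 0 ≤ β + θ by linarith))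
  have w1 : θ⁻¹ * (∫ u in α..β, (mert (u + θ) - mert u)) ≤ mert (β + θ) - mert α := by
    rw [inv_mul_le_iff₀ h0]; exact u1
  have w2 : mert β - mert (α + θ) ≤ θ⁻¹ * (∫ u in α..β, (mert (u + θ) - mert u)) := by
    rw [le_inv_mul_iff₀ h0]; exact u2
  rw [e, abs_le]
  constructor <;> linarith

end PrimeGap

namespace PrimeGap
open Real Finset MeasureTheory intervalIntegral
open scoped ArithmeticFunction.Moebius ArithmeticFunction.vonMangoldt

/-- Selberg's formula in windows of the two lengths `η` and `τ = η / 10 ^ 6` at scale `L`. -/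
structure Scale (L η τ : ℝ) : Prop where
  L_ge : 10 ^ 12 ≤ L
  η_pos : 0 < η
  η_le : η ≤ 1 / 10 ^ 6
  τ_eq : τ = η / 10 ^ 6
  selberg : ∀ v θ : ℝ, θ = η ∨ θ = τ → L / 10 ^ 6 ≤ v → v ≤ 2 * L →
    |v * ∑ n ∈ win v θ, Λ n / n + ∑ n ∈ win v θ, (Λ * Λ) n / n - 2 * v * θ| ≤ θ * (L / 10 ^ 12)

lemma vonMangoldt_mul_div_nonneg (n : ℕ) : 0 ≤ (Λ * Λ) n / n :=
  div_nonneg (vonMangoldt_mul_nonneg n) (Nat.cast_nonneg _)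

namespace Scale
variable {L η τ v θ : ℝ}

lemma τ_pos (h : Scale L η τ) : 0 < τ := by
  rw [h.τ_eq]; have := h.η_pos; positivity

lemma τ_le (h : Scale L η τ) : τ ≤ 1 / 10 ^ 6 := by
  rw [h.τ_eq]; have := h.η_pos; have := h.η_le; linarith

lemma fW_le (h : Scale L η τ) (hθ : θ = η ∨ θ = τ) (h1 : L / 10 ^ 6 ≤ v) (h2 : v ≤ 2 * L) :
    fW θ v ≤ 2 + 1 / 10 ^ 6 := by
  have hL := h.L_ge
  have hθ0 : 0 < θ := by rcases hθ with rfl | rfl; exacts [h.η_pos, h.τ_pos]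
  have hv : 0 < v := by linarith
  have hs := (abs_le.1 (h.selberg v θ hθ h1 h2)).2
  have hn : 0 ≤ ∑ n ∈ win v θ, (Λ * Λ) n / n := sum_nonneg fun n _ => vonMangoldt_mul_div_nonneg n
  rw [Setup.sum_eq_fW hθ0] at hs
  have h3 : (v * θ) * fW θ v ≤ (v * θ) * (2 + 1 / 10 ^ 6) := by nlinarith
  exact le_of_mul_le_mul_left h3 (by positivity)

lemma neg_one_le_rW (h : 0 ≤ θ) (v : ℝ) : -1 ≤ rW θ v := by
  have := fW_nonneg h v
  rw [rW]; linarith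

lemma rW_le (h : Scale L η τ) (hθ : θ = η ∨ θ = τ) (h1 : L / 10 ^ 6 ≤ v) (h2 : v ≤ 2 * L) :
    rW θ v ≤ 1 + 1 / 10 ^ 6 := by
  have := h.fW_le hθ h1 h2
  rw [rW]; linarith

lemma abs_rW_le (h : Scale L η τ) (h1 : L / 10 ^ 6 ≤ v) (h2 : v ≤ 2 * L) :
    |rW η v| ≤ 1 + 1 / 10 ^ 6 := by
  rw [abs_le]
  exact ⟨by linarith [neg_one_le_rW h.η_pos.le v], h.rW_le (Or.inl rfl) h1 h2⟩

lemma rW_sq_le (h : Scale L η τ) (hθ : θ = η ∨ θ = τ) (h1 : L / 10 ^ 6 ≤ v) (h2 : v ≤ 2 * L) :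
    rW θ v ^ 2 ≤ 1 + 3 / 10 ^ 6 := by
  have hθ0 : 0 ≤ θ := by rcases hθ with rfl | rfl; exacts [h.η_pos.le, h.τ_pos.le]
  have a := neg_one_le_rW hθ0 v
  have b := h.rW_le hθ h1 h2
  nlinarith

/-- Almost-Lipschitz property of the error term. -/
lemma abs_rW_sub_le (h : Scale L η τ) {x x' : ℝ} (h1 : L / 10 ^ 6 ≤ x) (h2 : x ≤ 2 * L - 1)
    (h3 : x ≤ x') (h4 : x' ≤ x + τ) : |rW η x' - rW η x| ≤ 3 / 10 ^ 6 := by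
  have key : ∀ y y', L / 10 ^ 6 ≤ y → y ≤ 2 * L → y ≤ y' → y' ≤ y + τ →
      0 ≤ mert y' - mert y ∧ mert y' - mert y ≤ η * (3 / 10 ^ 6) := by
    intro y y' a b c d
    refine ⟨by linarith [mert_mono c], ?_⟩
    have e := h.fW_le (Or.inr rfl) a b
    rw [fW_eq h.τ_pos.le, div_le_iff₀ h.τ_pos, h.τ_eq] at e
    have := mert_mono d
    rw [h.τ_eq] at this
    linarith [h.η_pos]
  have hη := h.η_pos
  have hη' := h.η_le
  obtain ⟨a1, a2⟩ := key x x' h1 (by linarith) h3 h4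
  obtain ⟨b1, b2⟩ := key (x + η) (x' + η) (by linarith) (by linarith) (by linarith) (by linarith)
  have e : rW η x' - rW η x = ((mert (x' + η) - mert (x + η)) - (mert x' - mert x)) / η := by
    rw [rW, rW, fW_eq hη.le, fW_eq hη.le]; ring
  rw [e, abs_div, abs_of_pos hη, div_le_iff₀ hη, abs_le]
  constructor <;> linarith

lemma abs_rW_sub_le_two (h : Scale L η τ) {x x' : ℝ} (h1 : L / 10 ^ 6 ≤ x) (h2 : x' ≤ 2 * L - 1)
    (h3 : x ≤ x') (h4 : x' ≤ x + 2 * τ) : |rW η x' - rW η x| ≤ 6 / 10 ^ 6 := by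
  have a := abs_le.1 (h.abs_rW_sub_le (x := x) (x' := (x + x') / 2) h1 (by linarith) (by linarith)
    (by linarith))
  have b := abs_le.1 (h.abs_rW_sub_le (x := (x + x') / 2) (x' := x') (by linarith) (by linarith)
    (by linarith) (by linarith))
  rw [abs_le]
  constructor <;> linarith [a.1, a.2, b.1, b.2]

lemma sum_vonMangoldt_mul_fW_le (h : Scale L η τ) {m : ℝ} (hm : 0 ≤ m) (h1 : L / 10 ^ 6 ≤ v - m)
    (h2 : v ≤ 2 * L) :
    ∑ a ∈ Ioc 0 ⌊exp m⌋₊, Λ a / a * fW η (v - log a) ≤ (2 + 1 / 10 ^ 6) * (m + 6) := by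
  calc _ ≤ ∑ a ∈ Ioc 0 ⌊exp m⌋₊, Λ a / a * (2 + 1 / 10 ^ 6) := by
        refine sum_le_sum fun a ha => ?_
        rw [mem_Ioc_exp] at ha
        have := log_natCast_nonneg a
        exact mul_le_mul_of_nonneg_left (h.fW_le (Or.inl rfl) (by linarith) (by linarith))
          (vonMangoldt_div_nonneg a)
    _ = (2 + 1 / 10 ^ 6) * mert m := by rw [← sum_mul, mul_comm, mert]
    _ ≤ _ := by
        have := (abs_le.1 (abs_mert_sub_le hm)).2
        gcongr
        linarith

/-- Splitting the sum over pairs according to whether the first factor is at most `exp m`. -/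
lemma convolution_split (h : Scale L η τ) {m m' : ℝ} (hm : m + m' = v + 1) :
    η * ∑ a ∈ Ioc 0 ⌊exp m⌋₊, Λ a / a * fW η (v - log a) ≤ ∑ n ∈ win v η, (Λ * Λ) n / n ∧
    ∑ n ∈ win v η, (Λ * Λ) n / n ≤ η * ∑ a ∈ Ioc 0 ⌊exp m⌋₊, Λ a / a * fW η (v - log a) +
      η * ∑ a ∈ Ioc 0 ⌊exp m'⌋₊, Λ a / a * fW η (v - log a) := by
  have hη := h.η_pos
  have hη1 : η ≤ 1 := h.η_le.trans (by norm_num)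
  set V := max (v + η) (max m m') with hV
  have hvV : v + η ≤ V := le_max_left _ _
  have hmV : m ≤ V := (le_max_left _ _).trans (le_max_right _ _)
  have hmV' : m' ≤ V := (le_max_right _ _).trans (le_max_right _ _)
  have hnn : ∀ a b : ℕ, 0 ≤ Λ a / a * (Λ b / b) := fun a b =>
    mul_nonneg (vonMangoldt_div_nonneg a) (vonMangoldt_div_nonneg b)
  have eG : ∀ s : ℝ, s ≤ V → η * ∑ a ∈ Ioc 0 ⌊exp s⌋₊, Λ a / a * fW η (v - log a) =
      ∑ n ∈ win v η, ∑ x ∈ n.divisorsAntidiagonal,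
        if log x.1 ≤ s then Λ x.1 / x.1 * (Λ x.2 / x.2) else 0 := by
    intro s hs
    rw [sum_win_antidiagonal hvV fun a b => if log a ≤ s then Λ a / a * (Λ b / b) else 0, mul_sum]
    have hsub : Ioc 0 ⌊exp s⌋₊ ⊆ Ioc 0 ⌊exp V⌋₊ :=
      Ioc_subset_Ioc_right (Nat.floor_le_floor (exp_le_exp.2 hs))
    rw [← sum_subset hsub]
    · refine sum_congr rfl fun a ha => ?_
      rw [mem_Ioc_exp] at ha
      simp only [if_pos ha.2]
      rw [← mul_sum, Setup.sum_eq_fW hη]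
      ring
    · intro a ha hs'
      rw [mem_Ioc_exp] at ha hs'
      have : ¬ log a ≤ s := fun hc => hs' ⟨ha.1, hc⟩
      simp [if_neg this]
  have eT : ∑ n ∈ win v η, (Λ * Λ) n / n =
      ∑ n ∈ win v η, ∑ x ∈ n.divisorsAntidiagonal, Λ x.1 / x.1 * (Λ x.2 / x.2) := by
    rw [sum_win_vonMangoldt_mul_vonMangoldt hvV, sum_win_antidiagonal hvV
      fun a b => Λ a / a * (Λ b / b)]
    exact sum_congr rfl fun a _ => mul_sum _ _ _
  have eS : ∑ n ∈ win v η, ∑ x ∈ n.divisorsAntidiagonal,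
        (if log x.1 ≤ m' then Λ x.1 / x.1 * (Λ x.2 / x.2) else 0) =
      ∑ n ∈ win v η, ∑ x ∈ n.divisorsAntidiagonal,
        (if log x.2 ≤ m' then Λ x.1 / x.1 * (Λ x.2 / x.2) else 0) := by
    refine sum_congr rfl fun n _ => ?_
    refine sum_equiv (Equiv.prodComm ℕ ℕ) (fun x => Nat.swap_mem_divisorsAntidiagonal.symm)
      fun x _ => ?_
    simp [mul_comm]
  rw [eG m hmV, eG m' hmV', eS, eT]
  refine ⟨sum_le_sum fun n _ => sum_le_sum fun x _ => ?_, ?_⟩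
  · split_ifs
    exacts [le_rfl, hnn _ _]
  · rw [← sum_add_distrib]
    refine sum_le_sum fun n hn => ?_
    rw [← sum_add_distrib]
    refine sum_le_sum fun x hx => ?_
    rw [mem_win] at hn
    rw [Nat.mem_divisorsAntidiagonal] at hx
    have hx1 : (x.1 : ℝ) ≠ 0 := by
      have : x.1 ≠ 0 := by rintro h0; rw [h0, zero_mul] at hx; exact hx.2 hx.1.symm
      exact_mod_cast this
    have hx2 : (x.2 : ℝ) ≠ 0 := by
      have : x.2 ≠ 0 := by rintro h0; rw [h0, mul_zero] at hx; exact hx.2 hx.1.symm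
      exact_mod_cast this
    have hlog : log n = log x.1 + log x.2 := by
      rw [← log_mul hx1 hx2, ← hx.1]; push_cast; rfl
    have := hnn x.1 x.2
    split_ifs with c1 c2 c2
    · linarith
    · linarith
    · linarith
    · exfalso; push Not at c1 c2; linarith [hn.2.2]

/-- Selberg's formula for the error term. -/
lemma selberg_rW (h : Scale L η τ) (h1 : 3 * (L / 10 ^ 6) ≤ v) (h2 : v ≤ L + 1) :
    |v * rW η v + ∑ a ∈ Ioc 0 ⌊exp (v - L / 10 ^ 6)⌋₊, Λ a / a * rW η (v - log a)| ≤
      5 * (L / 10 ^ 6) := by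
  have hL := h.L_ge
  have hη := h.η_pos
  obtain ⟨s1, s2⟩ := h.convolution_split (v := v) (m := v - L / 10 ^ 6) (m' := L / 10 ^ 6 + 1) (by ring)
  have s3 := h.sum_vonMangoldt_mul_fW_le (v := v) (m := L / 10 ^ 6 + 1) (by linarith) (by linarith)
    (by linarith)
  have s4 := h.selberg v η (Or.inl rfl) (by linarith) (by linarith)
  rw [Setup.sum_eq_fW hη] at s4
  have s5 := abs_le.1 (abs_mert_sub_le (show 0 ≤ v - L / 10 ^ 6 by linarith))
  set A := ∑ a ∈ Ioc 0 ⌊exp (v - L / 10 ^ 6)⌋₊, Λ a / a * fW η (v - log a) with hA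
  set B := ∑ a ∈ Ioc 0 ⌊exp (L / 10 ^ 6 + 1)⌋₊, Λ a / a * fW η (v - log a) with hB
  set D := ∑ n ∈ win v η, (Λ * Λ) n / n with hD
  have e : ∑ a ∈ Ioc 0 ⌊exp (v - L / 10 ^ 6)⌋₊, Λ a / a * rW η (v - log a) =
      A - mert (v - L / 10 ^ 6) := by
    rw [hA, mert, ← sum_sub_distrib]
    exact sum_congr rfl fun a _ => by rw [rW]; ring
  have hd : D = η * (D / η) := by field_simp
  rw [hd] at s1 s2 s4
  have s1' : A ≤ D / η := le_of_mul_le_mul_left s1 hη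
  have s2' : D / η ≤ A + B := by
    rw [← mul_add] at s2; exact le_of_mul_le_mul_left s2 hη
  have s4' : |v * fW η v + D / η - 2 * v| ≤ L / 10 ^ 12 := by
    rw [show v * (η * fW η v) + η * (D / η) - 2 * v * η = η * (v * fW η v + D / η - 2 * v) by ring,
      abs_mul, abs_of_pos hη] at s4
    exact le_of_mul_le_mul_left s4 hη
  rw [abs_le] at s4'
  rw [e, rW, abs_le]
  constructor <;> linarith [s4'.1, s4'.2, s5.1, s5.2]

end Scale
end PrimeGap

namespace PrimeGap
open Real Finset MeasureTheory intervalIntegral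
open scoped ArithmeticFunction.Moebius ArithmeticFunction.vonMangoldt

namespace Scale
variable {L η τ v θ : ℝ}

lemma locBdd (h : Scale L η τ) : LocBdd (rW η) := locBdd_rW h.η_pos.le

lemma integral_rW_sq_ge (h : Scale L η τ) (hgap : rW η L = -1) :
    L - 26 * (L / 10 ^ 6) ≤ ∫ u in (L / 10 ^ 6 + τ)..(L - L / 10 ^ 6), rW η u ^ 2 := by
  have hL := h.L_ge
  have hη := h.η_pos
  have hτ := h.τ_pos
  have hτ1 := h.τ_le
  set M := L / 10 ^ 6 with hM
  have hsel := (abs_le.1 (h.selberg_rW (v := L) (by linarith) (by linarith))).1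
  rw [hgap, ← hM] at hsel
  have hr : LocBdd fun u => rW η (L - u) := h.locBdd.comp_sub_left L
  have hrτ : LocBdd (rW τ) := locBdd_rW hτ.le
  have hG : LocBdd fun u => 2 - rW η (L - u) := (LocBdd.const 2).sub hr
  have hmain := integral_sum_win_mul_le (h := fun n => Λ n / n) vonMangoldt_div_nonneg hG
    (α := M) (β := L - M - τ) (ω := 3 / 10 ^ 6) hτ.le (by norm_num) (by linarith)
    (fun u hu => by
      have := h.rW_le (Or.inl rfl) (v := L - u) (by linarith [hu.2]) (by linarith [hu.1])
      linarith)
    (fun u hu x hx => by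
      have := abs_le.1 (h.abs_rW_sub_le (x := L - x) (x' := L - u) (by linarith [hu.2, hx.2])
        (by linarith [hu.1, hx.1]) (by linarith [hx.1]) (by linarith [hx.2]))
      linarith [this.1])
  have hup : ∑ n ∈ win M (L - M - τ + τ - M), Λ n / n * (2 - rW η (L - log n) + 3 / 10 ^ 6) ≤
      L + 7 * M := by
    have hsub : win M (L - M - τ + τ - M) ⊆ Ioc 0 ⌊exp (L - M)⌋₊ := by
      intro n hn
      rw [mem_win] at hn
      exact mem_Ioc_exp.2 ⟨hn.1, by linarith [hn.2.2]⟩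
    calc _ ≤ ∑ n ∈ Ioc 0 ⌊exp (L - M)⌋₊, Λ n / n * (2 - rW η (L - log n) + 3 / 10 ^ 6) := by
          refine sum_le_sum_of_subset_of_nonneg hsub fun n hn _ => ?_
          rw [mem_Ioc_exp] at hn
          have := h.rW_le (Or.inl rfl) (v := L - log n) (by linarith [hn.2])
            (by linarith [log_natCast_nonneg n])
          exact mul_nonneg (vonMangoldt_div_nonneg n) (by linarith)
      _ = (2 + 3 / 10 ^ 6) * mert (L - M) -
          ∑ a ∈ Ioc 0 ⌊exp (L - M)⌋₊, Λ a / a * rW η (L - log a) := by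
          rw [mert, mul_sum, ← sum_sub_distrib]
          exact sum_congr rfl fun n _ => by ring
      _ ≤ _ := by
          have := (abs_le.1 (abs_mert_sub_le (show 0 ≤ L - M by linarith))).2
          linarith
  have hlow : ∫ u in M..(L - M - τ), τ * (2 * rW τ u + (3 / 2 - 2 / 10 ^ 6) - rW η (L - u) -
      1 / 2 * rW η (L - u) ^ 2) ≤
      ∫ u in M..(L - M - τ), (∑ n ∈ win u τ, Λ n / n) * (2 - rW η (L - u)) := by
    refine LocBdd.integral_mono ((LocBdd.const τ).mul (((((LocBdd.const 2).mul hrτ).add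
      (LocBdd.const _)).sub hr).sub ((LocBdd.const _).mul hr.sq)))
      ((locBdd_sum_win vonMangoldt_div_nonneg hτ.le).mul hG) (by linarith) fun u hu => ?_
    rw [Setup.sum_eq_fW hτ, show fW τ u = 1 + rW τ u by rw [rW]; ring, mul_assoc]
    refine mul_le_mul_of_nonneg_left ?_ hτ.le
    have := h.rW_sq_le (Or.inr rfl) (v := u) hu.1 (by linarith [hu.2])
    nlinarith [sq_nonneg (rW τ u - rW η (L - u))]
  have e : ∫ u in M..(L - M - τ), τ * (2 * rW τ u + (3 / 2 - 2 / 10 ^ 6) - rW η (L - u) -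
      1 / 2 * rW η (L - u) ^ 2) = τ * (2 * (∫ u in M..(L - M - τ), rW τ u) +
        (L - M - τ - M) * (3 / 2 - 2 / 10 ^ 6) - (∫ u in (M + τ)..(L - M), rW η u) -
        1 / 2 * ∫ u in (M + τ)..(L - M), rW η u ^ 2) := by
    rw [intervalIntegral.integral_const_mul]
    have t1 := (LocBdd.const 2).mul hrτ
    have t2 := t1.add (LocBdd.const (3 / 2 - 2 / 10 ^ 6))
    have t3 := t2.sub hr
    have t4 := (LocBdd.const (1 / 2)).mul hr.sq
    rw [t3.integral_sub_eq t4, t2.integral_sub_eq hr, t1.integral_add_eq (LocBdd.const _),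
      intervalIntegral.integral_const_mul, intervalIntegral.integral_const_mul,
      intervalIntegral.integral_const, intervalIntegral.integral_comp_sub_left (fun u => rW η u),
      intervalIntegral.integral_comp_sub_left (fun u => rW η u ^ 2),
      show L - (L - M - τ) = M + τ by ring, smul_eq_mul]
  rw [e] at hlow
  have hfin := le_of_mul_le_mul_left ((hlow.trans hmain).trans
    (mul_le_mul_of_nonneg_left hup hτ.le)) hτ
  have i1 := (abs_le.1 (abs_integral_rW_le hτ (by linarith) (show 0 ≤ M by linarith)
    (show M ≤ L - M - τ by linarith))).1
  have i2 := (abs_le.1 (abs_integral_rW_le hη (h.η_le.trans (by norm_num))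
    (show 0 ≤ M + τ by linarith) (show M + τ ≤ L - M by linarith))).2
  linarith

lemma le_integral_rW_sq (h : Scale L η τ) (hgap : rW η L = -1) {a b : ℝ} (ha : L / 4 ≤ a)
    (hab : a ≤ b) (hb : b ≤ 3 * L / 4) :
    b - a - 27 * (L / 10 ^ 6) ≤ ∫ u in a..b, rW η u ^ 2 := by
  have hL := h.L_ge
  have hτ := h.τ_pos
  have hτ1 := h.τ_le
  have hm := h.integral_rW_sq_ge hgap
  set M := L / 10 ^ 6 with hM
  have hr := h.locBdd.sq
  have hle : ∀ x y, M ≤ x → x ≤ y → y ≤ L →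
      ∫ u in x..y, rW η u ^ 2 ≤ (y - x) * (1 + 3 / 10 ^ 6) := by
    intro x y hx hxy hy
    have := hr.integral_mono (LocBdd.const (1 + 3 / 10 ^ 6)) hxy fun u hu =>
      h.rW_sq_le (Or.inl rfl) (v := u) (by linarith [hu.1]) (by linarith [hu.2])
    rwa [intervalIntegral.integral_const, smul_eq_mul] at this
  have h1 := hle (M + τ) a (by linarith) (by linarith) (by linarith)
  have h2 := hle b (L - M) (by linarith) (by linarith) (by linarith)
  have e1 := integral_add_adjacent_intervals (hr.intervalIntegrable (M + τ) a)
    (hr.intervalIntegrable a b)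
  have e2 := integral_add_adjacent_intervals (hr.intervalIntegrable (M + τ) b)
    (hr.intervalIntegrable b (L - M))
  linarith

lemma sum_sq_add_le (h : Scale L η τ) (h1 : L / 4 ≤ v) (h2 : v ≤ 3 * L / 4) :
    ∑ a ∈ Ioc 0 ⌊exp (L / 8)⌋₊, Λ a / a * (rW η v + rW η (v - log a)) ^ 2 ≤
      L * (1 - rW η v ^ 2) + 17 * (L / 10 ^ 6) := by
  have hL := h.L_ge
  have hsel := abs_le.1 (h.selberg_rW (v := v) (by linarith) (by linarith))
  have hR := abs_le.1 (h.abs_rW_le (v := v) (by linarith) (by linarith))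
  have hR2 := h.rW_sq_le (Or.inl rfl) (v := v) (by linarith) (by linarith)
  set M := L / 10 ^ 6 with hM
  set R := rW η v with hRdef
  have hm := (abs_le.1 (abs_mert_sub_le (show 0 ≤ v - M by linarith))).2
  set X := ∑ a ∈ Ioc 0 ⌊exp (v - M)⌋₊, Λ a / a * rW η (v - log a) with hX
  calc _ ≤ ∑ a ∈ Ioc 0 ⌊exp (v - M)⌋₊, Λ a / a * (R + rW η (v - log a)) ^ 2 := by
        refine sum_le_sum_of_subset_of_nonneg (Ioc_subset_Ioc_right (Nat.floor_le_floor
          (exp_le_exp.2 (by linarith)))) fun n _ _ => ?_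
        exact mul_nonneg (vonMangoldt_div_nonneg n) (sq_nonneg _)
    _ ≤ ∑ a ∈ Ioc 0 ⌊exp (v - M)⌋₊, (Λ a / a * (R ^ 2 + (1 + 3 / 10 ^ 6)) +
          2 * R * (Λ a / a * rW η (v - log a))) := by
        refine sum_le_sum fun a ha => ?_
        rw [mem_Ioc_exp] at ha
        have := h.rW_sq_le (Or.inl rfl) (v := v - log a) (by linarith)
          (by linarith [log_natCast_nonneg a])
        have := mul_le_mul_of_nonneg_left this (vonMangoldt_div_nonneg a)
        linarith
    _ = mert (v - M) * (R ^ 2 + (1 + 3 / 10 ^ 6)) + 2 * R * X := by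
        rw [sum_add_distrib, ← sum_mul, ← mul_sum, mert]
    _ ≤ (v - M + 6) * (R ^ 2 + (1 + 3 / 10 ^ 6)) + 2 * R * X := by
        gcongr; linarith
    _ ≤ _ := by
        have hXR : 2 * R * X ≤ -2 * v * R ^ 2 + 11 * M := by
          have : R * (X + v * R) ≤ (11 / 10) * (5 * M) := by
            have hab : |X + v * R| ≤ 5 * M := by rw [abs_le]; constructor <;> linarith [hsel.1, hsel.2]
            have hR' : |R| ≤ 11 / 10 := by rw [abs_le]; constructor <;> linarith [hR.1, hR.2]
            calc R * (X + v * R) ≤ |R * (X + v * R)| := le_abs_self _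
              _ = |R| * |X + v * R| := abs_mul _ _
              _ ≤ _ := mul_le_mul hR' hab (abs_nonneg _) (by norm_num)
          nlinarith
        have : (L - v) * (1 + 3 / 10 ^ 6 - R ^ 2) ≥ 0 := mul_nonneg (by linarith) (by linarith)
        nlinarith [sq_nonneg R]

/-- Mean square of `R(v) + R(v - u)`. -/
noncomputable def meanAdd (L η u : ℝ) : ℝ :=
  ∫ v in (L / 4)..(3 * L / 4), (rW η v + rW η (v - u)) ^ 2

/-- Mean square of `R(v) - R(v - u)`. -/
noncomputable def meanSub (L η u : ℝ) : ℝ :=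
  ∫ v in (L / 2)..(3 * L / 4), (rW η v - rW η (v - u)) ^ 2

lemma sum_meanAdd_le (h : Scale L η τ) (hgap : rW η L = -1) :
    ∑ a ∈ Ioc 0 ⌊exp (L / 8)⌋₊, Λ a / a * meanAdd L η (log a) ≤ 40 * (L * (L / 10 ^ 6)) := by
  have hL := h.L_ge
  have hr := h.locBdd
  have hF : ∀ a : ℕ, LocBdd fun v => (rW η v + rW η (v - log a)) ^ 2 := fun a =>
    (hr.add (hr.comp_sub _)).sq
  have hI := h.le_integral_rW_sq hgap (a := L / 4) (b := 3 * L / 4) le_rfl (by linarith) le_rfl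
  unfold meanAdd
  rw [← LocBdd.integral_sum_eq _ (fun a : ℕ => Λ a / a) hF]
  have t := ((LocBdd.const L).mul ((LocBdd.const 1).sub hr.sq))
  have hm := (LocBdd.sum (Ioc 0 ⌊exp (L / 8)⌋₊) fun a : ℕ =>
    (LocBdd.const (Λ a / a)).mul (hF a)).integral_mono
    (t.add (LocBdd.const (17 * (L / 10 ^ 6)))) (show L / 4 ≤ 3 * L / 4 by linarith) fun v hv =>
      h.sum_sq_add_le hv.1 hv.2
  refine hm.trans ?_
  rw [t.integral_add_eq (LocBdd.const _), intervalIntegral.integral_const_mul,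
    (LocBdd.const 1).integral_sub_eq hr.sq, intervalIntegral.integral_const,
    intervalIntegral.integral_const, smul_eq_mul, smul_eq_mul]
  nlinarith

end Scale
end PrimeGap

namespace PrimeGap
open Real Finset MeasureTheory intervalIntegral
open scoped ArithmeticFunction.Moebius ArithmeticFunction.vonMangoldt

namespace Scale
variable {L η τ v θ : ℝ}

lemma meanAdd_nonneg (h : Scale L η τ) (u : ℝ) : 0 ≤ meanAdd L η u :=
  integral_nonneg (by linarith [h.L_ge]) fun _ _ => sq_nonneg _

/-- Shifting the variable in the mean square of `R(v) + R(v - s)`. -/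
lemma integral_shift_le_meanAdd (h : Scale L η τ) {s w : ℝ} (hw : 0 ≤ w) (hw' : w ≤ L / 4) :
    ∫ v in (L / 2)..(3 * L / 4), (rW η (v - w) + rW η (v - w - s)) ^ 2 ≤ meanAdd L η s := by
  have hL := h.L_ge
  have hr := h.locBdd
  rw [meanAdd, intervalIntegral.integral_comp_sub_right (fun v => (rW η v + rW η (v - s)) ^ 2)]
  exact (hr.add (hr.comp_sub s)).sq.integral_mono_interval (by linarith) (by linarith) (by linarith)
    fun _ _ => sq_nonneg _

lemma locBdd_shift (h : Scale L η τ) (w s : ℝ) :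
    LocBdd fun v => (rW η (v - w) + rW η (v - w - s)) ^ 2 := by
  have hr := h.locBdd
  have := (hr.comp_sub w).add (hr.comp_sub (w + s))
  simpa only [sub_sub] using this.sq

lemma meanSub_two_mul_le (h : Scale L η τ) {s : ℝ} (hs : 0 ≤ s) (hs' : s ≤ L / 8) :
    meanSub L η (2 * s) ≤ 4 * meanAdd L η s := by
  have hL := h.L_ge
  have hr := h.locBdd
  have h1 := h.integral_shift_le_meanAdd (s := s) le_rfl (by linarith)
  have h2 := h.integral_shift_le_meanAdd (s := s) hs (by linarith)
  have b1 := h.locBdd_shift 0 s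
  have b2 := h.locBdd_shift s s
  have hle := (hr.sub (hr.comp_sub (2 * s))).sq.integral_mono ((LocBdd.const 2).mul (b1.add b2))
    (show L / 2 ≤ 3 * L / 4 by linarith) fun v _ => by
      rw [sub_zero, show v - s - s = v - 2 * s by ring]
      nlinarith [sq_nonneg (rW η v + 2 * rW η (v - s) + rW η (v - 2 * s))]
  rw [intervalIntegral.integral_const_mul, b1.integral_add_eq b2] at hle
  rw [meanSub]
  linarith

lemma meanSub_two_mul_add_le (h : Scale L η τ) {s t : ℝ} (hs : 0 ≤ s) (ht : 0 ≤ t)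
    (hst : s + t ≤ L / 8) :
    meanSub L η (2 * (s + t)) ≤ 8 * (meanAdd L η s + meanAdd L η t) := by
  have hL := h.L_ge
  have hr := h.locBdd
  have h1 := h.integral_shift_le_meanAdd (s := s) le_rfl (by linarith)
  have h2 := h.integral_shift_le_meanAdd (s := t) (w := s) hs (by linarith)
  have h3 := h.integral_shift_le_meanAdd (s := s) (w := s + t) (by linarith) (by linarith)
  have h4 := h.integral_shift_le_meanAdd (s := t) (w := 2 * s + t) (by linarith) (by linarith)
  have b1 := h.locBdd_shift 0 s
  have b2 := h.locBdd_shift s t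
  have b3 := h.locBdd_shift (s + t) s
  have b4 := h.locBdd_shift (2 * s + t) t
  have hle := (hr.sub (hr.comp_sub (2 * (s + t)))).sq.integral_mono
    ((LocBdd.const 4).mul (((b1.add b2).add b3).add b4))
    (show L / 2 ≤ 3 * L / 4 by linarith) fun v _ => by
      rw [sub_zero, show v - s - t = v - (s + t) by ring,
        show v - (s + t) - s = v - (2 * s + t) by ring,
        show v - (2 * s + t) - t = v - 2 * (s + t) by ring]
      have key : ∀ a b c d : ℝ, (a - b + c - d) ^ 2 ≤ 4 * (a ^ 2 + b ^ 2 + c ^ 2 + d ^ 2) := by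
        intro a b c d
        nlinarith [sq_nonneg (a + b), sq_nonneg (a - c), sq_nonneg (a + d), sq_nonneg (b + c),
          sq_nonneg (b - d), sq_nonneg (c + d)]
      refine le_trans (le_of_eq ?_) (key _ _ _ _)
      ring
  rw [intervalIntegral.integral_const_mul, ((b1.add b2).add b3).integral_add_eq b4,
    (b1.add b2).integral_add_eq b3, b1.integral_add_eq b2] at hle
  rw [meanSub]
  linarith

/-- The weight in Selberg's formula. -/
noncomputable def selbergWt (n : ℕ) : ℝ := log n * (Λ n / n) + (Λ * Λ) n / n

lemma selbergWt_nonneg (n : ℕ) : 0 ≤ selbergWt n :=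
  add_nonneg (mul_nonneg (log_natCast_nonneg n) (vonMangoldt_div_nonneg n))
    (vonMangoldt_mul_div_nonneg n)

/-- A nonnegative sum over pairs with product at most `exp V`. -/
lemma sum_convolution_le {V : ℝ} {f : ℕ → ℝ} {g : ℕ → ℕ → ℝ}
    (hg : ∀ a b, 0 ≤ g a b)
    (hf : ∀ a b : ℕ, 0 < a → 0 < b → log a + log b ≤ V → f (a * b) ≤ g a b) :
    ∑ n ∈ Ioc 0 ⌊exp V⌋₊, (Λ * Λ) n / n * f n ≤ ∑ a ∈ Ioc 0 ⌊exp V⌋₊, ∑ b ∈ Ioc 0 ⌊exp V⌋₊,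
      Λ a / a * (Λ b / b) * g a b := by
  have hwin : Ioc 0 ⌊exp V⌋₊ = win (-1) (V + 1) := by
    ext n
    rw [mem_Ioc_exp, mem_win]
    have := log_natCast_nonneg n
    constructor
    · rintro ⟨h1, h2⟩; exact ⟨h1, by linarith, by linarith⟩
    · rintro ⟨h1, _, h2⟩; exact ⟨h1, by linarith⟩
  have hnn : ∀ a b : ℕ, 0 ≤ Λ a / a * (Λ b / b) := fun a b =>
    mul_nonneg (vonMangoldt_div_nonneg a) (vonMangoldt_div_nonneg b)
  calc _ ≤ ∑ n ∈ win (-1) (V + 1), ∑ x ∈ n.divisorsAntidiagonal,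
        Λ x.1 / x.1 * (Λ x.2 / x.2) * g x.1 x.2 := by
        rw [hwin]
        refine sum_le_sum fun n hn => ?_
        rw [← hwin, mem_Ioc_exp] at hn
        rw [ArithmeticFunction.mul_apply, sum_div, sum_mul]
        refine sum_le_sum fun x hx => ?_
        rw [Nat.mem_divisorsAntidiagonal] at hx
        have hx1 : 0 < x.1 := Nat.pos_of_ne_zero fun h0 => by
          rw [h0, zero_mul] at hx; exact hx.2 hx.1.symm
        have hx2 : 0 < x.2 := Nat.pos_of_ne_zero fun h0 => by
          rw [h0, mul_zero] at hx; exact hx.2 hx.1.symm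
        have hlog : log n = log x.1 + log x.2 := by
          rw [← log_mul (by exact_mod_cast hx1.ne') (by exact_mod_cast hx2.ne'), ← hx.1]
          push_cast; rfl
        have e : Λ x.1 * Λ x.2 / (n : ℝ) = Λ x.1 / x.1 * (Λ x.2 / x.2) := by
          rw [← hx.1, div_mul_div_comm, Nat.cast_mul]
        rw [e, ← hx.1]
        exact mul_le_mul_of_nonneg_left (hf _ _ hx1 hx2 (hlog ▸ hn.2)) (hnn _ _)
    _ = ∑ a ∈ Ioc 0 ⌊exp V⌋₊, ∑ b ∈ win (-1 - log a) (V + 1), Λ a / a * (Λ b / b) * g a b :=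
        sum_win_antidiagonal (by linarith) fun a b => Λ a / a * (Λ b / b) * g a b
    _ ≤ _ := by
        refine sum_le_sum fun a _ => sum_le_sum_of_subset_of_nonneg (fun b hb => ?_)
          fun b _ _ => mul_nonneg (hnn a b) (hg a b)
        rw [mem_win] at hb
        exact mem_Ioc_exp.2 ⟨hb.1, by linarith [hb.2.2, log_natCast_nonneg a]⟩

lemma mert_eighth_le (h : Scale L η τ) : mert (L / 8) ≤ L / 7 := by
  have hL := h.L_ge
  have := (abs_le.1 (abs_mert_sub_le (show 0 ≤ L / 8 by linarith))).2
  linarith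

lemma sum_selbergWt_le (h : Scale L η τ) :
    ∑ n ∈ Ioc 0 ⌊exp (L / 8)⌋₊, selbergWt n ≤ L ^ 2 / 16 := by
  have hL := h.L_ge
  have hm := h.mert_eighth_le
  have hm0 := mert_nonneg (L / 8)
  have h1 : ∑ n ∈ Ioc 0 ⌊exp (L / 8)⌋₊, log n * (Λ n / n) ≤ L / 8 * mert (L / 8) := by
    rw [mert, mul_sum]
    refine sum_le_sum fun n hn => ?_
    rw [mem_Ioc_exp] at hn
    exact mul_le_mul_of_nonneg_right hn.2 (vonMangoldt_div_nonneg n)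
  have h2 := sum_convolution_le (V := L / 8) (f := fun _ => 1) (g := fun _ _ => 1)
    (fun _ _ => zero_le_one) fun _ _ _ _ _ => le_rfl
  simp only [mul_one, ← mul_sum, ← sum_mul] at h2
  simp only [selbergWt, sum_add_distrib]
  rw [mert] at *
  nlinarith

lemma sum_meanSub_le (h : Scale L η τ) (hgap : rW η L = -1) :
    ∑ n ∈ Ioc 0 ⌊exp (L / 8)⌋₊, selbergWt n * meanSub L η (2 * log n) ≤
      120 * (L ^ 2 * (L / 10 ^ 6)) := by
  have hL := h.L_ge
  have hA := h.sum_meanAdd_le hgap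
  have hm := h.mert_eighth_le
  have hm0 := mert_nonneg (L / 8)
  set A := ∑ a ∈ Ioc 0 ⌊exp (L / 8)⌋₊, Λ a / a * meanAdd L η (log a) with hAdef
  have h1 : ∑ n ∈ Ioc 0 ⌊exp (L / 8)⌋₊, log n * (Λ n / n) * meanSub L η (2 * log n) ≤
      L / 2 * A := by
    rw [hAdef, mul_sum]
    refine sum_le_sum fun n hn => ?_
    rw [mem_Ioc_exp] at hn
    have a1 := log_natCast_nonneg n
    have a2 := h.meanSub_two_mul_le a1 hn.2
    have a3 := vonMangoldt_div_nonneg n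
    have a4 := h.meanAdd_nonneg (log n)
    calc _ ≤ log n * (Λ n / n) * (4 * meanAdd L η (log n)) :=
          mul_le_mul_of_nonneg_left a2 (mul_nonneg a1 a3)
      _ ≤ (L / 8) * (Λ n / n) * (4 * meanAdd L η (log n)) := by gcongr; exact hn.2
      _ = _ := by ring
  have h2 := sum_convolution_le (V := L / 8) (f := fun n => meanSub L η (2 * log n))
    (g := fun a b => 8 * (meanAdd L η (log a) + meanAdd L η (log b)))
    (fun a b => by have := h.meanAdd_nonneg (log a); have := h.meanAdd_nonneg (log b); positivity)
    fun a b ha hb hab => by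
      have e : log ((a * b : ℕ) : ℝ) = log a + log b := by
        rw [Nat.cast_mul, log_mul (by exact_mod_cast ha.ne') (by exact_mod_cast hb.ne')]
      simp only [e]
      exact h.meanSub_two_mul_add_le (log_natCast_nonneg a) (log_natCast_nonneg b) hab
  have h3 : ∑ a ∈ Ioc 0 ⌊exp (L / 8)⌋₊, ∑ b ∈ Ioc 0 ⌊exp (L / 8)⌋₊,
      Λ a / a * (Λ b / b) * (8 * (meanAdd L η (log a) + meanAdd L η (log b))) =
      16 * A * mert (L / 8) := by
    have e : ∀ a b : ℕ, Λ a / a * (Λ b / b) * (8 * (meanAdd L η (log a) + meanAdd L η (log b))) =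
        8 * ((Λ a / a * meanAdd L η (log a)) * (Λ b / b)) +
        8 * ((Λ a / a) * (Λ b / b * meanAdd L η (log b))) := fun a b => by ring
    simp only [e, sum_add_distrib, ← mul_sum, ← sum_mul]
    rw [mert, hAdef]
    ring
  rw [h3] at h2
  have hA0 : 0 ≤ A := sum_nonneg fun a _ =>
    mul_nonneg (vonMangoldt_div_nonneg a) (h.meanAdd_nonneg _)
  simp only [selbergWt, add_mul, sum_add_distrib]
  have h4 : 16 * A * mert (L / 8) ≤ 16 * A * (L / 7) := by gcongr
  have h5 : L * A ≤ L * (40 * (L * (L / 10 ^ 6))) := by gcongr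
  nlinarith

lemma le_sum_win_selbergWt (h : Scale L η τ) (h1 : L / 16 ≤ v) (h2 : v ≤ L) :
    τ * (L / 9) ≤ ∑ n ∈ win v τ, selbergWt n := by
  have hL := h.L_ge
  have hs := (abs_le.1 (h.selberg v τ (Or.inr rfl) (by linarith) (by linarith))).1
  have : v * ∑ n ∈ win v τ, Λ n / n ≤ ∑ n ∈ win v τ, log n * (Λ n / n) := by
    rw [mul_sum]
    refine sum_le_sum fun n hn => mul_le_mul_of_nonneg_right ?_ (vonMangoldt_div_nonneg n)
    exact (mem_win.1 hn).2.1.le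
  simp only [selbergWt, sum_add_distrib]
  nlinarith [h.τ_pos]

lemma pointwise_lower (h : Scale L η τ) (h1 : L / 2 ≤ v) (h2 : v ≤ 3 * L / 4) :
    L / 9 * ((L / 16 - 1) * rW η v ^ 2 - 15) ≤
      ∑ n ∈ Ioc 0 ⌊exp (L / 8)⌋₊, selbergWt n * (rW η v - rW η (v - 2 * log n)) ^ 2 +
        2 * (L * (L / 10 ^ 6)) := by
  have hL := h.L_ge
  have hη := h.η_pos
  have hτ := h.τ_pos
  have hτ1 := h.τ_le
  have hr := h.locBdd
  have hR := abs_le.1 (h.abs_rW_le (v := v) (by linarith) (by linarith))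
  have hG : LocBdd fun u => (rW η v - rW η (v - 2 * u)) ^ 2 :=
    ((LocBdd.const _).sub (hr.comp_sub_mul 2 v)).sq
  have hmain := integral_sum_win_mul_le selbergWt_nonneg hG
    (α := L / 16) (β := L / 8 - 1) (τ := τ) (ω := 30 / 10 ^ 6) hτ.le (by norm_num) (by linarith)
    (fun u hu => sq_nonneg _) (fun u hu x hx => by
      have a := abs_le.1 (h.abs_rW_sub_le_two (x := v - 2 * x) (x' := v - 2 * u)
        (by linarith [hu.2, hx.2]) (by linarith [hu.1]) (by linarith [hx.1]) (by linarith [hx.2]))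
      have b := abs_le.1 (h.abs_rW_le (v := v - 2 * u) (by linarith [hu.2]) (by linarith [hu.1]))
      have c := abs_le.1 (h.abs_rW_le (v := v - 2 * x) (by linarith [hu.2, hx.2])
        (by linarith [hu.1, hx.1]))
      set p := rW η (v - 2 * u)
      set p' := rW η (v - 2 * x)
      have e : (rW η v - p) ^ 2 - (rW η v - p') ^ 2 = (p - p') * (p + p' - 2 * rW η v) := by ring
      have e2 : |(p - p') * (p + p' - 2 * rW η v)| ≤ (6 / 10 ^ 6) * 5 := by
        rw [abs_mul]
        refine mul_le_mul (abs_le.2 ⟨by linarith [a.1], by linarith [a.2]⟩)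
          (abs_le.2 ⟨by linarith [hR.2, b.1, c.1], by linarith [hR.1, b.2, c.2]⟩) (abs_nonneg _)
          (by norm_num)
      linarith [le_abs_self ((p - p') * (p + p' - 2 * rW η v))])
  have hlow : ∫ u in (L / 16)..(L / 8 - 1), τ * (L / 9) * (rW η v - rW η (v - 2 * u)) ^ 2 ≤
      ∫ u in (L / 16)..(L / 8 - 1), (∑ n ∈ win u τ, selbergWt n) *
        (rW η v - rW η (v - 2 * u)) ^ 2 := by
    refine ((LocBdd.const _).mul hG).integral_mono ((locBdd_sum_win selbergWt_nonneg hτ.le).mul hG)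
      (by linarith) fun u hu => ?_
    exact mul_le_mul_of_nonneg_right (h.le_sum_win_selbergWt hu.1 (by linarith [hu.2])) (sq_nonneg _)
  have hup : ∑ n ∈ win (L / 16) (L / 8 - 1 + τ - L / 16),
      selbergWt n * ((rW η v - rW η (v - 2 * log n)) ^ 2 + 30 / 10 ^ 6) ≤
      ∑ n ∈ Ioc 0 ⌊exp (L / 8)⌋₊, selbergWt n * (rW η v - rW η (v - 2 * log n)) ^ 2 +
        2 * (L * (L / 10 ^ 6)) := by
    calc _ ≤ ∑ n ∈ Ioc 0 ⌊exp (L / 8)⌋₊,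
          selbergWt n * ((rW η v - rW η (v - 2 * log n)) ^ 2 + 30 / 10 ^ 6) := by
          refine sum_le_sum_of_subset_of_nonneg (fun n hn => ?_) fun n _ _ =>
            mul_nonneg (selbergWt_nonneg n) (by positivity)
          rw [mem_win] at hn
          exact mem_Ioc_exp.2 ⟨hn.1, by linarith [hn.2.2]⟩
      _ = ∑ n ∈ Ioc 0 ⌊exp (L / 8)⌋₊, selbergWt n * (rW η v - rW η (v - 2 * log n)) ^ 2 +
          (∑ n ∈ Ioc 0 ⌊exp (L / 8)⌋₊, selbergWt n) * (30 / 10 ^ 6) := by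
          rw [sum_mul, ← sum_add_distrib]
          exact sum_congr rfl fun n _ => mul_add _ _ _
      _ ≤ _ := by
          have := h.sum_selbergWt_le
          nlinarith
  rw [intervalIntegral.integral_const_mul] at hlow
  have h3 := (hlow.trans hmain).trans (mul_le_mul_of_nonneg_left hup hτ.le)
  rw [mul_assoc] at h3
  have h4 := le_of_mul_le_mul_left h3 hτ
  have h5 : (L / 16 - 1) * rW η v ^ 2 - 15 ≤
      ∫ u in (L / 16)..(L / 8 - 1), (rW η v - rW η (v - 2 * u)) ^ 2 := by
    have b1 : LocBdd fun u => 2 * rW η v * rW η (v - 2 * u) :=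
      (LocBdd.const _).mul (hr.comp_sub_mul 2 v)
    have hle := ((LocBdd.const (rW η v ^ 2)).sub b1).integral_mono hG
      (show L / 16 ≤ L / 8 - 1 by linarith) fun u _ => by nlinarith [sq_nonneg (rW η (v - 2 * u))]
    rw [(LocBdd.const _).integral_sub_eq b1, intervalIntegral.integral_const,
      intervalIntegral.integral_const_mul,
      intervalIntegral.integral_comp_sub_mul (fun u => rW η u) (by norm_num), smul_eq_mul,
      smul_eq_mul] at hle
    have hi := abs_integral_rW_le hη (h.η_le.trans (by norm_num))
      (show 0 ≤ v - 2 * (L / 8 - 1) by linarith)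
      (show v - 2 * (L / 8 - 1) ≤ v - 2 * (L / 16) by linarith)
    set I := ∫ u in (v - 2 * (L / 8 - 1))..(v - 2 * (L / 16)), rW η u
    have : rW η v * I ≤ (1 + 1 / 10 ^ 6) * 13 := by
      calc rW η v * I ≤ |rW η v * I| := le_abs_self _
        _ = |rW η v| * |I| := abs_mul _ _
        _ ≤ _ := mul_le_mul (abs_le.2 hR) hi (abs_nonneg _) (by norm_num)
    nlinarith
  exact (mul_le_mul_of_nonneg_left h5 (by linarith)).trans h4

theorem rW_ne (h : Scale L η τ) : rW η L ≠ -1 := by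
  intro hgap
  have hL := h.L_ge
  have hr := h.locBdd
  have hF : ∀ n : ℕ, LocBdd fun v => (rW η v - rW η (v - 2 * log n)) ^ 2 := fun a =>
    (hr.sub (hr.comp_sub _)).sq
  have hS := h.sum_meanSub_le hgap
  unfold meanSub at hS
  rw [← LocBdd.integral_sum_eq _ selbergWt hF] at hS
  have b0 := (LocBdd.const (L / 16 - 1)).mul hr.sq
  have b1 := LocBdd.sum (Ioc 0 ⌊exp (L / 8)⌋₊) fun n : ℕ =>
    (LocBdd.const (selbergWt n)).mul (hF n)
  have hle := ((LocBdd.const (L / 9)).mul (b0.sub (LocBdd.const 15))).integral_mono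
    (b1.add (LocBdd.const (2 * (L * (L / 10 ^ 6))))) (show L / 2 ≤ 3 * L / 4 by linarith)
    fun v hv => h.pointwise_lower hv.1 hv.2
  rw [b1.integral_add_eq (LocBdd.const _), intervalIntegral.integral_const_mul,
    b0.integral_sub_eq (LocBdd.const _), intervalIntegral.integral_const_mul,
    intervalIntegral.integral_const, intervalIntegral.integral_const, smul_eq_mul, smul_eq_mul]
    at hle
  have hI := h.le_integral_rW_sq hgap (a := L / 2) (b := 3 * L / 4) (by linarith) (by linarith)
    le_rfl
  have h1 : L / 9 * ((L / 17) * (L / 5)) ≤ L / 9 * ((L / 16 - 1) *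
      (∫ u in (L / 2)..(3 * L / 4), rW η u ^ 2) - (3 * L / 4 - L / 2) * 15) := by
    refine mul_le_mul_of_nonneg_left ?_ (by linarith)
    have : (2 * L / 33) * (2 * L / 9) ≤ (L / 16 - 1) * ∫ u in (L / 2)..(3 * L / 4), rW η u ^ 2 :=
      mul_le_mul (by linarith) (by linarith) (by positivity) (by linarith)
    nlinarith
  have h2 : L / 9 * ((L / 17) * (L / 5)) = L ^ 3 / 765 := by ring
  have h3 : (3 * L / 4 - L / 2) * (2 * (L * (L / 10 ^ 6))) + 120 * (L ^ 2 * (L / 10 ^ 6)) ≤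
      L ^ 3 / 1000 := by
    have : 0 ≤ L ^ 3 := by positivity
    nlinarith
  have : 0 < L ^ 3 := by positivity
  linarith

end Scale
end PrimeGap

namespace PrimeGap
open Real Finset Filter
open scoped ArithmeticFunction.Moebius ArithmeticFunction.vonMangoldt

/-- Prime powers in multiplicatively short intervals. -/
theorem exists_isPrimePow_log : ∃ δ : ℝ, 0 < δ ∧ ∃ L₀ : ℝ, ∀ L ≥ L₀, ∃ n : ℕ, IsPrimePow n ∧
    L < log n ∧ log n ≤ L + exp (-(δ * L)) := by
  obtain ⟨δ, hδ, L₀, h⟩ := exists_selberg (c := 1 / 10 ^ 6) (ε₁ := 1 / 10 ^ 12) (by norm_num)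
    (by norm_num) (by norm_num)
  have hδ2 : 0 < δ / 2 := by positivity
  have ht : ∀ᶠ L in atTop, exp (-(δ / 2 * L)) ≤ 1 / 10 ^ 6 := by
    have := tendsto_exp_neg_atTop_nhds_zero.comp (tendsto_id.const_mul_atTop hδ2)
    exact (this.eventually (ge_mem_nhds (show (0 : ℝ) < 1 / 10 ^ 6 by norm_num)))
  obtain ⟨L₁, hL₁⟩ := eventually_atTop.1 ht
  refine ⟨δ / 2, hδ2, max (max L₀ L₁) (10 ^ 12), fun L hL => ?_⟩
  have hL0 : L₀ ≤ L := (le_max_left _ _).trans ((le_max_left _ _).trans hL)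
  have hL1 : L₁ ≤ L := (le_max_right _ _).trans ((le_max_left _ _).trans hL)
  have hL2 : 10 ^ 12 ≤ L := (le_max_right _ _).trans hL
  have hη1 := hL₁ L hL1
  set η := exp (-(δ / 2 * L)) with hη
  have hη0 : 0 < η := exp_pos _
  have hsq : exp (-(δ * L)) = η * η := by rw [hη, ← exp_add]; congr 1; ring
  have hs : Scale L η (η / 10 ^ 6) := by
    refine ⟨hL2, hη0, hη1, rfl, fun v θ hθ h1 h2 => ?_⟩
    have hθ' : exp (-(δ * L)) ≤ θ ∧ θ ≤ 1 := by
      rw [hsq]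
      rcases hθ with rfl | rfl
      · exact ⟨by nlinarith, by linarith⟩
      · exact ⟨by nlinarith, by linarith⟩
    have := h L hL0 v θ (by linarith) h2 hθ'.1 hθ'.2
    rwa [show 1 / 10 ^ 12 * L = L / 10 ^ 12 by ring] at this
  by_contra hcon
  refine hs.rW_ne ?_
  have h0 : ∑ n ∈ win L η, Λ n / n = 0 := by
    refine sum_eq_zero fun n hn => ?_
    rw [mem_win] at hn
    rw [ArithmeticFunction.vonMangoldt_eq_zero_iff.2, zero_div]
    exact fun hp => hcon ⟨n, hp, hn.2.1, hn.2.2⟩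
  rw [rW, fW, h0]
  norm_num

lemma bddAbove_q (x : ℕ) : BddAbove {m : ℕ | (IsPrimePow m ∨ m = 1) ∧ m ≤ x} :=
  ⟨x, fun _ h => h.2⟩

lemma le_q {x n : ℕ} (hn : IsPrimePow n) (h : n ≤ x) : n ≤ q x := by
  have : n ∈ {m : ℕ | (IsPrimePow m ∨ m = 1) ∧ m ≤ x} := ⟨Or.inl hn, h⟩
  exact le_csSup (bddAbove_q x) this

lemma q_spec {x : ℕ} (hx : 1 ≤ x) : (IsPrimePow (q x) ∨ q x = 1) ∧ q x ≤ x := by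
  have : 1 ∈ {m : ℕ | (IsPrimePow m ∨ m = 1) ∧ m ≤ x} := ⟨Or.inr rfl, hx⟩
  exact Nat.sSup_mem ⟨1, this⟩ (bddAbove_q x)

lemma P_of_not {x : ℕ} (h : ¬(IsPrimePow x ∨ x = 1)) : P x = x - q x := by
  push Not at h
  rw [P, if_neg h.2, if_neg h.1]

lemma P_pos_lt {x : ℕ} (hx : 1 ≤ x) (h : ¬(IsPrimePow x ∨ x = 1)) : 1 ≤ P x ∧ P x < x := by
  have hq := q_spec hx
  have hne : q x ≠ x := fun e => h (e ▸ hq.1)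
  have hpos : 0 < q x := by
    rcases hq.1 with hp | hp
    exacts [hp.pos, by omega]
  rw [P_of_not h]
  omega

lemma exists_log_P_le : ∃ κ : ℝ, 0 < κ ∧ κ < 1 ∧ ∃ N : ℕ, 3 ≤ N ∧ ∀ x : ℕ, N ≤ x →
    ¬(IsPrimePow x ∨ x = 1) → log (P x) ≤ κ * log x := by
  obtain ⟨δ, hδ, L₀, h⟩ := exists_isPrimePow_log
  set d := min (δ / 2) (1 / 2) with hd
  have hd0 : 0 < d := lt_min (by positivity) (by norm_num)
  have hd1 : d ≤ 1 / 2 := min_le_right _ _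
  have hdδ : d ≤ δ / 2 := min_le_left _ _
  refine ⟨1 - d, by linarith, by linarith, ⌈exp (max (2 * L₀) 2)⌉₊ + 3, by omega,
    fun x hx hP => ?_⟩
  have hxR : exp (max (2 * L₀) 2) ≤ x := by
    refine (Nat.le_ceil _).trans ?_
    exact_mod_cast (by omega : ⌈exp (max (2 * L₀) 2)⌉₊ ≤ x)
  have hx0 : (0 : ℝ) < x := (exp_pos _).trans_le hxR
  have hx1 : 1 ≤ x := by exact_mod_cast hx0
  have hy := (le_log_iff_exp_le hx0).2 hxR
  set y := log x with hydef
  have hy1 : 2 * L₀ ≤ y := (le_max_left _ _).trans hy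
  have hy2 : 2 ≤ y := (le_max_right _ _).trans hy
  set t := exp (-(d * y)) with ht
  have ht0 : 0 < t := exp_pos _
  have ht1 : t ≤ 1 := exp_le_one_iff.2 (by nlinarith)
  obtain ⟨n, hn, hn1, hn2⟩ := h (y - t) (by linarith)
  have hexp : exp (-(δ * (y - t))) ≤ t := by
    rw [ht, exp_le_exp]
    have : δ / 2 * y ≤ δ * (y - t) := by nlinarith
    nlinarith
  have hn0 : (0 : ℝ) < n := by exact_mod_cast hn.pos
  have hnx : n ≤ x := by
    have : log n ≤ log x := by rw [← hydef]; linarith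
    exact_mod_cast (log_le_log_iff hn0 hx0).1 this
  have hq := le_q hn hnx
  have hlow : (x : ℝ) * (1 - t) ≤ n := by
    have h1 : exp (y - t) ≤ n := ((lt_log_iff_exp_lt hn0).1 hn1).le
    rw [sub_eq_add_neg, exp_add, hydef, exp_log hx0] at h1
    refine le_trans ?_ h1
    have := add_one_le_exp (-t)
    gcongr
    linarith
  have hPx := P_pos_lt hx1 hP
  have hle : (P x : ℝ) ≤ x * t := by
    have h2 : P x + n ≤ x := by
      rw [P_of_not hP]
      have := (q_spec hx1).2
      omega
    have h3 : (P x : ℝ) + n ≤ x := by exact_mod_cast h2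
    linarith
  calc log (P x) ≤ log (x * t) := log_le_log (by exact_mod_cast hPx.1) hle
    _ = y + -(d * y) := by rw [log_mul hx0.ne' ht0.ne', ht, log_exp]
    _ = (1 - d) * y := by ring

/-- The orbit of `x` settles within the first `N` terms. -/
def SettlesBy (x N : ℕ) : Prop :=
  ∃ n, 1 ≤ n ∧ n ≤ N ∧ (IsPrimePow (orbit x n) ∨ orbit x n = 1)

lemma SettlesBy.mono {x M N : ℕ} (h : SettlesBy x M) (hMN : M ≤ N) : SettlesBy x N := by
  obtain ⟨n, h1, h2, h3⟩ := h
  exact ⟨n, h1, h2.trans hMN, h3⟩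

lemma SettlesBy.succ {x N : ℕ} (h : SettlesBy (P x) N) : SettlesBy x (N + 1) := by
  obtain ⟨n, h1, h2, h3⟩ := h
  refine ⟨n + 1, by omega, by omega, ?_⟩
  have e : orbit x (n + 1) = orbit (P x) n := by
    obtain ⟨m, rfl⟩ : ∃ m, n = m + 1 := ⟨n - 1, by omega⟩
    simp [orbit]
  rwa [e]

lemma settlesBy_one {x : ℕ} (h : IsPrimePow x ∨ x = 1) : SettlesBy x 1 :=
  ⟨1, le_rfl, le_rfl, by simpa [orbit] using h⟩

lemma SettlesBy.S_le {x N : ℕ} (h : SettlesBy x N) : S x ≤ N := by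
  obtain ⟨n, h1, h2, h3⟩ := h
  have : n ∈ {n : ℕ | 1 ≤ n ∧ (IsPrimePow (orbit x n) ∨ orbit x n = 1)} := ⟨h1, h3⟩
  exact (Nat.sInf_le this).trans h2

lemma settlesBy_self {x : ℕ} (hx : 1 ≤ x) : SettlesBy x x := by
  induction x using Nat.strong_induction_on with
  | _ x ih =>
    by_cases h : IsPrimePow x ∨ x = 1
    · exact (settlesBy_one h).mono hx
    · obtain ⟨h1, h2⟩ := P_pos_lt hx h
      exact (ih _ h2 h1).succ.mono h2

lemma settlesBy_of_log_le {κ : ℝ} {N : ℕ} (hκ : 0 < κ) (hN : 3 ≤ N)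
    (h : ∀ x : ℕ, N ≤ x → ¬(IsPrimePow x ∨ x = 1) → log (P x) ≤ κ * log x) (k : ℕ) :
    ∀ x : ℕ, 1 ≤ x → κ ^ k * log x ≤ log N → SettlesBy x (N + k) := by
  induction k with
  | zero =>
    intro x hx hl
    have hxN : x ≤ N := by
      rw [pow_zero, one_mul] at hl
      exact_mod_cast (log_le_log_iff (by exact_mod_cast hx) (by exact_mod_cast (by omega))).1 hl
    exact (settlesBy_self hx).mono hxN
  | succ k ih =>
    intro x hx hl
    by_cases hxN : x ≤ N
    · exact (settlesBy_self hx).mono (by omega)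
    by_cases hp : IsPrimePow x ∨ x = 1
    · exact (settlesBy_one hp).mono (by omega)
    refine (ih (P x) (P_pos_lt hx hp).1 (le_trans ?_ hl)).succ
    rw [pow_succ, mul_assoc]
    exact mul_le_mul_of_nonneg_left (h x (by omega) hp) (by positivity)

end PrimeGap

theorem stmt_7 :
    ∃ C : ℝ, 0 < C ∧ ∃ x₀ : ℕ, 0 < x₀ ∧
      ∀ x : ℕ, x₀ ≤ x → (S x : ℝ) ≤ C * Real.log (Real.log x) := by
  obtain ⟨κ, hκ, hκ1, N, hN, h⟩ := PrimeGap.exists_log_P_le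
  have hc : 0 < Real.log κ⁻¹ := Real.log_pos ((one_lt_inv₀ hκ).2 hκ1)
  refine ⟨N + 1 + (Real.log κ⁻¹)⁻¹, by positivity, ⌈Real.exp (Real.exp 1)⌉₊ + 1, by omega,
    fun x hx => ?_⟩
  have hxR : Real.exp (Real.exp 1) ≤ x := by
    refine (Nat.le_ceil _).trans ?_
    exact_mod_cast (by omega : ⌈Real.exp (Real.exp 1)⌉₊ ≤ x)
  have hx0 : (0 : ℝ) < x := (Real.exp_pos _).trans_le hxR
  have hy := (Real.le_log_iff_exp_le hx0).2 hxR
  have hy0 : 0 < Real.log x := (Real.exp_pos _).trans_le hy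
  have hz := (Real.le_log_iff_exp_le hy0).2 hy
  set z := Real.log (Real.log x) with hzdef
  set k := ⌈z / Real.log κ⁻¹⌉₊ with hk
  have hk1 : z ≤ k * Real.log κ⁻¹ := (div_le_iff₀ hc).1 (Nat.le_ceil _)
  have hk2 : (k : ℝ) ≤ z / Real.log κ⁻¹ + 1 := (Nat.ceil_lt_add_one (by positivity)).le
  have hpow : κ ^ k * Real.log x ≤ 1 := by
    have e : κ ^ k = Real.exp (-(k * Real.log κ⁻¹)) := by
      rw [Real.log_inv, mul_neg, neg_neg, ← Real.log_pow, Real.exp_log (by positivity)]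
    have e2 : Real.log x = Real.exp z := (Real.exp_log hy0).symm
    rw [e, e2, ← Real.exp_add]
    exact Real.exp_le_one_iff.2 (by linarith)
  have hlogN : 1 ≤ Real.log N := by
    rw [Real.le_log_iff_exp_le (by exact_mod_cast (by omega))]
    have : (3 : ℝ) ≤ N := by exact_mod_cast hN
    linarith [Real.exp_one_lt_d9]
  have hS := (PrimeGap.settlesBy_of_log_le hκ hN h k x (by exact_mod_cast hx0)
    (hpow.trans hlogN)).S_le
  have hS' : (S x : ℝ) ≤ N + k := by exact_mod_cast hS
  have hN0 : (0 : ℝ) ≤ N := Nat.cast_nonneg N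
  have : z / Real.log κ⁻¹ = (Real.log κ⁻¹)⁻¹ * z := by rw [div_eq_inv_mul]
  nlinarith
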